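/- Let 1 < p < ∞, let W be a matrix A_p weight on ℝ^d with reducing operators V_I, fix I_0 ∈ 𝒟, let 𝒥 be the stopping time where 𝒥(I) consists of the maximal dyadic subcubes J of I with ‖V_J V_I^{−1}‖^p > λ₁ or ‖V_J^{−1} V_I‖^{p'} > λ₂, with λ₁, λ₂ chosen as in the decay lemma (λ₁ depending only on n, d, p and λ₂ ≈ ‖W‖_{A_p}^{p'/p}), and define T_j f⃗ := ∑_{I ∈ ℱ^j} ∑_{ε ∈ 𝒮} W^{1/p} V_I^{−1} f⃗_I^ε h_I^ε. Then there exist constants C > 0 and C' > 1, depending only on p, n, d and independent of W and I_0, such that for every f⃗ with finite Haar expansion and all integers k > j ≥ 1, ∫_{ℝ^d} |T_k f⃗(x)|^{p/2} |T_j f⃗(x)|^{p/2} dx ≤ C ‖W‖_{A_p} 2^{−(k−j−1)/(2(p C' ‖W‖_{A_p} + 1))} ‖Δ_j f⃗‖_{L^p}^{p/2} ‖Δ_k f⃗‖_{L^p}^{p/2}. -/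

import Mathlib

open MeasureTheory ENNReal
open scoped ComplexOrder

noncomputable section

/-! ## Basic linear-algebra notation -/

/-- The operator norm of an `n × n` complex matrix, viewed as an operator on the
Euclidean space `ℂⁿ`. -/
def matNorm {n : ℕ} (M : Matrix (Fin n) (Fin n) ℂ) : ℝ :=
  ‖Matrix.toEuclideanCLM (𝕜 := ℂ) (n := Fin n) M‖

/-- A matrix applied to a vector of `ℂⁿ` (with its Euclidean norm). -/
def mApp {n : ℕ} (M : Matrix (Fin n) (Fin n) ℂ) (v : EuclideanSpace ℂ (Fin n)) :
    EuclideanSpace ℂ (Fin n) :=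
  Matrix.toEuclideanCLM (𝕜 := ℂ) (n := Fin n) M v


/-- Entrywise measurability of a matrix-valued function. -/
def MatMeasurable {d n : ℕ} (W : (Fin d → ℝ) → Matrix (Fin n) (Fin n) ℂ) : Prop :=
  ∀ i j, Measurable fun x => W x i j

/-! ## Dyadic cubes and Haar functions -/

/-- A dyadic cube in `ℝ^d`, with side length `2^k` and lower-left corner `(m i * 2^k)_i`. -/
structure DCube (d : ℕ) where
  k : ℤ
  m : Fin d → ℤ

namespace DCube

variable {d : ℕ}

/-- The (half-open) cube in `ℝ^d` determined by a dyadic cube. -/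
def set (I : DCube d) : Set (Fin d → ℝ) :=
  {x | ∀ i, (I.m i : ℝ) * 2 ^ I.k ≤ x i ∧ x i < ((I.m i : ℝ) + 1) * 2 ^ I.k}

/-- The volume `|I| = (2^k)^d` of a dyadic cube. -/
def vol (I : DCube d) : ℝ := ((2 : ℝ) ^ I.k) ^ d

/-- The lower-left corner of a dyadic cube. -/
def corner (I : DCube d) : Fin d → ℝ := fun i => (I.m i : ℝ) * 2 ^ I.k

/-- The side length of a dyadic cube. -/
def side (I : DCube d) : ℝ := (2 : ℝ) ^ I.k

end DCube

/-- One-dimensional Haar functions on the dyadic interval `[m·2^k, (m+1)·2^k)`: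
`haar1D true` is the non-cancellative `|I|^{-1/2} χ_I`, while `haar1D false` is
`|I|^{-1/2} (χ_{I_ℓ} - χ_{I_r})`. -/
def haar1D (ε : Bool) (k mm : ℤ) (t : ℝ) : ℝ :=
  if ε then
    Set.indicator {s : ℝ | (mm : ℝ) * 2 ^ k ≤ s ∧ s < ((mm : ℝ) + 1) * 2 ^ k}
      (fun _ => ((2 : ℝ) ^ k) ^ (-(1 / 2 : ℝ))) t
  else
    Set.indicator {s : ℝ | (mm : ℝ) * 2 ^ k ≤ s ∧ s < (mm : ℝ) * 2 ^ k + 2 ^ (k - 1)}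
      (fun _ => ((2 : ℝ) ^ k) ^ (-(1 / 2 : ℝ))) t -
    Set.indicator {s : ℝ | (mm : ℝ) * 2 ^ k + 2 ^ (k - 1) ≤ s ∧ s < ((mm : ℝ) + 1) * 2 ^ k}
      (fun _ => ((2 : ℝ) ^ k) ^ (-(1 / 2 : ℝ))) t

/-- The signature set `𝒮 = {0,1}^d \ {(1,…,1)}` indexing the cancellative Haar functions. -/
def Sfin (d : ℕ) : Finset (Fin d → Bool) := Finset.univ.erase (fun _ => true)

/-- The Haar function `h_I^ε = ∏ i, h_{I_i}^{ε_i}` associated to a dyadic cube `I ⊂ ℝ^d`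
and a signature `ε ∈ {0,1}^d`. -/
def haarFn {d : ℕ} (I : DCube d) (ε : Fin d → Bool) (x : Fin d → ℝ) : ℝ :=
  ∏ i, haar1D (ε i) I.k (I.m i) (x i)

/-- The (vector of) Haar coefficients `f_I^ε = ∫ f h_I^ε` of a `ℂⁿ`-valued function. -/
def haarCoef {d n : ℕ} (f : (Fin d → ℝ) → EuclideanSpace ℂ (Fin n)) (I : DCube d)
    (ε : Fin d → Bool) : EuclideanSpace ℂ (Fin n) :=
  ∫ x, haarFn I ε x • f x

/-! ## Matrix `A_p` weights and reducing operators -/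

/-- The (closed, axis-parallel) cube with corner `c` and side length `r`. -/
def cubeSet {d : ℕ} (c : Fin d → ℝ) (r : ℝ) : Set (Fin d → ℝ) :=
  {x | ∀ i, c i ≤ x i ∧ x i ≤ c i + r}

/-- The matrix `A_p` characteristic `‖W‖_{A_p}` of a matrix weight `W`, expressed in terms of
`W1p = W^{1/p}` (so that `W^{-1/p} = (W1p)⁻¹`):
`sup_I (1/|I|) ∫_I ((1/|I|) ∫_I ‖W^{1/p}(x) W^{-1/p}(t)‖^{p'} dt)^{p/p'} dx`,
the supremum being over all cubes `I ⊂ ℝ^d`.  Here `p' = p/(p-1)` and `p/p' = p - 1`. -/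
def apNorm {d n : ℕ} (p : ℝ) (W1p : (Fin d → ℝ) → Matrix (Fin n) (Fin n) ℂ) : ℝ≥0∞ :=
  ⨆ (c : Fin d → ℝ) (r : ℝ) (_ : 0 < r),
    (ENNReal.ofReal (r ^ d))⁻¹ *
      ∫⁻ x in cubeSet c r,
        ((ENNReal.ofReal (r ^ d))⁻¹ *
            ∫⁻ t in cubeSet c r,
              ENNReal.ofReal (matNorm (W1p x * (W1p t)⁻¹)) ^ (p / (p - 1))) ^ (p - 1)

/-- The `L^q` average `(|I|^{-1} ∫_I ‖A(x) e‖^q dx)^{1/q}` over a dyadic cube. -/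
def redAvgD {d n : ℕ} (q : ℝ) (A : (Fin d → ℝ) → Matrix (Fin n) (Fin n) ℂ) (I : DCube d)
    (e : EuclideanSpace ℂ (Fin n)) : ℝ≥0∞ :=
  ((ENNReal.ofReal I.vol)⁻¹ * ∫⁻ x in I.set, ENNReal.ofReal ‖mApp (A x) e‖ ^ q) ^ (1 / q)

/-- `V` is a family of reducing operators for the weight `W = (W1p)^p` (indexed by dyadic
cubes), with comparability constants `c₁, c₂`:  each `V I` is positive definite and
`|V_I e| ≈ (|I|^{-1} ∫_I |W^{1/p}(x) e|^p dx)^{1/p}`. -/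
def IsReducing {d n : ℕ} (p c₁ c₂ : ℝ) (W1p : (Fin d → ℝ) → Matrix (Fin n) (Fin n) ℂ)
    (V : DCube d → Matrix (Fin n) (Fin n) ℂ) : Prop :=
  ∀ I : DCube d, (V I).PosDef ∧ ∀ e : EuclideanSpace ℂ (Fin n),
    ENNReal.ofReal c₁ * redAvgD p W1p I e ≤ ENNReal.ofReal ‖mApp (V I) e‖ ∧
    ENNReal.ofReal ‖mApp (V I) e‖ ≤ ENNReal.ofReal c₂ * redAvgD p W1p I e

/-- `V'` is a family of dual reducing operators for the weight `W = (W1p)^p`: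
`|V_I' e| ≈ (|I|^{-1} ∫_I |W^{-1/p}(x) e|^{p'} dx)^{1/p'}` with `p' = p/(p-1)`. -/
def IsDualReducing {d n : ℕ} (p c₁ c₂ : ℝ) (W1p : (Fin d → ℝ) → Matrix (Fin n) (Fin n) ℂ)
    (V' : DCube d → Matrix (Fin n) (Fin n) ℂ) : Prop :=
  ∀ I : DCube d, (V' I).PosDef ∧ ∀ e : EuclideanSpace ℂ (Fin n),
    ENNReal.ofReal c₁ * redAvgD (p / (p - 1)) (fun x => (W1p x)⁻¹) I e ≤
        ENNReal.ofReal ‖mApp (V' I) e‖ ∧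
    ENNReal.ofReal ‖mApp (V' I) e‖ ≤
        ENNReal.ofReal c₂ * redAvgD (p / (p - 1)) (fun x => (W1p x)⁻¹) I e

/-- The `L^p(W)` norm `(∫ |W^{1/p}(x) f(x)|^p dx)^{1/p}` (as a value in `[0,∞]`). -/
def wNorm {d n : ℕ} (p : ℝ) (W1p : (Fin d → ℝ) → Matrix (Fin n) (Fin n) ℂ)
    (f : (Fin d → ℝ) → EuclideanSpace ℂ (Fin n)) : ℝ≥0∞ :=
  (∫⁻ x, ENNReal.ofReal ‖mApp (W1p x) (f x)‖ ^ p) ^ (1 / p)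

/-- The square-function expression
`∑_{I ∈ 𝒟} ∑_{ε ∈ 𝒮} |A_I f_I^ε|² |I|^{-1} χ_I(x)` for a family of matrices `A_I`. -/
def sqFn {d n : ℕ} (A : DCube d → Matrix (Fin n) (Fin n) ℂ)
    (f : (Fin d → ℝ) → EuclideanSpace ℂ (Fin n)) (x : Fin d → ℝ) : ℝ≥0∞ :=
  ∑' I : DCube d, ∑ ε ∈ Sfin d,
    Set.indicator I.set
      (fun _ => ENNReal.ofReal (‖mApp (A I) (haarCoef f I ε)‖ ^ 2) / ENNReal.ofReal I.vol) x

/-! ## Stopping times -/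

/-- A stopping time assigns to each dyadic cube `I` a collection `𝒥 I` of pairwise disjoint
dyadic subcubes of `I`. -/
def IsStopping {d : ℕ} (𝒥 : DCube d → Set (DCube d)) : Prop :=
  ∀ I : DCube d, (∀ J ∈ 𝒥 I, J.set ⊆ I.set) ∧
    (𝒥 I).Pairwise fun J K => Disjoint J.set K.set

/-- `ℱ(I)`: the dyadic subcubes of `I` not contained in any stopping cube `J ∈ 𝒥(I)`. -/
def Fcol {d : ℕ} (𝒥 : DCube d → Set (DCube d)) (I : DCube d) : Set (DCube d) :=
  {J | J.set ⊆ I.set ∧ ∀ K ∈ 𝒥 I, ¬J.set ⊆ K.set}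

/-- A stopping time is admissible if `I ∈ ℱ(I)` for every `I`. -/
def Admissible {d : ℕ} (𝒥 : DCube d → Set (DCube d)) : Prop :=
  ∀ I : DCube d, I ∈ Fcol 𝒥 I

/-- The iterated stopping collections: `𝒥^0(I) = {I}` and
`𝒥^{j+1}(I) = ⋃_{J ∈ 𝒥^j(I)} 𝒥(J)`. -/
def JIter {d : ℕ} (𝒥 : DCube d → Set (DCube d)) : ℕ → DCube d → Set (DCube d)
  | 0, I => {I}
  | j + 1, I => ⋃ J ∈ JIter 𝒥 j I, 𝒥 J

/-- A stopping time is decaying with constant `c` if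
`∑_{J ∈ 𝒥(I)} |J| ≤ c |I|` for every `I`. -/
def Decaying {d : ℕ} (c : ℝ) (𝒥 : DCube d → Set (DCube d)) : Prop :=
  ∀ I : DCube d,
    ∑' J : 𝒥 I, ENNReal.ofReal (J : DCube d).vol ≤ ENNReal.ofReal c * ENNReal.ofReal I.vol

/-- `ℱ^j = ℱ^j(I₀) = ⋃_{J ∈ 𝒥^{j-1}(I₀)} ℱ(J)` (intended for `j ≥ 1`). -/
def Fj {d : ℕ} (𝒥 : DCube d → Set (DCube d)) (I₀ : DCube d) (j : ℕ) : Set (DCube d) :=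
  ⋃ J ∈ JIter 𝒥 (j - 1) I₀, Fcol 𝒥 J

/-- The Haar projection `Δ_j f = ∑_{I ∈ ℱ^j} ∑_{ε ∈ 𝒮} f_I^ε h_I^ε`. -/
def deltaHaar {d n : ℕ} (𝒥 : DCube d → Set (DCube d)) (I₀ : DCube d) (j : ℕ)
    (f : (Fin d → ℝ) → EuclideanSpace ℂ (Fin n)) (x : Fin d → ℝ) :
    EuclideanSpace ℂ (Fin n) :=
  ∑' I : Fj 𝒥 I₀ j, ∑ ε ∈ Sfin d, haarFn (I : DCube d) ε x • haarCoef f (I : DCube d) ε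

/-! ## Constant Haar multipliers -/

/-- `∑_{I ∈ S} ∑_{ε ∈ 𝒮} V_I^{-1} f_I^ε h_I^ε(x)`. -/
def projInv {d n : ℕ} (V : DCube d → Matrix (Fin n) (Fin n) ℂ) (S : Set (DCube d))
    (f : (Fin d → ℝ) → EuclideanSpace ℂ (Fin n)) (x : Fin d → ℝ) :
    EuclideanSpace ℂ (Fin n) :=
  ∑' I : S, ∑ ε ∈ Sfin d,
    haarFn (I : DCube d) ε x • mApp ((V (I : DCube d))⁻¹) (haarCoef f (I : DCube d) ε)

/-- A function has finite Haar expansion if it is a finite sum of Haar functions. -/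
def FiniteHaar {d n : ℕ} (f : (Fin d → ℝ) → EuclideanSpace ℂ (Fin n)) : Prop :=
  ∃ F : Finset (DCube d × (Fin d → Bool)),
    ∀ x, f x = ∑ q ∈ F, haarFn q.1 q.2 x • haarCoef f q.1 q.2

/-! ## The weighted stopping time -/

/-- The stopping condition `‖V_J V_I^{-1}‖^p > λ₁` or `‖V_J^{-1} V_I‖^{p'} > λ₂`. -/
def stopBad {d n : ℕ} (p l₁ l₂ : ℝ) (V : DCube d → Matrix (Fin n) (Fin n) ℂ)
    (J I : DCube d) : Prop :=
  l₁ < matNorm (V J * (V I)⁻¹) ^ p ∨ l₂ < matNorm ((V J)⁻¹ * V I) ^ (p / (p - 1))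

/-- The stopping time `𝒥(I)` = maximal dyadic subcubes `J ⊆ I` satisfying `stopBad`. -/
def stopST {d n : ℕ} (p l₁ l₂ : ℝ) (V : DCube d → Matrix (Fin n) (Fin n) ℂ)
    (I : DCube d) : Set (DCube d) :=
  {J | J.set ⊆ I.set ∧ stopBad p l₁ l₂ V J I ∧
    ∀ K : DCube d, K.set ⊆ I.set → stopBad p l₁ l₂ V K I → J.set ⊆ K.set → K = J}



/-! ## Matrices acting on `ℂⁿ` -/

section Matrices

variable {n : ℕ}

lemma mApp_zero (M : Matrix (Fin n) (Fin n) ℂ) :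
    mApp M (0 : EuclideanSpace ℂ (Fin n)) = 0 := by
  simp [mApp]

lemma mApp_smul_real (M : Matrix (Fin n) (Fin n) ℂ) (a : ℝ) (v : EuclideanSpace ℂ (Fin n)) :
    mApp M (a • v) = a • mApp M v := by
  simp [mApp]

lemma mApp_sum {ι : Type*} (M : Matrix (Fin n) (Fin n) ℂ) (s : Finset ι)
    (v : ι → EuclideanSpace ℂ (Fin n)) :
    mApp M (∑ i ∈ s, v i) = ∑ i ∈ s, mApp M (v i) := by
  simp [mApp]

lemma mApp_mul (A B : Matrix (Fin n) (Fin n) ℂ) (v : EuclideanSpace ℂ (Fin n)) :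
    mApp (A * B) v = mApp A (mApp B v) := by
  simp [mApp]

lemma mApp_one (v : EuclideanSpace ℂ (Fin n)) : mApp 1 v = v := by
  simp [mApp]

lemma matNorm_nonneg (M : Matrix (Fin n) (Fin n) ℂ) : 0 ≤ matNorm M := norm_nonneg _

lemma norm_mApp_le (M : Matrix (Fin n) (Fin n) ℂ) (v : EuclideanSpace ℂ (Fin n)) :
    ‖mApp M v‖ ≤ matNorm M * ‖v‖ :=
  ContinuousLinearMap.le_opNorm _ v

lemma matNorm_mul_le (A B : Matrix (Fin n) (Fin n) ℂ) :
    matNorm (A * B) ≤ matNorm A * matNorm B := by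
  unfold matNorm
  rw [map_mul]
  exact norm_mul_le _ _

lemma matNorm_conjTranspose (M : Matrix (Fin n) (Fin n) ℂ) :
    matNorm M.conjTranspose = matNorm M := by
  unfold matNorm
  rw [← Matrix.star_eq_conjTranspose, map_star, ContinuousLinearMap.star_eq_adjoint]
  exact LinearIsometryEquiv.norm_map _ _

lemma inner_mApp {M : Matrix (Fin n) (Fin n) ℂ} (hM : M.IsHermitian)
    (u v : EuclideanSpace ℂ (Fin n)) : inner ℂ (mApp M u) v = inner ℂ u (mApp M v) := by
  unfold mApp
  have h : ContinuousLinearMap.adjoint (Matrix.toEuclideanCLM (𝕜 := ℂ) (n := Fin n) M) =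
      Matrix.toEuclideanCLM (𝕜 := ℂ) (n := Fin n) M := by
    rw [← ContinuousLinearMap.star_eq_adjoint, ← map_star, Matrix.star_eq_conjTranspose, hM.eq]
  conv_lhs => rw [← h]
  exact ContinuousLinearMap.adjoint_inner_left _ _ _

lemma mApp_inv_mApp {M : Matrix (Fin n) (Fin n) ℂ} (hM : M.PosDef)
    (v : EuclideanSpace ℂ (Fin n)) : mApp M⁻¹ (mApp M v) = v := by
  rw [← mApp_mul, Matrix.nonsing_inv_mul _ ((Matrix.isUnit_iff_isUnit_det _).1 hM.isUnit), mApp_one]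

lemma mApp_mApp_inv {M : Matrix (Fin n) (Fin n) ℂ} (hM : M.PosDef)
    (v : EuclideanSpace ℂ (Fin n)) : mApp M (mApp M⁻¹ v) = v := by
  rw [← mApp_mul, Matrix.mul_nonsing_inv _ ((Matrix.isUnit_iff_isUnit_det _).1 hM.isUnit), mApp_one]

lemma matNorm_le_sum (M : Matrix (Fin n) (Fin n) ℂ) :
    matNorm M ≤ ∑ i, ‖mApp M (EuclideanSpace.single i 1)‖ := by
  refine ContinuousLinearMap.opNorm_le_bound _ (Finset.sum_nonneg fun _ _ => norm_nonneg _) ?_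
  intro v
  have hv : v = ∑ i, v i • EuclideanSpace.single i (1 : ℂ) := by
    ext j
    simp [Pi.single_apply]
  conv_lhs => rw [hv, map_sum]
  rw [Finset.sum_mul]
  refine (norm_sum_le _ _).trans (Finset.sum_le_sum fun i _ => ?_)
  rw [map_smul, norm_smul, mul_comm]
  exact mul_le_mul_of_nonneg_left (PiLp.norm_apply_le v i) (norm_nonneg _)

lemma matNorm_rpow_le_sum (M : Matrix (Fin n) (Fin n) ℂ) {q : ℝ} (hq : 0 < q) :
    matNorm M ^ q ≤ (n : ℝ) ^ q * ∑ i, ‖mApp M (EuclideanSpace.single i 1)‖ ^ q := by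
  set S := ∑ i, ‖mApp M (EuclideanSpace.single i 1)‖ ^ q with hS
  have hS0 : 0 ≤ S := Finset.sum_nonneg fun _ _ => by positivity
  have h1 : matNorm M ≤ n * S ^ q⁻¹ := by
    refine (matNorm_le_sum M).trans ?_
    calc ∑ i, ‖mApp M (EuclideanSpace.single i 1)‖ ≤ ∑ _i : Fin n, S ^ q⁻¹ := by
          refine Finset.sum_le_sum fun i _ => ?_
          rw [Real.le_rpow_inv_iff_of_pos (norm_nonneg _) hS0 hq]
          exact Finset.single_le_sum (f := fun i => ‖mApp M (EuclideanSpace.single i 1)‖ ^ q)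
            (fun _ _ => by positivity) (Finset.mem_univ i)
      _ = n * S ^ q⁻¹ := by simp
  calc matNorm M ^ q ≤ (n * S ^ q⁻¹) ^ q := Real.rpow_le_rpow (matNorm_nonneg _) h1 hq.le
    _ = n ^ q * S := by
      rw [Real.mul_rpow (by positivity) (by positivity), Real.rpow_inv_rpow hS0 hq.ne']

lemma MatMeasurable.inv {d : ℕ} {W : (Fin d → ℝ) → Matrix (Fin n) (Fin n) ℂ}
    (hW : MatMeasurable W) : MatMeasurable fun x => (W x)⁻¹ := by
  have hdet : ∀ {U : (Fin d → ℝ) → Matrix (Fin n) (Fin n) ℂ}, MatMeasurable U →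
      Measurable fun x => (U x).det := by
    intro U hU
    simp only [Matrix.det_apply]
    exact Finset.measurable_sum _ fun σ _ =>
      (Finset.measurable_prod _ fun i _ => hU _ _).const_smul _
  intro i j
  simp only [Matrix.inv_def, Matrix.smul_apply, smul_eq_mul, Ring.inverse_eq_inv',
    Matrix.adjugate_apply]
  refine (hdet hW).inv.mul (hdet fun a b => ?_)
  by_cases h : a = j
  · subst h; simp
  · simpa [Matrix.updateRow_apply, h] using hW a b

lemma MatMeasurable.mul {d : ℕ} {U W : (Fin d → ℝ) → Matrix (Fin n) (Fin n) ℂ}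
    (hU : MatMeasurable U) (hW : MatMeasurable W) : MatMeasurable fun x => U x * W x := by
  intro i j
  simp only [Matrix.mul_apply]
  exact Finset.measurable_sum _ fun k _ => (hU i k).mul (hW k j)

lemma measurable_mApp {d : ℕ} {W : (Fin d → ℝ) → Matrix (Fin n) (Fin n) ℂ}
    (hW : MatMeasurable W) {v : (Fin d → ℝ) → EuclideanSpace ℂ (Fin n)} (hv : Measurable v) :
    Measurable fun x => mApp (W x) (v x) := by
  have h : (fun x => mApp (W x) (v x)) =
      fun x => WithLp.toLp 2 (fun i => ∑ j, W x i j * v x j) := by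
    funext x
    ext i
    have hv : v x = WithLp.toLp 2 (v x).ofLp := rfl
    unfold mApp
    conv_lhs => rw [hv, Matrix.toEuclideanCLM_toLp]
    simp [Matrix.mulVec, dotProduct]
  rw [h]
  refine (WithLp.measurable_toLp 2 _).comp (measurable_pi_lambda _ fun i => ?_)
  refine Finset.measurable_sum _ fun j _ => (hW i j).mul ?_
  exact (measurable_pi_apply j).comp ((WithLp.measurable_ofLp 2 _).comp hv)

lemma measurable_matNorm {d : ℕ} {W : (Fin d → ℝ) → Matrix (Fin n) (Fin n) ℂ}
    (hW : MatMeasurable W) : Measurable fun x => matNorm (W x) := by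
  have h : Continuous fun M : Matrix (Fin n) (Fin n) ℂ => matNorm M := by
    unfold matNorm
    exact continuous_norm.comp (LinearMap.continuous_of_finiteDimensional
      ((Matrix.toEuclideanCLM (𝕜 := ℂ) (n := Fin n)).toAlgEquiv.toLinearMap))
  have h' : Continuous fun M : Fin n → Fin n → ℂ => matNorm (Matrix.of M) := h
  exact h'.measurable.comp (measurable_pi_lambda _ fun i => measurable_pi_lambda _ fun j => hW i j)

end Matrices

/-! ## Burkholder's function -/

section Burkholder

variable {H : Type*} [NormedAddCommGroup H]

/-- Burkholder's function up to normalisation. -/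
def burkholderFn (p α β : ℝ) (x y : H) : ℝ :=
  (‖x‖ + ‖y‖) ^ (p - 1) * (α * ‖y‖ - β * ‖x‖)

lemma continuous_burkholderFn {p : ℝ} (hp : 1 < p) (α β : ℝ) :
    Continuous fun z : H × H => burkholderFn p α β z.1 z.2 := by
  unfold burkholderFn
  refine Continuous.mul (Continuous.rpow_const (by fun_prop) fun _ => Or.inr (by linarith)) ?_
  fun_prop

lemma norm_rpow_le_burkholderFn {p α β : ℝ} (hp : 1 < p) (hα : 0 < α) (hβ : 0 < β) (x y : H) :
    ‖y‖ ^ p ≤ ((2 * β / α) ^ p + 2 / α * (β * (1 + 2 * β / α) ^ (p - 1))) * ‖x‖ ^ p +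
      2 / α * burkholderFn p α β x y := by
  have hx := norm_nonneg x
  have hy := norm_nonneg y
  have hp1 : 0 ≤ p - 1 := by linarith
  have pw : ∀ {s : ℝ}, 0 ≤ s → s ^ p = s ^ (p - 1) * s := by
    intro s hs
    rcases hs.eq_or_lt with h | h
    · subst h; rw [Real.zero_rpow (by linarith), mul_zero]
    · rw [← Real.rpow_add_one h.ne']; ring_nf
  by_cases h : 2 * β * ‖x‖ ≤ α * ‖y‖
  · have h1 : ‖y‖ ^ (p - 1) * (α / 2 * ‖y‖) ≤ burkholderFn p α β x y := by
      unfold burkholderFn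
      apply mul_le_mul
      · exact Real.rpow_le_rpow hy (by linarith) hp1
      · linarith
      · positivity
      · positivity
    have h2 : ‖y‖ ^ p = 2 / α * (‖y‖ ^ (p - 1) * (α / 2 * ‖y‖)) := by
      rw [pw hy]; field_simp
    have h3 := mul_le_mul_of_nonneg_left h1 (show 0 ≤ 2 / α by positivity)
    have : 0 ≤ ((2 * β / α) ^ p + 2 / α * (β * (1 + 2 * β / α) ^ (p - 1))) * ‖x‖ ^ p := by
      positivity
    linarith
  · push Not at h
    have hyx : ‖y‖ ≤ 2 * β / α * ‖x‖ := by
      rw [div_mul_eq_mul_div, le_div_iff₀ hα]; linarith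
    have h1 : ‖y‖ ^ p ≤ (2 * β / α) ^ p * ‖x‖ ^ p := by
      rw [← Real.mul_rpow (by positivity) hx]
      exact Real.rpow_le_rpow hy hyx (by linarith)
    have h2 : (‖x‖ + ‖y‖) ^ (p - 1) ≤ (1 + 2 * β / α) ^ (p - 1) * ‖x‖ ^ (p - 1) := by
      rw [← Real.mul_rpow (by positivity) hx]
      exact Real.rpow_le_rpow (by positivity) (by linarith) hp1
    have h3 : -(β * (1 + 2 * β / α) ^ (p - 1) * ‖x‖ ^ p) ≤ burkholderFn p α β x y := by
      unfold burkholderFn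
      rw [pw hx]
      have a1 : 0 ≤ (‖x‖ + ‖y‖) ^ (p - 1) * (α * ‖y‖) := by positivity
      have a2 := mul_le_mul_of_nonneg_right h2 (show 0 ≤ β * ‖x‖ by positivity)
      linarith
    have h4 := mul_le_mul_of_nonneg_left h3 (show 0 ≤ 2 / α by positivity)
    linarith

variable [InnerProductSpace ℝ H]

open scoped RealInnerProductSpace

lemma inner_normalized_le (x z : H) : ⟪‖x‖⁻¹ • x, z⟫ ≤ ‖z‖ := by
  refine (real_inner_le_norm _ _).trans ?_
  rw [norm_smul, norm_inv, norm_norm]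
  exact mul_le_of_le_one_left (norm_nonneg _) (inv_mul_le_one)

lemma inner_normalized_self (x : H) : ⟪‖x‖⁻¹ • x, x⟫ = ‖x‖ := by
  rw [real_inner_smul_left, real_inner_self_eq_norm_sq, sq]
  by_cases h : ‖x‖ = 0
  · simp [h]
  · field_simp

/-- The building block of Burkholder's function for `1 < p < 2`. -/
def weakLow (t : ℝ) (x y : H) : ℝ :=
  if ‖x‖ + ‖y‖ < t then ‖y‖ ^ 2 - ‖x‖ ^ 2 else t ^ 2 - 2 * t * ‖x‖

/-- The building block of Burkholder's function for `p > 2`. -/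
def weakHigh (t : ℝ) (x y : H) : ℝ :=
  if ‖x‖ + ‖y‖ ≤ t then 0 else (‖y‖ - t) ^ 2 - ‖x‖ ^ 2

lemma weakLow_add_le {t : ℝ} (ht : 0 < t) (x y d e : H) (hde : ‖e‖ ≤ ‖d‖) :
    weakLow t (x + d) (y + e) ≤ weakLow t x y +
      if ‖x‖ + ‖y‖ < t then 2 * ⟪y, e⟫ - 2 * ⟪x, d⟫ else -(2 * t * ⟪‖x‖⁻¹ • x, d⟫) := by
  have hx' : ‖x + d‖ ^ 2 = ‖x‖ ^ 2 + 2 * ⟪x, d⟫ + ‖d‖ ^ 2 := norm_add_sq_real x d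
  have hy' : ‖y + e‖ ^ 2 = ‖y‖ ^ 2 + 2 * ⟪y, e⟫ + ‖e‖ ^ 2 := norm_add_sq_real y e
  have hde2 : ‖e‖ ^ 2 ≤ ‖d‖ ^ 2 := by gcongr
  have hxi : ⟪‖x‖⁻¹ • x, x + d⟫ ≤ ‖x + d‖ := inner_normalized_le _ _
  rw [inner_add_right, inner_normalized_self] at hxi
  have n1 := norm_nonneg (x + d)
  have n2 := norm_nonneg (y + e)
  have n3 := norm_nonneg y
  unfold weakLow
  by_cases h : ‖x‖ + ‖y‖ < t
  · simp only [h, if_true]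
    split_ifs with h'
    · linarith
    · by_cases h2 : t ≤ ‖x + d‖ ∧ ‖y + e‖ ≤ ‖x + d‖ - t
      · have hd : ‖x + d‖ ≤ ‖x‖ + ‖d‖ := norm_add_le _ _
        have hye : -(‖y‖ * ‖d‖) ≤ ⟪y, e⟫ := by
          have := neg_le_of_abs_le (abs_real_inner_le_norm y e)
          have := mul_le_mul_of_nonneg_left hde n3
          linarith
        nlinarith [h2.1, h2.2]
      · push Not at h2 h'
        rcases le_or_gt t ‖x + d‖ with h3 | h3
        · have := h2 h3
          nlinarith
        · nlinarith
  · simp only [h, if_false]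
    split_ifs with h'
    · nlinarith
    · nlinarith

lemma weakHigh_add_le {t : ℝ} (ht : 0 < t) (x y d e : H) (hde : ‖e‖ ≤ ‖d‖) :
    weakHigh t (x + d) (y + e) ≤ weakHigh t x y +
      if ‖x‖ + ‖y‖ ≤ t then 0 else 2 * ⟪y, e⟫ - 2 * ⟪x, d⟫ - 2 * t * ⟪‖y‖⁻¹ • y, e⟫ := by
  have hx' : ‖x + d‖ ^ 2 = ‖x‖ ^ 2 + 2 * ⟪x, d⟫ + ‖d‖ ^ 2 := norm_add_sq_real x d
  have hy' : ‖y + e‖ ^ 2 = ‖y‖ ^ 2 + 2 * ⟪y, e⟫ + ‖e‖ ^ 2 := norm_add_sq_real y e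
  have hde2 : ‖e‖ ^ 2 ≤ ‖d‖ ^ 2 := by gcongr
  have hyi : ⟪‖y‖⁻¹ • y, y + e⟫ ≤ ‖y + e‖ := inner_normalized_le _ _
  rw [inner_add_right, inner_normalized_self] at hyi
  have n1 := norm_nonneg (x + d)
  have n2 := norm_nonneg (y + e)
  unfold weakHigh
  by_cases h : ‖x‖ + ‖y‖ ≤ t
  · simp only [h, if_true]
    split_ifs with h'
    · linarith
    · have h1 : ‖y + e‖ ≤ ‖y‖ + ‖e‖ := norm_add_le _ _
      have h2 : ‖d‖ ≤ ‖x + d‖ + ‖x‖ := by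
        simpa using norm_sub_le (x + d) x
      push Not at h'
      nlinarith
  · simp only [h, if_false]
    split_ifs with h'
    · nlinarith
    · nlinarith

lemma integral_low {p r A B C : ℝ} (hp : 1 < p) (hp2 : p < 2) (hr : 0 ≤ r) (hA : r = 0 → A = 0) :
    IntegrableOn (fun t : ℝ => t ^ (p - 3) * if r < t then A else B * t + C * t ^ 2)
      (Set.Ioi 0) ∧
    ∫ t in Set.Ioi (0 : ℝ), t ^ (p - 3) * (if r < t then A else B * t + C * t ^ 2) =
      A * r ^ (p - 2) / (2 - p) + B * r ^ (p - 1) / (p - 1) + C * r ^ p / p := by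
  have e1 : Set.EqOn (fun t : ℝ => t ^ (p - 3) * if r < t then A else B * t + C * t ^ 2)
      (fun t => B * t ^ (p - 2) + C * t ^ (p - 1)) (Set.Ioc 0 r) := by
    intro t ht
    have h0 : 0 < t := ht.1
    simp only [not_lt.2 ht.2, if_false]
    have h1 : t ^ (p - 2) = t ^ (p - 3) * t := by
      rw [← Real.rpow_add_one h0.ne']; ring_nf
    have h2 : t ^ (p - 1) = t ^ (p - 3) * t ^ 2 := by
      rw [← Real.rpow_natCast t 2, ← Real.rpow_add h0]; norm_num; ring_nf
    rw [h1, h2]; ring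
  have e2 : Set.EqOn (fun t : ℝ => t ^ (p - 3) * if r < t then A else B * t + C * t ^ 2)
      (fun t => A * t ^ (p - 3)) (Set.Ioi r) := by
    intro t ht
    have : r < t := ht
    simp [this, mul_comm]
  have i1 : IntervalIntegrable (fun t : ℝ => t ^ (p - 2)) volume 0 r :=
    intervalIntegral.intervalIntegrable_rpow' (by linarith)
  have i2 : IntervalIntegrable (fun t : ℝ => t ^ (p - 1)) volume 0 r :=
    intervalIntegral.intervalIntegrable_rpow' (by linarith)
  have j1 : IntegrableOn (fun t : ℝ => B * t ^ (p - 2) + C * t ^ (p - 1)) (Set.Ioc 0 r) := by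
    have := (i1.const_mul B).add (i2.const_mul C)
    exact (intervalIntegrable_iff_integrableOn_Ioc_of_le hr).1 this
  have v1 : ∫ t in Set.Ioc 0 r, (B * t ^ (p - 2) + C * t ^ (p - 1)) =
      B * r ^ (p - 1) / (p - 1) + C * r ^ p / p := by
    rw [← intervalIntegral.integral_of_le hr,
      intervalIntegral.integral_add (i1.const_mul B) (i2.const_mul C),
      intervalIntegral.integral_const_mul, intervalIntegral.integral_const_mul,
      integral_rpow (Or.inl (by linarith)), integral_rpow (Or.inl (by linarith))]
    rw [show p - 2 + 1 = p - 1 by ring, show p - 1 + 1 = p by ring,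
      Real.zero_rpow (by linarith), Real.zero_rpow (by linarith)]
    ring
  have j2 : IntegrableOn (fun t : ℝ => A * t ^ (p - 3)) (Set.Ioi r) ∧
      ∫ t in Set.Ioi r, A * t ^ (p - 3) = A * r ^ (p - 2) / (2 - p) := by
    rcases hr.eq_or_lt with h | h
    · simp [hA h.symm]
    · refine ⟨(integrableOn_Ioi_rpow_of_lt (by linarith) h).const_mul A, ?_⟩
      rw [integral_const_mul, integral_Ioi_rpow_of_lt (by linarith) h,
        show p - 3 + 1 = p - 2 by ring, show (2 - p) = -(p - 2) by ring, div_neg, neg_div]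
      ring
  have k1 := j1.congr_fun e1.symm measurableSet_Ioc
  have k2 := j2.1.congr_fun e2.symm measurableSet_Ioi
  rw [← Set.Ioc_union_Ioi_eq_Ioi hr]
  refine ⟨k1.union k2, ?_⟩
  rw [setIntegral_union (Set.Ioc_disjoint_Ioi le_rfl) measurableSet_Ioi k1 k2,
    setIntegral_congr_fun measurableSet_Ioc e1, setIntegral_congr_fun measurableSet_Ioi e2,
    v1, j2.2]
  ring

lemma integral_high {p r A B C : ℝ} (hp2 : 2 < p) (hr : 0 ≤ r) :
    IntegrableOn (fun t : ℝ => t ^ (p - 3) * if r ≤ t then 0 else A + B * t + C * t ^ 2)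
      (Set.Ioi 0) ∧
    ∫ t in Set.Ioi (0 : ℝ), t ^ (p - 3) * (if r ≤ t then 0 else A + B * t + C * t ^ 2) =
      A * r ^ (p - 2) / (p - 2) + B * r ^ (p - 1) / (p - 1) + C * r ^ p / p := by
  have e1 : Set.EqOn (fun t : ℝ => t ^ (p - 3) * if r ≤ t then 0 else A + B * t + C * t ^ 2)
      (fun t => A * t ^ (p - 3) + B * t ^ (p - 2) + C * t ^ (p - 1)) (Set.Ioo 0 r) := by
    intro t ht
    have h0 : 0 < t := ht.1
    simp only [not_le.2 ht.2, if_false]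
    have h1 : t ^ (p - 2) = t ^ (p - 3) * t := by
      rw [← Real.rpow_add_one h0.ne']; ring_nf
    have h2 : t ^ (p - 1) = t ^ (p - 3) * t ^ 2 := by
      rw [← Real.rpow_natCast t 2, ← Real.rpow_add h0]; norm_num; ring_nf
    rw [h1, h2]; ring
  have e2 : Set.EqOn (fun t : ℝ => t ^ (p - 3) * if r ≤ t then 0 else A + B * t + C * t ^ 2)
      (fun _ => 0) (Set.Ici r) := by
    intro t ht
    have : r ≤ t := ht
    simp [this]
  have i0 : IntervalIntegrable (fun t : ℝ => A * t ^ (p - 3)) volume 0 r :=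
    (intervalIntegral.intervalIntegrable_rpow' (by linarith)).const_mul A
  have i1 : IntervalIntegrable (fun t : ℝ => B * t ^ (p - 2)) volume 0 r :=
    (intervalIntegral.intervalIntegrable_rpow' (by linarith)).const_mul B
  have i2 : IntervalIntegrable (fun t : ℝ => C * t ^ (p - 1)) volume 0 r :=
    (intervalIntegral.intervalIntegrable_rpow' (by linarith)).const_mul C
  have j1 : IntegrableOn (fun t : ℝ => A * t ^ (p - 3) + B * t ^ (p - 2) + C * t ^ (p - 1))
      (Set.Ioo 0 r) :=
    (intervalIntegrable_iff_integrableOn_Ioo_of_le hr).1 ((i0.add i1).add i2)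
  have v1 : ∫ t in Set.Ioo 0 r, (A * t ^ (p - 3) + B * t ^ (p - 2) + C * t ^ (p - 1)) =
      A * r ^ (p - 2) / (p - 2) + B * r ^ (p - 1) / (p - 1) + C * r ^ p / p := by
    rw [← integral_Ioc_eq_integral_Ioo, ← intervalIntegral.integral_of_le hr,
      intervalIntegral.integral_add (i0.add i1) i2, intervalIntegral.integral_add i0 i1,
      intervalIntegral.integral_const_mul, intervalIntegral.integral_const_mul,
      intervalIntegral.integral_const_mul, integral_rpow (Or.inl (by linarith)),
      integral_rpow (Or.inl (by linarith)), integral_rpow (Or.inl (by linarith))]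
    rw [show p - 3 + 1 = p - 2 by ring, show p - 2 + 1 = p - 1 by ring,
      show p - 1 + 1 = p by ring, Real.zero_rpow (by linarith), Real.zero_rpow (by linarith),
      Real.zero_rpow (by linarith)]
    ring
  have k1 := j1.congr_fun e1.symm measurableSet_Ioo
  have k2 : IntegrableOn (fun t : ℝ => t ^ (p - 3) * if r ≤ t then 0 else A + B * t + C * t ^ 2)
      (Set.Ici r) := integrableOn_zero.congr_fun e2.symm measurableSet_Ici
  rcases hr.eq_or_lt with h | h
  · subst h
    have k3 : Set.EqOn (fun t : ℝ => t ^ (p - 3) * if 0 ≤ t then 0 else A + B * t + C * t ^ 2)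
      (fun _ => 0) (Set.Ioi 0) := e2.mono Set.Ioi_subset_Ici_self
    refine ⟨k2.mono_set Set.Ioi_subset_Ici_self, ?_⟩
    rw [setIntegral_congr_fun measurableSet_Ioi k3, Real.zero_rpow (by linarith),
      Real.zero_rpow (by linarith), Real.zero_rpow (by linarith)]
    simp
  rw [← Set.Ioo_union_Ici_eq_Ioi h]
  refine ⟨k1.union k2, ?_⟩
  rw [setIntegral_union (show Disjoint (Set.Ioo 0 r) (Set.Ici r) from
    Set.disjoint_left.2 fun t h1 h2 => not_le.2 h1.2 h2) measurableSet_Ici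
    k1 k2, setIntegral_congr_fun measurableSet_Ioo e1, setIntegral_congr_fun measurableSet_Ici e2,
    v1]
  simp

/-- Burkholder's function admits, at each point, a superdifferential along subordinate
increments. -/
theorem exists_burkholderFn {p : ℝ} (hp : 1 < p) :
    ∃ α β : ℝ, 0 < α ∧ 0 < β ∧ ∀ x y : H, ∃ ξ η : H, ∀ d e : H, ‖e‖ ≤ ‖d‖ →
      burkholderFn p α β (x + d) (y + e) ≤ burkholderFn p α β x y + ⟪ξ, d⟫ + ⟪η, e⟫ := by
  have hrpow : ∀ x y : H, (‖y‖ ^ 2 - ‖x‖ ^ 2) * (‖x‖ + ‖y‖) ^ (p - 2) =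
      (‖x‖ + ‖y‖) ^ (p - 1) * (‖y‖ - ‖x‖) ∧
      (‖x‖ + ‖y‖) ^ p = (‖x‖ + ‖y‖) ^ (p - 1) * (‖x‖ + ‖y‖) := by
    intro x y
    have h0 : 0 ≤ ‖x‖ + ‖y‖ := by positivity
    rcases h0.eq_or_lt with h | h
    · have hx : ‖x‖ = 0 := by linarith [norm_nonneg x, norm_nonneg y]
      have hy : ‖y‖ = 0 := by linarith [norm_nonneg x, norm_nonneg y]
      have : p ≠ 0 := by linarith
      simp [hx, hy, this]
    · constructor
      · have : (‖x‖ + ‖y‖) ^ (p - 1) = (‖x‖ + ‖y‖) ^ (p - 2) * (‖x‖ + ‖y‖) := by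
          rw [← Real.rpow_add_one h.ne']; ring_nf
        rw [this]; ring
      · rw [← Real.rpow_add_one h.ne']; ring_nf
  have hnorm0 : ∀ x y : H, ‖x‖ + ‖y‖ = 0 → x = 0 ∧ y = 0 := by
    intro x y h
    constructor
    · exact norm_eq_zero.1 (by linarith [norm_nonneg x, norm_nonneg y])
    · exact norm_eq_zero.1 (by linarith [norm_nonneg x, norm_nonneg y])
  rcases lt_trichotomy p 2 with h2 | h2 | h2
  · refine ⟨1 / (2 - p) + 1 / p, 1 / (2 - p) + 2 / (p - 1) - 1 / p, ?_, ?_, ?_⟩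
    · have : 0 < 2 - p := by linarith
      positivity
    · have a1 : 1 ≤ 1 / (2 - p) := by rw [le_div_iff₀ (by linarith)]; linarith
      have a2 : 1 / p < 1 := by rw [div_lt_one (by linarith)]; exact hp
      have a3 : 0 < 2 / (p - 1) := by
        have : 0 < p - 1 := by linarith
        positivity
      linarith
    have key : ∀ x y : H,
        IntegrableOn (fun t : ℝ => t ^ (p - 3) * weakLow t x y) (Set.Ioi 0) ∧
        ∫ t in Set.Ioi (0 : ℝ), t ^ (p - 3) * weakLow t x y =
          burkholderFn p (1 / (2 - p) + 1 / p) (1 / (2 - p) + 2 / (p - 1) - 1 / p) x y := by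
      intro x y
      have := integral_low (r := ‖x‖ + ‖y‖) (A := ‖y‖ ^ 2 - ‖x‖ ^ 2) (B := -(2 * ‖x‖)) (C := 1)
        hp h2 (by positivity) (fun h => by simp [(hnorm0 x y h).1, (hnorm0 x y h).2])
      have e : ∀ t : ℝ, weakLow t x y = if ‖x‖ + ‖y‖ < t then ‖y‖ ^ 2 - ‖x‖ ^ 2 else
          -(2 * ‖x‖) * t + 1 * t ^ 2 := by
        intro t
        unfold weakLow
        split_ifs <;> ring
      simp only [e]
      refine ⟨this.1, this.2.trans ?_⟩
      rw [(hrpow x y).1, (hrpow x y).2]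
      unfold burkholderFn
      ring
    intro x y
    set r := ‖x‖ + ‖y‖ with hr
    refine ⟨-(2 * r ^ (p - 2) / (2 - p)) • x - (2 * r ^ (p - 1) / (p - 1)) • (‖x‖⁻¹ • x),
      (2 * r ^ (p - 2) / (2 - p)) • y, fun d e hde => ?_⟩
    have hL := integral_low (r := r) (A := 2 * ⟪y, e⟫ - 2 * ⟪x, d⟫)
      (B := -(2 * ⟪‖x‖⁻¹ • x, d⟫)) (C := 0) hp h2 (by positivity)
      (fun h => by simp [(hnorm0 x y h).1, (hnorm0 x y h).2])
    have hmono := setIntegral_mono_on (key (x + d) (y + e)).1 ((key x y).1.add hL.1)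
      measurableSet_Ioi (fun t ht => by
        have h := weakLow_add_le (show 0 < t from ht) x y d e hde
        have ht' : 0 ≤ t ^ (p - 3) := Real.rpow_nonneg (le_of_lt ht) _
        have := mul_le_mul_of_nonneg_left h ht'
        refine this.trans (le_of_eq ?_)
        simp only [Pi.add_apply]
        rw [← mul_add]
        congr 2
        split_ifs <;> ring)
    simp only [Pi.add_apply] at hmono
    rw [integral_add (key x y).1 hL.1, (key x y).2, (key (x + d) (y + e)).2, hL.2] at hmono
    refine hmono.trans (le_of_eq ?_)
    generalize ‖x‖⁻¹ • x = q
    simp only [inner_sub_left, real_inner_smul_left]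
    ring
  · subst h2
    refine ⟨1, 1, one_pos, one_pos, fun x y => ⟨-(2 : ℝ) • x, (2 : ℝ) • y, fun d e hde => ?_⟩⟩
    have hx' : ‖x + d‖ ^ 2 = ‖x‖ ^ 2 + 2 * ⟪x, d⟫ + ‖d‖ ^ 2 := norm_add_sq_real x d
    have hy' : ‖y + e‖ ^ 2 = ‖y‖ ^ 2 + 2 * ⟪y, e⟫ + ‖e‖ ^ 2 := norm_add_sq_real y e
    have hde2 : ‖e‖ ^ 2 ≤ ‖d‖ ^ 2 := by gcongr
    have e21 : (2 : ℝ) - 1 = 1 := by norm_num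
    simp only [burkholderFn, e21, Real.rpow_one, real_inner_smul_left]
    nlinarith
  · refine ⟨1 / (p - 2) - 2 / (p - 1) + 1 / p, 1 / (p - 2) - 1 / p, ?_, ?_, ?_⟩
    · have a1 : 0 < p - 2 := by linarith
      have a2 : 0 < p - 1 := by linarith
      have a3 : 0 < p := by linarith
      have : 1 / (p - 2) - 2 / (p - 1) + 1 / p = 2 / (p * (p - 1) * (p - 2)) := by
        field_simp
        ring
      rw [this]
      positivity
    · have : 1 / p < 1 / (p - 2) := one_div_lt_one_div_of_lt (by linarith) (by linarith)
      linarith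
    have key : ∀ x y : H,
        IntegrableOn (fun t : ℝ => t ^ (p - 3) * weakHigh t x y) (Set.Ioi 0) ∧
        ∫ t in Set.Ioi (0 : ℝ), t ^ (p - 3) * weakHigh t x y =
          burkholderFn p (1 / (p - 2) - 2 / (p - 1) + 1 / p) (1 / (p - 2) - 1 / p) x y := by
      intro x y
      have := integral_high (r := ‖x‖ + ‖y‖) (A := ‖y‖ ^ 2 - ‖x‖ ^ 2) (B := -(2 * ‖y‖)) (C := 1)
        h2 (by positivity)
      have e : ∀ t : ℝ, weakHigh t x y = if ‖x‖ + ‖y‖ ≤ t then 0 else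
          ‖y‖ ^ 2 - ‖x‖ ^ 2 + -(2 * ‖y‖) * t + 1 * t ^ 2 := by
        intro t
        unfold weakHigh
        split_ifs <;> ring
      simp only [e]
      refine ⟨this.1, this.2.trans ?_⟩
      rw [(hrpow x y).1, (hrpow x y).2]
      unfold burkholderFn
      ring
    intro x y
    set r := ‖x‖ + ‖y‖ with hr
    refine ⟨-(2 * r ^ (p - 2) / (p - 2)) • x,
      (2 * r ^ (p - 2) / (p - 2)) • y - (2 * r ^ (p - 1) / (p - 1)) • (‖y‖⁻¹ • y),
      fun d e hde => ?_⟩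
    have hL := integral_high (r := r) (A := 2 * ⟪y, e⟫ - 2 * ⟪x, d⟫)
      (B := -(2 * ⟪‖y‖⁻¹ • y, e⟫)) (C := 0) h2 (by positivity)
    have hmono := setIntegral_mono_on (key (x + d) (y + e)).1 ((key x y).1.add hL.1)
      measurableSet_Ioi (fun t ht => by
        have h := weakHigh_add_le (show 0 < t from ht) x y d e hde
        have ht' : 0 ≤ t ^ (p - 3) := Real.rpow_nonneg (le_of_lt ht) _
        have := mul_le_mul_of_nonneg_left h ht'
        refine this.trans (le_of_eq ?_)
        simp only [Pi.add_apply]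
        rw [← mul_add]
        congr 2
        split_ifs <;> ring)
    simp only [Pi.add_apply] at hmono
    rw [integral_add (key x y).1 hL.1, (key x y).2, (key (x + d) (y + e)).2, hL.2] at hmono
    refine hmono.trans (le_of_eq ?_)
    generalize ‖y‖⁻¹ • y = q
    simp only [inner_sub_left, real_inner_smul_left]
    ring

end Burkholder

/-! ## Dyadic cubes -/

lemma floor_div_two_zpow_congr {k l : ℤ} (hkl : k ≤ l) {s t : ℝ}
    (h : ⌊s / 2 ^ k⌋ = ⌊t / 2 ^ k⌋) : ⌊s / 2 ^ l⌋ = ⌊t / 2 ^ l⌋ := by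
  obtain ⟨m, rfl⟩ := Int.le.dest hkl
  have e : ∀ u : ℝ, ⌊u / 2 ^ (k + (m : ℤ))⌋ = ⌊u / 2 ^ k⌋ / ((2 ^ m : ℕ) : ℤ) := by
    intro u
    rw [← Int.floor_div_natCast, zpow_add₀ two_ne_zero, ← div_div]
    simp
  rw [e, e, h]

lemma mem_dyadicInterval_iff (k m : ℤ) (t : ℝ) :
    ((m : ℝ) * 2 ^ k ≤ t ∧ t < ((m : ℝ) + 1) * 2 ^ k) ↔ ⌊t / 2 ^ k⌋ = m := by
  rw [Int.floor_eq_iff, le_div_iff₀ (by positivity), div_lt_iff₀ (by positivity)]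

namespace DCube

variable {d : ℕ}

lemma mem_set_iff {I : DCube d} {x : Fin d → ℝ} :
    x ∈ I.set ↔ ∀ i, ⌊x i / 2 ^ I.k⌋ = I.m i := by
  simp only [DCube.set, Set.mem_ofPred_eq, mem_dyadicInterval_iff]

lemma corner_mem (I : DCube d) : I.corner ∈ I.set := by
  rw [mem_set_iff]
  intro i
  rw [DCube.corner, mul_div_cancel_right₀ _ (by positivity), Int.floor_intCast]

/-- The dyadic cube of side length `2 ^ k` containing `x`. -/
def around (k : ℤ) (x : Fin d → ℝ) : DCube d := ⟨k, fun i => ⌊x i / 2 ^ k⌋⟩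

lemma mem_around (k : ℤ) (x : Fin d → ℝ) : x ∈ (around k x).set :=
  mem_set_iff.2 fun _ => rfl

lemma eq_of_k_eq {I J : DCube d} (hk : I.k = J.k) {x : Fin d → ℝ} (hI : x ∈ I.set)
    (hJ : x ∈ J.set) : I = J := by
  obtain ⟨k, m⟩ := I
  obtain ⟨l, m'⟩ := J
  simp only at hk
  subst hk
  congr 1
  funext i
  have h1 := mem_set_iff.1 hI i
  have h2 := mem_set_iff.1 hJ i
  exact h1.symm.trans h2

lemma subset_of_k_le {I J : DCube d} (hk : I.k ≤ J.k) {x : Fin d → ℝ} (hI : x ∈ I.set)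
    (hJ : x ∈ J.set) : I.set ⊆ J.set := by
  intro y hy
  rw [mem_set_iff] at *
  intro i
  rw [← hJ i]
  exact floor_div_two_zpow_congr hk ((hy i).trans (hI i).symm)

lemma set_eq_pi (I : DCube d) :
    I.set = Set.pi Set.univ fun i =>
      Set.Ico ((I.m i : ℝ) * 2 ^ I.k) (((I.m i : ℝ) + 1) * 2 ^ I.k) := by
  ext x
  simp [DCube.set]

lemma measurableSet_set (I : DCube d) : MeasurableSet I.set := by
  rw [set_eq_pi]
  exact MeasurableSet.univ_pi fun _ => measurableSet_Ico

lemma vol_pos (I : DCube d) : 0 < I.vol := by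
  unfold DCube.vol; positivity

lemma volume_set (I : DCube d) : volume I.set = ENNReal.ofReal I.vol := by
  rw [set_eq_pi, Real.volume_pi_Ico]
  have : ∀ i, ((I.m i : ℝ) + 1) * 2 ^ I.k - (I.m i : ℝ) * 2 ^ I.k = 2 ^ I.k := fun i => by ring
  simp only [this]
  rw [DCube.vol, Finset.prod_const, Finset.card_univ, Fintype.card_fin,
    ENNReal.ofReal_pow (by positivity)]

lemma k_le_of_subset (hd : 0 < d) {I J : DCube d} (h : I.set ⊆ J.set) : I.k ≤ J.k := by
  have h1 := measure_mono (μ := volume) h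
  rw [volume_set, volume_set, ENNReal.ofReal_le_ofReal_iff J.vol_pos.le] at h1
  unfold DCube.vol at h1
  have h2 := (pow_le_pow_iff_left₀ (by positivity) (by positivity) hd.ne').1 h1
  exact (zpow_le_zpow_iff_right₀ (by norm_num)).1 h2

instance : Countable (DCube d) := by
  have : Function.Injective fun I : DCube d => (I.k, I.m) := by
    rintro ⟨k, m⟩ ⟨l, m'⟩ h
    simpa using h
  exact this.countable

/-- The dyadic parent of a dyadic cube. -/
def parent (I : DCube d) : DCube d := around (I.k + 1) I.corner

lemma subset_parent (I : DCube d) : I.set ⊆ I.parent.set :=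
  subset_of_k_le (by simp [parent, around]) I.corner_mem (mem_around _ _)

lemma vol_parent (I : DCube d) : I.parent.vol = 2 ^ d * I.vol := by
  unfold DCube.vol parent around
  rw [zpow_add_one₀ two_ne_zero, mul_pow]
  ring

lemma parent_subset {I J : DCube d} (h : I.set ⊆ J.set) (hne : I.k < J.k) :
    I.parent.set ⊆ J.set :=
  subset_of_k_le hne (I.subset_parent I.corner_mem) (h I.corner_mem)

lemma finite_subcubes (hd : 0 < d) (I₀ : DCube d) (N : ℤ) :
    {I : DCube d | I.set ⊆ I₀.set ∧ N ≤ I.k}.Finite := by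
  have hB : ∀ i : Fin d, ∃ B : ℤ, ∀ I : DCube d, I.set ⊆ I₀.set → N ≤ I.k →
      -B ≤ I.m i ∧ I.m i ≤ B := by
    intro i
    obtain ⟨B, hB⟩ := exists_int_gt ((|(I₀.m i : ℝ)| + 1) * 2 ^ I₀.k / 2 ^ N)
    refine ⟨B, fun I hI hN => ?_⟩
    have h1 := hI I.corner_mem i
    simp only [DCube.corner] at h1
    have hm : |(I.m i : ℝ)| * 2 ^ I.k ≤ (|(I₀.m i : ℝ)| + 1) * 2 ^ I₀.k := by
      have h0 : (0 : ℝ) < 2 ^ I₀.k := by positivity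
      rw [← abs_of_pos (show (0 : ℝ) < 2 ^ I.k by positivity), ← abs_mul, abs_le]
      constructor
      · nlinarith [neg_abs_le (I₀.m i : ℝ)]
      · nlinarith [le_abs_self (I₀.m i : ℝ)]
    have hle : |(I.m i : ℝ)| ≤ (|(I₀.m i : ℝ)| + 1) * 2 ^ I₀.k / 2 ^ N := by
      rw [le_div_iff₀ (by positivity)]
      refine le_trans (mul_le_mul_of_nonneg_left ?_ (abs_nonneg _)) hm
      exact zpow_le_zpow_right₀ (by norm_num) hN
    have h3 := abs_le.1 (hle.trans hB.le)
    constructor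
    · exact_mod_cast h3.1
    · exact_mod_cast h3.2
  choose B hB using hB
  have hfin : (Set.Icc N I₀.k ×ˢ Set.pi Set.univ fun i => Set.Icc (-B i) (B i)).Finite :=
    (Set.finite_Icc _ _).prod (Set.Finite.pi fun i => Set.finite_Icc (-B i) (B i))
  have hinj : Function.Injective fun I : DCube d => (I.k, I.m) := by
    rintro ⟨k, m⟩ ⟨l, m'⟩ h
    simpa using h
  refine Set.Finite.of_finite_image (f := fun I : DCube d => (I.k, I.m))
    (hfin.subset ?_) hinj.injOn
  rintro _ ⟨I, ⟨h1, h2⟩, rfl⟩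
  exact ⟨⟨h2, k_le_of_subset hd h1⟩, fun i _ => hB i I h1 h2⟩

end DCube

/-! ## Haar functions -/

section Haar

variable {d : ℕ}

lemma haar1D_false_eq (k m : ℤ) (t : ℝ) : haar1D false k m t =
    (if ⌊t / 2 ^ (k - 1)⌋ = 2 * m then ((2 : ℝ) ^ k) ^ (-(1 / 2 : ℝ)) else 0) -
      if ⌊t / 2 ^ (k - 1)⌋ = 2 * m + 1 then ((2 : ℝ) ^ k) ^ (-(1 / 2 : ℝ)) else 0 := by
  have h2 : (2 : ℝ) ^ k = 2 ^ (k - 1) * 2 := by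
    rw [← zpow_add_one₀ two_ne_zero]; ring_nf
  have e1 : ((m : ℝ) * 2 ^ k ≤ t ∧ t < (m : ℝ) * 2 ^ k + 2 ^ (k - 1)) ↔
      ⌊t / 2 ^ (k - 1)⌋ = 2 * m := by
    rw [← mem_dyadicInterval_iff, h2]
    push_cast
    ring_nf
  have e2 : ((m : ℝ) * 2 ^ k + 2 ^ (k - 1) ≤ t ∧ t < ((m : ℝ) + 1) * 2 ^ k) ↔
      ⌊t / 2 ^ (k - 1)⌋ = 2 * m + 1 := by
    rw [← mem_dyadicInterval_iff, h2]
    push_cast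
    ring_nf
  unfold haar1D
  simp only [Bool.false_eq_true, if_false, Set.indicator, Set.mem_ofPred_eq, e1, e2]

lemma haar1D_true_eq (k m : ℤ) (t : ℝ) : haar1D true k m t =
    if ⌊t / 2 ^ k⌋ = m then ((2 : ℝ) ^ k) ^ (-(1 / 2 : ℝ)) else 0 := by
  unfold haar1D
  simp only [if_true, Set.indicator, Set.mem_ofPred_eq, mem_dyadicInterval_iff]

lemma haar1D_congr (ε : Bool) {k l m : ℤ} (hl : l < k) {s t : ℝ}
    (h : ⌊s / 2 ^ l⌋ = ⌊t / 2 ^ l⌋) : haar1D ε k m s = haar1D ε k m t := by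
  cases ε
  · rw [haar1D_false_eq, haar1D_false_eq, floor_div_two_zpow_congr (show l ≤ k - 1 by omega) h]
  · rw [haar1D_true_eq, haar1D_true_eq, floor_div_two_zpow_congr hl.le h]

lemma haar1D_eq_zero (ε : Bool) {k m : ℤ} {t : ℝ} (h : ⌊t / 2 ^ k⌋ ≠ m) :
    haar1D ε k m t = 0 := by
  cases ε
  · have e : ⌊t / 2 ^ k⌋ = ⌊t / 2 ^ (k - 1)⌋ / 2 := by
      have := Int.floor_div_natCast (t / 2 ^ (k - 1)) 2
      push_cast at this
      rw [div_div, ← zpow_add_one₀ two_ne_zero, sub_add_cancel] at this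
      exact this
    rw [haar1D_false_eq, if_neg, if_neg, sub_zero]
    · intro h'; apply h; omega
    · intro h'; apply h; omega
  · rw [haar1D_true_eq, if_neg h]

lemma measurable_haar1D (ε : Bool) (k m : ℤ) : Measurable (haar1D ε k m) := by
  have h : ∀ l : ℤ, Measurable fun t : ℝ => ⌊t / 2 ^ l⌋ := fun l =>
    Int.measurable_floor.comp (measurable_id.div_const _)
  cases ε
  · rw [show haar1D false k m = _ from funext (haar1D_false_eq k m)]
    exact (Measurable.ite (h _ (measurableSet_singleton _)) measurable_const
      measurable_const).sub (Measurable.ite (h _ (measurableSet_singleton _)) measurable_const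
      measurable_const)
  · rw [show haar1D true k m = _ from funext (haar1D_true_eq k m)]
    exact Measurable.ite (h _ (measurableSet_singleton _)) measurable_const measurable_const

lemma abs_haar1D_le (ε : Bool) (k m : ℤ) (t : ℝ) :
    |haar1D ε k m t| ≤ ((2 : ℝ) ^ k) ^ (-(1 / 2 : ℝ)) := by
  have h0 : (0 : ℝ) ≤ ((2 : ℝ) ^ k) ^ (-(1 / 2 : ℝ)) := by positivity
  cases ε
  · rw [haar1D_false_eq]
    split_ifs with h1 h2 h2
    · omega
    · rw [sub_zero, abs_of_nonneg h0]
    · rw [zero_sub, abs_neg, abs_of_nonneg h0]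
    · rwa [sub_zero, abs_zero]
  · rw [haar1D_true_eq]
    split_ifs
    · rw [abs_of_nonneg h0]
    · rwa [abs_zero]

lemma integral_haar1D_false (k m : ℤ) : ∫ t, haar1D false k m t = 0 := by
  set c := ((2 : ℝ) ^ k) ^ (-(1 / 2 : ℝ))
  have h2 : (2 : ℝ) ^ k = 2 ^ (k - 1) * 2 := by
    rw [← zpow_add_one₀ two_ne_zero]; ring_nf
  have h0 : (0 : ℝ) < 2 ^ (k - 1) := by positivity
  have e : haar1D false k m = fun t =>
      (Set.Ico ((m : ℝ) * 2 ^ k) ((m : ℝ) * 2 ^ k + 2 ^ (k - 1))).indicator (fun _ => c) t -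
      (Set.Ico ((m : ℝ) * 2 ^ k + 2 ^ (k - 1)) (((m : ℝ) + 1) * 2 ^ k)).indicator
        (fun _ => c) t := by
    funext t
    simp [haar1D, Set.Ico, c]
  have hi : ∀ a b : ℝ, Integrable ((Set.Ico a b).indicator fun _ : ℝ => c) := fun a b =>
    (integrable_indicator_iff measurableSet_Ico).2 (integrableOn_const (by simp))
  rw [e, integral_sub (hi _ _) (hi _ _), integral_indicator measurableSet_Ico,
    integral_indicator measurableSet_Ico]
  simp only [integral_const, MeasurableSet.univ, measureReal_restrict_apply, Set.univ_inter,
    Real.volume_real_Ico, smul_eq_mul]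
  rw [← sub_mul, h2]
  rw [max_eq_left (by linarith), max_eq_left (by linarith)]
  ring

lemma haarFn_eq_zero {I : DCube d} (ε : Fin d → Bool) {x : Fin d → ℝ} (h : x ∉ I.set) :
    haarFn I ε x = 0 := by
  rw [DCube.mem_set_iff, not_forall] at h
  obtain ⟨i, hi⟩ := h
  exact Finset.prod_eq_zero (Finset.mem_univ i) (haar1D_eq_zero _ hi)

lemma haarFn_congr {I J : DCube d} (hk : J.k < I.k) (ε : Fin d → Bool) {x y : Fin d → ℝ}
    (hx : x ∈ J.set) (hy : y ∈ J.set) : haarFn I ε x = haarFn I ε y := by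
  rw [DCube.mem_set_iff] at hx hy
  exact Finset.prod_congr rfl fun i _ => haar1D_congr _ hk ((hx i).trans (hy i).symm)

lemma measurable_haarFn (I : DCube d) (ε : Fin d → Bool) : Measurable (haarFn I ε) :=
  Finset.measurable_prod _ fun i _ => (measurable_haar1D _ _ _).comp (measurable_pi_apply i)

lemma exists_abs_haarFn_le (I : DCube d) (ε : Fin d → Bool) : ∃ C, ∀ x, |haarFn I ε x| ≤ C := by
  refine ⟨∏ _i : Fin d, ((2 : ℝ) ^ I.k) ^ (-(1 / 2 : ℝ)), fun x => ?_⟩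
  rw [haarFn, Finset.abs_prod]
  exact Finset.prod_le_prod (fun _ _ => abs_nonneg _) fun _ _ => abs_haar1D_le _ _ _ _

lemma integrable_haarFn (I : DCube d) (ε : Fin d → Bool) : Integrable (haarFn I ε) := by
  obtain ⟨C, hC⟩ := exists_abs_haarFn_le I ε
  have h : IntegrableOn (haarFn I ε) I.set :=
    Measure.integrableOn_of_bounded (M := C) (by simp [DCube.volume_set])
      (measurable_haarFn I ε).aestronglyMeasurable (Filter.Eventually.of_forall hC)
  exact h.integrable_of_forall_notMem_eq_zero fun x hx => haarFn_eq_zero ε hx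

lemma integral_haarFn {I : DCube d} {ε : Fin d → Bool} (hε : ε ∈ Sfin d) :
    ∫ x, haarFn I ε x = 0 := by
  have hne : ε ≠ fun _ => true := (Finset.mem_erase.1 hε).1
  obtain ⟨i, hi⟩ := Function.ne_iff.1 hne
  have hi' : ε i = false := by simpa using hi
  unfold haarFn
  rw [integral_fintype_prod_volume_eq_prod (fun i t => haar1D (ε i) I.k (I.m i) t)]
  refine Finset.prod_eq_zero (Finset.mem_univ i) ?_
  rw [hi']
  exact integral_haar1D_false _ _

variable {n : ℕ}

/-- A function with finite Haar expansion has only finitely many non-zero cancellative Haar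
coefficients inside a given cube. -/
lemma FiniteHaar.finite_support (hd : 0 < d) {f : (Fin d → ℝ) → EuclideanSpace ℂ (Fin n)}
    (hf : FiniteHaar f) (I₀ : DCube d) :
    {I : DCube d | I.set ⊆ I₀.set ∧ ∃ ε ∈ Sfin d, haarCoef f I ε ≠ 0}.Finite := by
  obtain ⟨F, hF⟩ := hf
  obtain ⟨N, hN⟩ : ∃ N : ℤ, ∀ q ∈ F, N ≤ q.1.k := by
    obtain ⟨N, hN⟩ := (F.image fun q => q.1.k).bddBelow
    exact ⟨N, fun q hq => hN (Finset.mem_coe.2 (Finset.mem_image_of_mem _ hq))⟩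
  refine (DCube.finite_subcubes hd I₀ N).subset ?_
  rintro I ⟨hI, ε, hε, hne⟩
  refine ⟨hI, ?_⟩
  by_contra hlt
  push Not at hlt
  apply hne
  have hconst : ∀ x, haarFn I ε x • f x = haarFn I ε x • f I.corner := by
    intro x
    by_cases hx : x ∈ I.set
    · rw [hF x, hF I.corner]
      congr 1
      refine Finset.sum_congr rfl fun q hq => ?_
      rw [haarFn_congr (hlt.trans_le (hN q hq)) q.2 hx I.corner_mem]
    · simp [haarFn_eq_zero ε hx]
  unfold haarCoef
  simp only [hconst]
  rw [integral_smul_const, integral_haarFn hε, zero_smul]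

end Haar

/-! ## Finite Haar sums -/

section HaarSum

variable {d : ℕ} {H : Type*} [NormedAddCommGroup H]

section Basic

variable [NormedSpace ℝ H]

/-- The finite Haar sum with (vector) coefficients `a`. -/
def haarSum (S : Finset (DCube d)) (a : DCube d → (Fin d → Bool) → H) (x : Fin d → ℝ) : H :=
  ∑ I ∈ S, ∑ ε ∈ Sfin d, haarFn I ε x • a I ε

lemma stronglyMeasurable_haarSum (S : Finset (DCube d)) (a : DCube d → (Fin d → Bool) → H) :
    StronglyMeasurable (haarSum S a) :=
  Finset.stronglyMeasurable_fun_sum _ fun I _ => Finset.stronglyMeasurable_fun_sum _ fun ε _ =>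
    (measurable_haarFn I ε).stronglyMeasurable.smul_const _

lemma exists_norm_haarSum_le (S : Finset (DCube d)) (a : DCube d → (Fin d → Bool) → H) :
    ∃ C, 0 ≤ C ∧ ∀ x, ‖haarSum S a x‖ ≤ C := by
  choose c hc using fun (I : DCube d) ε => exists_abs_haarFn_le I ε
  have h : ∀ x, ‖haarSum S a x‖ ≤ ∑ I ∈ S, ∑ ε ∈ Sfin d, c I ε * ‖a I ε‖ := fun x => by
    refine norm_sum_le_of_le _ fun I _ => norm_sum_le_of_le _ fun ε _ => ?_
    rw [norm_smul]
    exact mul_le_mul_of_nonneg_right (hc I ε x) (norm_nonneg _)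
  exact ⟨_, (norm_nonneg _).trans (h 0), h⟩

lemma haarSum_eq_zero {S : Finset (DCube d)} (a : DCube d → (Fin d → Bool) → H) {x : Fin d → ℝ}
    (hx : ∀ I ∈ S, x ∉ I.set) : haarSum S a x = 0 :=
  Finset.sum_eq_zero fun I hI => Finset.sum_eq_zero fun ε _ => by
    rw [haarFn_eq_zero ε (hx I hI), zero_smul]

lemma haarSum_congr {S : Finset (DCube d)} (a : DCube d → (Fin d → Bool) → H) {J : DCube d}
    (hS : ∀ I ∈ S, J.k < I.k ∨ Disjoint I.set J.set) {x y : Fin d → ℝ} (hx : x ∈ J.set)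
    (hy : y ∈ J.set) : haarSum S a x = haarSum S a y :=
  Finset.sum_congr rfl fun I hI => Finset.sum_congr rfl fun ε _ => by
    rcases hS I hI with h | h
    · rw [haarFn_congr h ε hx hy]
    · rw [haarFn_eq_zero ε (Set.disjoint_right.1 h hx),
        haarFn_eq_zero ε (Set.disjoint_right.1 h hy)]

lemma integrable_of_support_subset_cubes {g : (Fin d → ℝ) → ℝ} (S : Finset (DCube d))
    (hg : AEStronglyMeasurable g) {C : ℝ} (hC : ∀ x, |g x| ≤ C)
    (hz : ∀ x, (∀ I ∈ S, x ∉ I.set) → g x = 0) : Integrable g := by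
  have hfin : volume (⋃ I ∈ S, I.set) ≠ ⊤ := by
    refine ((measure_biUnion_finset_le S _).trans_lt ?_).ne
    exact ENNReal.sum_lt_top.2 fun I _ => by simp [DCube.volume_set]
  have h : IntegrableOn g (⋃ I ∈ S, I.set) :=
    Measure.integrableOn_of_bounded (M := C) hfin hg (Filter.Eventually.of_forall hC)
  refine h.integrable_of_forall_notMem_eq_zero fun x hx => hz x fun I hI hxI => hx ?_
  exact Set.mem_biUnion (Finset.mem_coe.2 hI) hxI

end Basic

variable [InnerProductSpace ℝ H]

lemma integrable_haarSum [CompleteSpace H] (S : Finset (DCube d))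
    (a : DCube d → (Fin d → Bool) → H) :
    Integrable (haarSum S a) ∧ ∫ x, haarSum S a x = 0 := by
  have hi : ∀ I : DCube d, ∀ ε : Fin d → Bool, Integrable fun x => haarFn I ε x • a I ε :=
    fun I ε => (integrable_haarFn I ε).smul_const _
  refine ⟨integrable_finsetSum _ fun I _ => integrable_finsetSum _ fun ε _ => hi I ε, ?_⟩
  unfold haarSum
  rw [integral_finsetSum _ fun I _ => integrable_finsetSum _ fun ε _ => hi I ε]
  refine Finset.sum_eq_zero fun I _ => ?_
  rw [integral_finsetSum _ fun ε _ => hi I ε]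
  refine Finset.sum_eq_zero fun ε hε => ?_
  rw [integral_smul_const, integral_haarFn hε, zero_smul]

lemma integrable_burkholderFn_haarSum {p α β : ℝ} (hp : 1 < p) (hα : 0 < α) (hβ : 0 < β)
    (S : Finset (DCube d)) (a b : DCube d → (Fin d → Bool) → H) :
    Integrable fun x => burkholderFn p α β (haarSum S a x) (haarSum S b x) := by
  obtain ⟨A, hA0, hA⟩ := exists_norm_haarSum_le S a
  obtain ⟨B, hB0, hB⟩ := exists_norm_haarSum_le S b
  refine integrable_of_support_subset_cubes S (C := (A + B) ^ (p - 1) * (α * B + β * A)) ?_ ?_ ?_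
  · exact ((continuous_burkholderFn hp α β).comp_stronglyMeasurable
      ((stronglyMeasurable_haarSum S a).prodMk
        (stronglyMeasurable_haarSum S b))).aestronglyMeasurable
  · intro x
    unfold burkholderFn
    rw [abs_mul, abs_of_nonneg (by positivity)]
    have h1 : |α * ‖haarSum S b x‖ - β * ‖haarSum S a x‖| ≤ α * B + β * A := by
      refine (abs_sub _ _).trans ?_
      rw [abs_of_nonneg (by positivity), abs_of_nonneg (by positivity)]
      exact add_le_add (mul_le_mul_of_nonneg_left (hB x) hα.le)
        (mul_le_mul_of_nonneg_left (hA x) hβ.le)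
    refine mul_le_mul ?_ h1 (abs_nonneg _) (by positivity)
    exact Real.rpow_le_rpow (by positivity) (add_le_add (hA x) (hB x)) (by linarith)
  · intro x hx
    simp [burkholderFn, haarSum_eq_zero a hx, haarSum_eq_zero b hx]

lemma integrable_norm_haarSum_rpow {p : ℝ} (hp : 1 < p) (S : Finset (DCube d))
    (a : DCube d → (Fin d → Bool) → H) : Integrable fun x => ‖haarSum S a x‖ ^ p := by
  obtain ⟨A, hA0, hA⟩ := exists_norm_haarSum_le S a
  refine integrable_of_support_subset_cubes S (C := A ^ p) ?_ ?_ ?_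
  · exact ((stronglyMeasurable_haarSum S a).norm.measurable.pow_const _).aestronglyMeasurable
  · intro x
    rw [abs_of_nonneg (by positivity)]
    exact Real.rpow_le_rpow (norm_nonneg _) (hA x) (by linarith)
  · intro x hx
    rw [haarSum_eq_zero a hx, norm_zero, Real.zero_rpow (by linarith)]

/-- The integral of the Burkholder function of a pair of differentially subordinate Haar sums is
non-positive. -/
lemma integral_burkholderFn_haarSum_nonpos [CompleteSpace H] {p α β : ℝ} (hp : 1 < p) (hα : 0 < α)
    (hβ : 0 < β)
    (hU : ∀ x y : H, ∃ ξ η : H, ∀ u v, ‖v‖ ≤ ‖u‖ → burkholderFn p α β (x + u) (y + v) ≤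
      burkholderFn p α β x y + inner ℝ ξ u + inner ℝ η v)
    (a b : DCube d → (Fin d → Bool) → H) (S : Finset (DCube d)) :
    (∀ I ∈ S, ∀ x, ‖haarSum {I} b x‖ ≤ ‖haarSum {I} a x‖) →
    ∫ x, burkholderFn p α β (haarSum S a x) (haarSum S b x) ≤ 0 := by
  classical
  refine Finset.induction_on_min_value (fun I : DCube d => I.k) S ?_ ?_
  · intro _
    simp [haarSum, burkholderFn]
  · intro I s hIs hmin ih hsub
    have hs : ∀ c : DCube d → (Fin d → Bool) → H, ∀ x,
        haarSum (insert I s) c x = haarSum s c x + haarSum {I} c x := fun c x => by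
      simp only [haarSum]
      rw [Finset.sum_insert hIs, Finset.sum_singleton, add_comm]
    have hconst : ∀ J ∈ s, I.k < J.k ∨ Disjoint J.set I.set := fun J hJ => by
      rcases (hmin J hJ).lt_or_eq with h | h
      · exact Or.inl h
      · refine Or.inr (Set.disjoint_left.2 fun x hxJ hxI => hIs ?_)
        rwa [DCube.eq_of_k_eq h hxI hxJ]
    obtain ⟨ξ, η, h⟩ := hU (haarSum s a I.corner) (haarSum s b I.corner)
    have hpt : ∀ x, burkholderFn p α β (haarSum (insert I s) a x) (haarSum (insert I s) b x) ≤
        burkholderFn p α β (haarSum s a x) (haarSum s b x) +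
          (inner ℝ ξ (haarSum {I} a x) + inner ℝ η (haarSum {I} b x)) := fun x => by
      rw [hs, hs]
      by_cases hx : x ∈ I.set
      · rw [haarSum_congr a hconst hx I.corner_mem, haarSum_congr b hconst hx I.corner_mem,
          ← add_assoc]
        exact h _ _ (hsub I (Finset.mem_insert_self _ _) x)
      · have hz : ∀ c : DCube d → (Fin d → Bool) → H, haarSum {I} c x = 0 := fun c =>
          haarSum_eq_zero c fun J hJ => by rwa [Finset.mem_singleton.1 hJ]
        simp [hz]
    have hia := (integrable_haarSum {I} a)
    have hib := (integrable_haarSum {I} b)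
    have hU' := integrable_burkholderFn_haarSum hp hα hβ s a b
    have hi : Integrable fun x => inner ℝ ξ (haarSum {I} a x) + inner ℝ η (haarSum {I} b x) :=
      (hia.1.const_inner ξ).add (hib.1.const_inner η)
    refine (integral_mono (integrable_burkholderFn_haarSum hp hα hβ _ a b) (hU'.add hi)
      hpt).trans ?_
    simp only [Pi.add_apply]
    rw [integral_add hU' hi,
      integral_add (hia.1.const_inner ξ) (hib.1.const_inner η), integral_inner hia.1,
      integral_inner hib.1, hia.2, hib.2, inner_zero_right, inner_zero_right, add_zero, add_zero]
    exact ih fun J hJ => hsub J (Finset.mem_insert_of_mem hJ)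

/-- `L^p` bound for differentially subordinate Haar sums. -/
theorem exists_lintegral_haarSum_le [CompleteSpace H] {p : ℝ} (hp : 1 < p) :
    ∃ C : ℝ, 0 < C ∧ ∀ (d : ℕ) (S : Finset (DCube d)) (a b : DCube d → (Fin d → Bool) → H),
      (∀ I ∈ S, ∀ x, ‖haarSum {I} b x‖ ≤ ‖haarSum {I} a x‖) →
      ∫⁻ x, ENNReal.ofReal ‖haarSum S b x‖ ^ p ≤
        ENNReal.ofReal C * ∫⁻ x, ENNReal.ofReal ‖haarSum S a x‖ ^ p := by
  obtain ⟨α, β, hα, hβ, hU⟩ := exists_burkholderFn (H := H) hp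
  refine ⟨(2 * β / α) ^ p + 2 / α * (β * (1 + 2 * β / α) ^ (p - 1)), by positivity,
    fun d S a b hsub => ?_⟩
  set C := (2 * β / α) ^ p + 2 / α * (β * (1 + 2 * β / α) ^ (p - 1))
  have hC : 0 ≤ C := by positivity
  have key : ∫ x, ‖haarSum S b x‖ ^ p ≤ C * ∫ x, ‖haarSum S a x‖ ^ p := by
    have hi := (integrable_norm_haarSum_rpow hp S a).const_mul C
    have hi' := (integrable_burkholderFn_haarSum hp hα hβ S a b).const_mul (2 / α)
    refine (integral_mono (integrable_norm_haarSum_rpow hp S b) (hi.add hi') fun x =>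
      norm_rpow_le_burkholderFn hp hα hβ _ _).trans ?_
    simp only [Pi.add_apply]
    rw [integral_add hi hi', integral_const_mul, integral_const_mul]
    have := integral_burkholderFn_haarSum_nonpos hp hα hβ hU a b S hsub
    have := mul_nonpos_of_nonneg_of_nonpos (show 0 ≤ 2 / α by positivity) this
    linarith
  have e : ∀ c : DCube d → (Fin d → Bool) → H, ∫⁻ x, ENNReal.ofReal ‖haarSum S c x‖ ^ p =
      ENNReal.ofReal (∫ x, ‖haarSum S c x‖ ^ p) := fun c => by
    rw [ofReal_integral_eq_lintegral_ofReal (integrable_norm_haarSum_rpow hp S c)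
      (Filter.Eventually.of_forall fun x => by positivity)]
    refine lintegral_congr fun x => ?_
    rw [ENNReal.ofReal_rpow_of_nonneg (norm_nonneg _) (by linarith)]
  rw [e, e, ← ENNReal.ofReal_mul hC]
  exact ENNReal.ofReal_le_ofReal key

end HaarSum

/-! ## Reducing operators -/

section Reducing

variable {d n : ℕ} {p : ℝ} {A : (Fin d → ℝ) → Matrix (Fin n) (Fin n) ℂ}
  {ν : Measure (Fin d → ℝ)}

lemma one_lt_conj (hp : 1 < p) : 1 < p / (p - 1) := by
  rw [one_lt_div (by linarith)]; linarith

lemma holderConjugate_div (hp : 1 < p) : p.HolderConjugate (p / (p - 1)) :=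
  Real.HolderConjugate.conjExponent hp

lemma norm_inner_le_mApp_inv {M : Matrix (Fin n) (Fin n) ℂ} (hM : M.PosDef)
    (u v : EuclideanSpace ℂ (Fin n)) : ‖inner ℂ u v‖ ≤ ‖mApp M⁻¹ u‖ * ‖mApp M v‖ := by
  rw [← mApp_inv_mApp hM v, ← inner_mApp hM.inv.isHermitian, mApp_inv_mApp hM v]
  exact norm_inner_le_norm _ _

lemma measurable_ofReal_norm_mApp (hA : MatMeasurable A) (e : EuclideanSpace ℂ (Fin n)) :
    Measurable fun x => ENNReal.ofReal ‖mApp (A x) e‖ :=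
  (measurable_mApp hA measurable_const).norm.ennreal_ofReal

/-- `∫ ‖A⁻¹ e‖ ^ p' < ∞` for a matrix weight with finite `A_p` quantity. -/
lemma lintegral_matNorm_inv_lt_top (hp : 1 < p) (hpd : ∀ᵐ x ∂ν, (A x).PosDef)
    (hK : ∫⁻ x,
      (∫⁻ t, ENNReal.ofReal (matNorm (A x * (A t)⁻¹)) ^ (p / (p - 1)) ∂ν) ^ (p - 1) ∂ν < ⊤) :
    ∫⁻ t, ENNReal.ofReal (matNorm (A t)⁻¹) ^ (p / (p - 1)) ∂ν < ⊤ := by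
  have hq := one_lt_conj hp
  rcases eq_or_ne ν 0 with rfl | hν
  · simp
  obtain ⟨x, hx, hfin⟩ : ∃ x, (A x).PosDef ∧
      ∫⁻ t, ENNReal.ofReal (matNorm (A x * (A t)⁻¹)) ^ (p / (p - 1)) ∂ν < ⊤ := by
    by_contra! hcon
    apply hK.ne
    rw [lintegral_congr_ae (g := fun _ => ⊤)]
    · rw [lintegral_const, ENNReal.top_mul]
      simpa using hν
    · filter_upwards [hpd] with x hx
      rw [top_le_iff.1 (hcon x hx), ENNReal.top_rpow_of_pos (by linarith)]
  have hle : ∀ t, ENNReal.ofReal (matNorm (A t)⁻¹) ^ (p / (p - 1)) ≤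
      ENNReal.ofReal (matNorm (A x)⁻¹) ^ (p / (p - 1)) *
        ENNReal.ofReal (matNorm (A x * (A t)⁻¹)) ^ (p / (p - 1)) := fun t => by
    rw [← ENNReal.mul_rpow_of_nonneg _ _ (by linarith), ← ENNReal.ofReal_mul (matNorm_nonneg _)]
    refine ENNReal.rpow_le_rpow (ENNReal.ofReal_le_ofReal ?_) (by linarith)
    have h : (A t)⁻¹ = (A x)⁻¹ * (A x * (A t)⁻¹) := by
      rw [← mul_assoc, Matrix.nonsing_inv_mul _ ((Matrix.isUnit_iff_isUnit_det _).1 hx.isUnit),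
        one_mul]
    conv_lhs => rw [h]
    exact matNorm_mul_le _ _
  have hc : ENNReal.ofReal (matNorm (A x)⁻¹) ^ (p / (p - 1)) ≠ ⊤ :=
    ENNReal.rpow_ne_top_of_nonneg (by linarith) ENNReal.ofReal_ne_top
  refine (lintegral_mono hle).trans_lt ?_
  rw [lintegral_const_mul' _ _ hc]
  exact ENNReal.mul_lt_top hc.lt_top hfin

/-- If `V` is bounded above by the `L^p(A)` averages, then `A⁻¹ V` is bounded in `L^{p'}` with
constant controlled by the matrix `A_p` quantity. -/
lemma lintegral_inv_mApp_le (hp : 1 < p) (hA : MatMeasurable A) (hpd : ∀ᵐ x ∂ν, (A x).PosDef)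
    {K : ℝ≥0∞} (hKtop : K < ⊤)
    (hK : ∫⁻ x,
      (∫⁻ t, ENNReal.ofReal (matNorm (A x * (A t)⁻¹)) ^ (p / (p - 1)) ∂ν) ^ (p - 1) ∂ν ≤ K)
    {V : Matrix (Fin n) (Fin n) ℂ} (hV : V.IsHermitian) {c₂ : ℝ}
    (hVu : ∀ e, ENNReal.ofReal ‖mApp V e‖ ^ p ≤
      ENNReal.ofReal c₂ ^ p * ∫⁻ x, ENNReal.ofReal ‖mApp (A x) e‖ ^ p ∂ν)
    (e : EuclideanSpace ℂ (Fin n)) :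
    ∫⁻ t, ENNReal.ofReal ‖mApp (A t)⁻¹ (mApp V e)‖ ^ (p / (p - 1)) ∂ν ≤
      ((ENNReal.ofReal ‖e‖ * ENNReal.ofReal c₂) ^ p * K) ^ (1 / (p - 1)) := by
  have hq := one_lt_conj hp
  set q := p / (p - 1) with hqdef
  have hp1 : p - 1 ≠ 0 := by linarith
  have hpq : p * (q - 1) = q := by rw [hqdef]; field_simp; ring
  set u := mApp V e
  set b : (Fin d → ℝ) → ℝ := fun t => ‖mApp (A t)⁻¹ u‖ with hb
  have hbm : Measurable fun t => mApp (A t)⁻¹ u := measurable_mApp hA.inv measurable_const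
  have hb0 : ∀ t, 0 ≤ b t := fun t => norm_nonneg _
  set w : (Fin d → ℝ) → EuclideanSpace ℂ (Fin n) := fun t =>
    ((b t ^ (q - 2) : ℝ) : ℂ) • mApp (A t)⁻¹ (mApp (A t)⁻¹ u) with hw
  have hwm : Measurable w :=
    (Complex.measurable_ofReal.comp (hbm.norm.pow_const _)).smul (measurable_mApp hA.inv hbm)
  have hinv := lintegral_matNorm_inv_lt_top hp hpd (hK.trans_lt hKtop)
  set R := ∫⁻ t, ENNReal.ofReal (b t) ^ q ∂ν with hR
  have hpow : ∀ t, b t ^ (q - 2) * b t = b t ^ (q - 1) := fun t => by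
    rcases (hb0 t).eq_or_lt with h | h
    · rw [← h, mul_zero, Real.zero_rpow (by linarith)]
    · conv_lhs => rw [← Real.rpow_one (b t), ← Real.rpow_mul (hb0 t), one_mul]
      rw [← Real.rpow_add h]; congr 1; ring
  have hwnorm : ∀ (M : Matrix (Fin n) (Fin n) ℂ) t, ‖mApp M (w t)‖ ≤
      matNorm (M * (A t)⁻¹) * b t ^ (q - 1) := fun M t => by
    have : mApp M (w t) = ((b t ^ (q - 2) : ℝ) : ℂ) • mApp (M * (A t)⁻¹) (mApp (A t)⁻¹ u) := by
      rw [hw, mApp_mul]; simp [mApp]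
    rw [this, norm_smul, Complex.norm_real, Real.norm_of_nonneg (by positivity), ← hpow t]
    calc b t ^ (q - 2) * ‖mApp (M * (A t)⁻¹) (mApp (A t)⁻¹ u)‖
        ≤ b t ^ (q - 2) * (matNorm (M * (A t)⁻¹) * b t) :=
          mul_le_mul_of_nonneg_left (norm_mApp_le _ _) (by positivity)
      _ = _ := by ring
  have hbR : ∀ t, b t ≤ matNorm (A t)⁻¹ * ‖u‖ := fun t => norm_mApp_le _ _
  have hRtop : R < ⊤ := by
    have hc : ENNReal.ofReal ‖u‖ ^ q ≠ ⊤ :=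
      ENNReal.rpow_ne_top_of_nonneg (by linarith) ENNReal.ofReal_ne_top
    refine lt_of_le_of_lt (lintegral_mono (g := fun t =>
      ENNReal.ofReal (matNorm (A t)⁻¹) ^ q * ENNReal.ofReal ‖u‖ ^ q) fun t => ?_) ?_
    · beta_reduce
      rw [← ENNReal.mul_rpow_of_nonneg _ _ (by linarith), ← ENNReal.ofReal_mul (matNorm_nonneg _)]
      exact ENNReal.rpow_le_rpow (ENNReal.ofReal_le_ofReal (hbR t)) (by linarith)
    · rw [lintegral_mul_const' _ _ hc]
      exact ENNReal.mul_lt_top hinv hc.lt_top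
  have hwi : Integrable w ν := by
    refine ⟨hwm.aestronglyMeasurable, ?_⟩
    have hc : ENNReal.ofReal (‖u‖ ^ (q - 1)) ≠ ⊤ := ENNReal.ofReal_ne_top
    refine lt_of_le_of_lt (lintegral_mono (g := fun t =>
      ENNReal.ofReal (matNorm (A t)⁻¹) ^ q * ENNReal.ofReal (‖u‖ ^ (q - 1))) fun t => ?_) ?_
    · beta_reduce
      rw [← ofReal_norm, ENNReal.ofReal_rpow_of_nonneg (matNorm_nonneg _) (by linarith),
        ← ENNReal.ofReal_mul (Real.rpow_nonneg (matNorm_nonneg _) _)]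
      refine ENNReal.ofReal_le_ofReal ?_
      have h1 := hwnorm 1 t
      rw [mApp_one, one_mul] at h1
      refine h1.trans ?_
      have h2 : b t ^ (q - 1) ≤ matNorm (A t)⁻¹ ^ (q - 1) * ‖u‖ ^ (q - 1) := by
        rw [← Real.mul_rpow (matNorm_nonneg _) (norm_nonneg _)]
        exact Real.rpow_le_rpow (hb0 t) (hbR t) (by linarith)
      have h3 : matNorm (A t)⁻¹ * matNorm (A t)⁻¹ ^ (q - 1) = matNorm (A t)⁻¹ ^ q := by
        rcases (matNorm_nonneg (A t)⁻¹).eq_or_lt with h | h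
        · rw [← h, zero_mul, Real.zero_rpow (by linarith)]
        · rw [← Real.rpow_one_add' h.le (by linarith)]; congr 1; ring
      calc _ ≤ matNorm (A t)⁻¹ * (matNorm (A t)⁻¹ ^ (q - 1) * ‖u‖ ^ (q - 1)) :=
            mul_le_mul_of_nonneg_left h2 (matNorm_nonneg _)
        _ = _ := by rw [← mul_assoc, h3]
    · rw [lintegral_mul_const' _ _ hc]
      exact ENNReal.mul_lt_top hinv hc.lt_top
  set η := ∫ t, w t ∂ν with hη
  have hAη : ∀ x, ENNReal.ofReal ‖mApp (A x) η‖ ^ p ≤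
      (∫⁻ t, ENNReal.ofReal (matNorm (A x * (A t)⁻¹)) ^ q ∂ν) ^ (p - 1) * R := fun x => by
    have h1 : mApp (A x) η = ∫ t, mApp (A x) (w t) ∂ν :=
      (ContinuousLinearMap.integral_comp_comm
        (Matrix.toEuclideanCLM (𝕜 := ℂ) (n := Fin n) (A x)) hwi).symm
    have hm1 : Measurable fun t => ENNReal.ofReal (matNorm (A x * (A t)⁻¹)) :=
      (measurable_matNorm (MatMeasurable.mul (U := fun _ => A x) (W := fun t => (A t)⁻¹)
        (fun _ _ => measurable_const) hA.inv)).ennreal_ofReal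
    have hm2 : Measurable fun t => ENNReal.ofReal (b t ^ (q - 1)) :=
      (hbm.norm.pow_const _).ennreal_ofReal
    have h2 : ENNReal.ofReal ‖mApp (A x) η‖ ≤
        (∫⁻ t, ENNReal.ofReal (matNorm (A x * (A t)⁻¹)) ^ q ∂ν) ^ (1 / q) * R ^ (1 / p) := by
      rw [h1, ofReal_norm]
      refine (enorm_integral_le_lintegral_enorm _).trans ?_
      refine (lintegral_mono (g := fun t => (ENNReal.ofReal (matNorm (A x * (A t)⁻¹))) *
        ENNReal.ofReal (b t ^ (q - 1))) fun t => ?_).trans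
        ((ENNReal.lintegral_mul_le_Lp_mul_Lq ν (holderConjugate_div hp).symm hm1.aemeasurable
          hm2.aemeasurable).trans_eq ?_)
      · beta_reduce
        rw [← ofReal_norm, ← ENNReal.ofReal_mul (matNorm_nonneg _)]
        exact ENNReal.ofReal_le_ofReal (hwnorm _ _)
      · congr 2
        refine lintegral_congr fun t => ?_
        rw [ENNReal.ofReal_rpow_of_nonneg (by positivity) (by linarith),
          ENNReal.ofReal_rpow_of_nonneg (hb0 t) (by linarith), ← Real.rpow_mul (hb0 t),
          mul_comm, hpq]
    refine (ENNReal.rpow_le_rpow h2 (by linarith)).trans_eq ?_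
    rw [ENNReal.mul_rpow_of_nonneg _ _ (by linarith), ← ENNReal.rpow_mul, ← ENNReal.rpow_mul,
      one_div_mul_cancel (by linarith), ENNReal.rpow_one]
    congr 2
    rw [hqdef]; field_simp
  have hVη : ENNReal.ofReal ‖mApp V η‖ ^ p ≤ ENNReal.ofReal c₂ ^ p * (K * R) := by
    refine (hVu η).trans (mul_le_mul_right ?_ _)
    refine (lintegral_mono hAη).trans ?_
    rw [lintegral_mul_const' _ _ hRtop.ne]
    exact mul_le_mul_left hK _
  have hRi : R = ENNReal.ofReal ‖inner ℂ u η‖ := by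
    have hbi : Integrable (fun t => b t ^ q) ν := by
      refine ⟨(hbm.norm.pow_const _).aestronglyMeasurable, ?_⟩
      refine lt_of_le_of_lt (le_of_eq (lintegral_congr fun t => ?_)) hRtop
      rw [← ofReal_norm, Real.norm_of_nonneg (by positivity),
        ENNReal.ofReal_rpow_of_nonneg (hb0 t) (by linarith)]
    have h1 : inner ℂ u η = ((∫ t, b t ^ q ∂ν : ℝ) : ℂ) := by
      rw [hη, ← integral_inner hwi, ← integral_complex_ofReal]
      refine integral_congr_ae ?_
      filter_upwards [hpd] with t ht
      rw [hw]
      simp only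
      rw [inner_smul_right, ← inner_mApp ht.inv.isHermitian, inner_self_eq_norm_sq_to_K]
      have : b t ^ (q - 2) * b t ^ 2 = b t ^ q := by
        rw [pow_two, ← mul_assoc, hpow]
        rcases (hb0 t).eq_or_lt with h | h
        · rw [← h, mul_zero, Real.zero_rpow (by linarith)]
        · rw [← Real.rpow_add_one h.ne']; congr 1; ring
      rw [← this]
      push_cast
      rfl
    rw [h1, Complex.norm_real, Real.norm_of_nonneg (integral_nonneg fun t => by positivity),
      ofReal_integral_eq_lintegral_ofReal hbi (Filter.Eventually.of_forall fun t => by positivity)]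
    exact lintegral_congr fun t => ENNReal.ofReal_rpow_of_nonneg (hb0 t) (by linarith)
  have hRle : R ≤ ENNReal.ofReal ‖e‖ * ENNReal.ofReal ‖mApp V η‖ := by
    rw [hRi, inner_mApp hV, ← ENNReal.ofReal_mul (norm_nonneg _)]
    exact ENNReal.ofReal_le_ofReal (norm_inner_le_norm _ _)
  have hfin : R ^ p ≤ (ENNReal.ofReal ‖e‖ * ENNReal.ofReal c₂) ^ p * K * R := by
    refine (ENNReal.rpow_le_rpow hRle (by linarith)).trans ?_
    rw [ENNReal.mul_rpow_of_nonneg _ _ (by linarith), ENNReal.mul_rpow_of_nonneg _ _ (by linarith),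
      mul_assoc, mul_assoc]
    exact mul_le_mul_right hVη _
  rcases eq_or_ne R 0 with h0 | h0
  · rw [h0]; exact zero_le
  have h1 : R ^ (p - 1) ≤ (ENNReal.ofReal ‖e‖ * ENNReal.ofReal c₂) ^ p * K := by
    have : R ^ p = R ^ (p - 1) * R := by
      conv_rhs => rw [← ENNReal.rpow_one R, ← ENNReal.rpow_mul, one_mul]
      rw [← ENNReal.rpow_add _ _ h0 hRtop.ne]; congr 1; ring
    rw [this] at hfin
    exact (ENNReal.mul_le_mul_iff_left h0 hRtop.ne).1 hfin
  have h2 := ENNReal.rpow_le_rpow h1 (show 0 ≤ 1 / (p - 1) by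
    have : 0 < p - 1 := by linarith
    positivity)
  rwa [← ENNReal.rpow_mul, mul_one_div_cancel (by linarith), ENNReal.rpow_one] at h2

lemma lintegral_norm_inner_le (hp : 1 < p) (hA : MatMeasurable A) (hpd : ∀ᵐ x ∂ν, (A x).PosDef)
    (u v : EuclideanSpace ℂ (Fin n)) (E : Set (Fin d → ℝ)) :
    ENNReal.ofReal ‖inner ℂ u v‖ * ν E ≤
      (∫⁻ x, ENNReal.ofReal ‖mApp (A x)⁻¹ u‖ ^ (p / (p - 1)) ∂ν) ^ (1 / (p / (p - 1))) *
        (∫⁻ x in E, ENNReal.ofReal ‖mApp (A x) v‖ ^ p ∂ν) ^ (1 / p) := by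
  have hq := one_lt_conj hp
  have h1 : ∫⁻ _ in E, ENNReal.ofReal ‖inner ℂ u v‖ ∂ν ≤ ∫⁻ x in E,
      ((fun x => ENNReal.ofReal ‖mApp (A x)⁻¹ u‖) *
        fun x => ENNReal.ofReal ‖mApp (A x) v‖) x ∂ν := by
    refine lintegral_mono_ae ?_
    filter_upwards [ae_restrict_of_ae hpd] with x hx
    rw [Pi.mul_apply, ← ENNReal.ofReal_mul (norm_nonneg _)]
    exact ENNReal.ofReal_le_ofReal (norm_inner_le_mApp_inv hx u v)
  rw [setLIntegral_const] at h1
  refine h1.trans ((ENNReal.lintegral_mul_le_Lp_mul_Lq _ (holderConjugate_div hp).symm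
    (measurable_ofReal_norm_mApp hA.inv u).aemeasurable
    (measurable_ofReal_norm_mApp hA v).aemeasurable).trans ?_)
  refine mul_le_mul_left (ENNReal.rpow_le_rpow ?_ (by positivity)) _
  exact lintegral_mono' Measure.restrict_le_self le_rfl

/-- The weights `‖A e‖ ^ p` are `A_∞` with constants controlled by the `A_p` quantity of `A`. -/
lemma ofReal_norm_mApp_rpow_mul_le (hp : 1 < p) (hA : MatMeasurable A)
    (hpd : ∀ᵐ x ∂ν, (A x).PosDef) {K : ℝ≥0∞} (hKtop : K < ⊤)
    (hK : ∫⁻ x,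
      (∫⁻ t, ENNReal.ofReal (matNorm (A x * (A t)⁻¹)) ^ (p / (p - 1)) ∂ν) ^ (p - 1) ∂ν ≤ K)
    {V : Matrix (Fin n) (Fin n) ℂ} (hV : V.IsHermitian) {c₂ : ℝ}
    (hVu : ∀ e, ENNReal.ofReal ‖mApp V e‖ ^ p ≤
      ENNReal.ofReal c₂ ^ p * ∫⁻ x, ENNReal.ofReal ‖mApp (A x) e‖ ^ p ∂ν)
    (e : EuclideanSpace ℂ (Fin n)) (E : Set (Fin d → ℝ)) :
    ENNReal.ofReal ‖mApp V e‖ ^ p * ν E ^ p ≤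
      ENNReal.ofReal c₂ ^ p * K * ∫⁻ x in E, ENNReal.ofReal ‖mApp (A x) e‖ ^ p ∂ν := by
  have hq := one_lt_conj hp
  have hp1 : p - 1 ≠ 0 := by linarith
  set u := mApp V e
  rcases eq_or_ne u 0 with h0 | h0
  · rw [h0, norm_zero, ENNReal.ofReal_zero, ENNReal.zero_rpow_of_pos (by linarith), zero_mul]
    exact zero_le
  have h1 := lintegral_norm_inner_le hp hA hpd (mApp V u) e E
  have h2 := lintegral_inv_mApp_le hp hA hpd hKtop hK hV hVu u
  rw [inner_mApp hV, inner_self_eq_norm_sq_to_K] at h1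
  have h3 := ENNReal.rpow_le_rpow h2 (show 0 ≤ 1 / (p / (p - 1)) by positivity)
  rw [← ENNReal.rpow_mul, show 1 / (p - 1) * (1 / (p / (p - 1))) = 1 / p by field_simp] at h3
  have hu0 : ENNReal.ofReal ‖u‖ ≠ 0 := by simpa using h0
  have hu1 : ENNReal.ofReal ‖u‖ ≠ ⊤ := ENNReal.ofReal_ne_top
  have h4 := ENNReal.rpow_le_rpow (h1.trans (mul_le_mul_left h3 _)) (show 0 ≤ p by linarith)
  have e1 : ENNReal.ofReal ‖((‖u‖ : ℂ)) ^ 2‖ = ENNReal.ofReal ‖u‖ * ENNReal.ofReal ‖u‖ := by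
    rw [norm_pow, Complex.norm_real, norm_norm, pow_two, ENNReal.ofReal_mul (norm_nonneg _)]
  have hp0 : 0 ≤ p := by linarith
  rw [show ((‖u‖ : ℝ) : ℂ) = (RCLike.ofReal ‖u‖ : ℂ) from rfl] at e1
  rw [e1, ENNReal.mul_rpow_of_nonneg _ _ hp0, ENNReal.mul_rpow_of_nonneg _ _ hp0,
    ENNReal.mul_rpow_of_nonneg _ _ hp0, ← ENNReal.rpow_mul, ← ENNReal.rpow_mul,
    one_div_mul_cancel (by linarith), ENNReal.rpow_one, ENNReal.rpow_one,
    ENNReal.mul_rpow_of_nonneg _ _ hp0, mul_assoc, mul_assoc, mul_assoc] at h4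
  rw [mul_assoc]
  exact (ENNReal.mul_le_mul_iff_right (ENNReal.rpow_pos (pos_iff_ne_zero.2 hu0) hu1).ne'
    (ENNReal.rpow_ne_top_of_nonneg hp0 hu1)).1 h4

/-- A lower bound for `V` by the `L^p(A)` averages dualizes to an upper bound for `V⁻¹`. -/
lemma ofReal_norm_inv_mApp_rpow_le (hp : 1 < p) (hA : MatMeasurable A)
    (hpd : ∀ᵐ x ∂ν, (A x).PosDef) {V : Matrix (Fin n) (Fin n) ℂ} (hV : V.PosDef) {c₁ : ℝ}
    (hVl : ∀ e, ENNReal.ofReal c₁ ^ p * ∫⁻ x, ENNReal.ofReal ‖mApp (A x) e‖ ^ p ∂ν ≤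
      ENNReal.ofReal ‖mApp V e‖ ^ p)
    (e : EuclideanSpace ℂ (Fin n)) :
    ENNReal.ofReal c₁ ^ (p / (p - 1)) * ENNReal.ofReal ‖mApp V⁻¹ e‖ ^ (p / (p - 1)) *
      ν Set.univ ^ (p / (p - 1)) ≤
      ∫⁻ x, ENNReal.ofReal ‖mApp (A x)⁻¹ e‖ ^ (p / (p - 1)) ∂ν := by
  have hq := one_lt_conj hp
  set q := p / (p - 1)
  set u := mApp V⁻¹ e with hu
  have hp0 : 0 ≤ p := by linarith
  rcases eq_or_ne u 0 with h0 | h0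
  · rw [h0, norm_zero, ENNReal.ofReal_zero, ENNReal.zero_rpow_of_pos (by linarith)]
    simp
  have h1 := lintegral_norm_inner_le hp hA hpd e (mApp V⁻¹ u) Set.univ
  rw [Measure.restrict_univ, ← inner_mApp hV.inv.isHermitian, ← hu,
    inner_self_eq_norm_sq_to_K] at h1
  have h2 := hVl (mApp V⁻¹ u)
  rw [mApp_mApp_inv hV] at h2
  have hu0 : ENNReal.ofReal ‖u‖ ≠ 0 := by simpa using h0
  have hu1 : ENNReal.ofReal ‖u‖ ≠ ⊤ := ENNReal.ofReal_ne_top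
  have h3 := ENNReal.rpow_le_rpow h2 (show 0 ≤ 1 / p by positivity)
  rw [ENNReal.mul_rpow_of_nonneg _ _ (by positivity), ← ENNReal.rpow_mul, ← ENNReal.rpow_mul,
    mul_one_div_cancel (by linarith), ENNReal.rpow_one, ENNReal.rpow_one] at h3
  have e1 : ENNReal.ofReal ‖((‖u‖ : ℂ)) ^ 2‖ = ENNReal.ofReal ‖u‖ * ENNReal.ofReal ‖u‖ := by
    rw [norm_pow, Complex.norm_real, norm_norm, pow_two, ENNReal.ofReal_mul (norm_nonneg _)]
  rw [show ((‖u‖ : ℝ) : ℂ) = (RCLike.ofReal ‖u‖ : ℂ) from rfl] at e1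
  rw [e1] at h1
  set B := (∫⁻ x, ENNReal.ofReal ‖mApp (A x)⁻¹ e‖ ^ q ∂ν) ^ (1 / q) with hB
  have h4 : ENNReal.ofReal ‖u‖ * (ENNReal.ofReal c₁ * ENNReal.ofReal ‖u‖ * ν Set.univ) ≤
      ENNReal.ofReal ‖u‖ * B := by
    calc _ = ENNReal.ofReal c₁ * (ENNReal.ofReal ‖u‖ * ENNReal.ofReal ‖u‖ * ν Set.univ) := by ring
      _ ≤ ENNReal.ofReal c₁ * _ := mul_le_mul_right h1 _
      _ = B * (ENNReal.ofReal c₁ * _) := by ring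
      _ ≤ B * ENNReal.ofReal ‖u‖ := mul_le_mul_right h3 _
      _ = _ := mul_comm _ _
  have h5 := ENNReal.rpow_le_rpow ((ENNReal.mul_le_mul_iff_right hu0 hu1).1 h4)
    (show 0 ≤ q by linarith)
  rwa [ENNReal.mul_rpow_of_nonneg _ _ (by linarith), ENNReal.mul_rpow_of_nonneg _ _ (by linarith),
    hB, ← ENNReal.rpow_mul, one_div_mul_cancel (by linarith), ENNReal.rpow_one] at h5

end Reducing

/-! ## Averages over dyadic cubes -/

section Avg

variable {d n : ℕ} {p c₁ c₂ : ℝ} {A : (Fin d → ℝ) → Matrix (Fin n) (Fin n) ℂ}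
  {V : DCube d → Matrix (Fin n) (Fin n) ℂ}

/-- The normalized Lebesgue measure on a dyadic cube. -/
def DCube.avg (I : DCube d) : Measure (Fin d → ℝ) :=
  (ENNReal.ofReal I.vol)⁻¹ • volume.restrict I.set

lemma DCube.ofReal_vol_ne_zero (I : DCube d) : ENNReal.ofReal I.vol ≠ 0 := by
  simpa using I.vol_pos

lemma lintegral_avg (I : DCube d) (g : (Fin d → ℝ) → ℝ≥0∞) :
    ∫⁻ x, g x ∂I.avg = (ENNReal.ofReal I.vol)⁻¹ * ∫⁻ x in I.set, g x := by
  rw [DCube.avg, lintegral_smul_measure, smul_eq_mul]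

lemma avg_univ (I : DCube d) : I.avg Set.univ = 1 := by
  rw [DCube.avg, Measure.smul_apply, Measure.restrict_apply_univ, DCube.volume_set, smul_eq_mul,
    ENNReal.inv_mul_cancel I.ofReal_vol_ne_zero ENNReal.ofReal_ne_top]

lemma ae_avg {P : (Fin d → ℝ) → Prop} (h : ∀ᵐ x, P x) (I : DCube d) : ∀ᵐ x ∂I.avg, P x :=
  Measure.ae_smul_measure (ae_restrict_of_ae h) _

lemma lintegral_avg_le_apNorm (hp : 1 < p) (I : DCube d) :
    ∫⁻ x, (∫⁻ t, ENNReal.ofReal (matNorm (A x * (A t)⁻¹)) ^ (p / (p - 1)) ∂I.avg) ^ (p - 1) ∂I.avg ≤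
      apNorm p A := by
  have hsub : I.set ⊆ cubeSet I.corner I.side := fun x hx i => by
    have := hx i
    refine ⟨this.1, this.2.le.trans_eq ?_⟩
    simp only [DCube.corner, DCube.side]
    ring
  refine le_trans ?_ (le_iSup₂_of_le I.corner I.side (le_iSup_of_le
    (show 0 < I.side by unfold DCube.side; positivity) le_rfl))
  rw [lintegral_avg]
  refine mul_le_mul_right ((lintegral_mono fun x => ?_).trans (lintegral_mono_set hsub)) _
  rw [lintegral_avg]
  exact ENNReal.rpow_le_rpow (mul_le_mul_right (lintegral_mono_set hsub) _) (by linarith)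

lemma IsReducing.le_lintegral (hp : 1 < p) (hV : IsReducing p c₁ c₂ A V) (I : DCube d)
    (e : EuclideanSpace ℂ (Fin n)) : ENNReal.ofReal ‖mApp (V I) e‖ ^ p ≤
      ENNReal.ofReal c₂ ^ p * ∫⁻ x, ENNReal.ofReal ‖mApp (A x) e‖ ^ p ∂I.avg := by
  have h := ENNReal.rpow_le_rpow ((hV I).2 e).2 (show 0 ≤ p by linarith)
  rwa [ENNReal.mul_rpow_of_nonneg _ _ (by linarith), redAvgD, ← ENNReal.rpow_mul,
    one_div_mul_cancel (by linarith), ENNReal.rpow_one, ← lintegral_avg] at h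

lemma IsReducing.lintegral_le (hp : 1 < p) (hV : IsReducing p c₁ c₂ A V) (I : DCube d)
    (e : EuclideanSpace ℂ (Fin n)) :
    ENNReal.ofReal c₁ ^ p * ∫⁻ x, ENNReal.ofReal ‖mApp (A x) e‖ ^ p ∂I.avg ≤
      ENNReal.ofReal ‖mApp (V I) e‖ ^ p := by
  have h := ENNReal.rpow_le_rpow ((hV I).2 e).1 (show 0 ≤ p by linarith)
  rwa [ENNReal.mul_rpow_of_nonneg _ _ (by linarith), redAvgD, ← ENNReal.rpow_mul,
    one_div_mul_cancel (by linarith), ENNReal.rpow_one, ← lintegral_avg] at h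

lemma IsReducing.setLIntegral_le (hp : 1 < p) (hV : IsReducing p c₁ c₂ A V) (I : DCube d)
    (e : EuclideanSpace ℂ (Fin n)) :
    ENNReal.ofReal c₁ ^ p * ∫⁻ x in I.set, ENNReal.ofReal ‖mApp (A x) e‖ ^ p ≤
      ENNReal.ofReal I.vol * ENNReal.ofReal ‖mApp (V I) e‖ ^ p := by
  have h := mul_le_mul_right (hV.lintegral_le hp I e) (ENNReal.ofReal I.vol)
  rw [lintegral_avg] at h
  refine le_trans (le_of_eq ?_) h
  rw [mul_left_comm, ← mul_assoc (ENNReal.ofReal I.vol),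
    ENNReal.mul_inv_cancel I.ofReal_vol_ne_zero ENNReal.ofReal_ne_top, one_mul]

lemma IsReducing.vol_mul_le (hp : 1 < p) (hV : IsReducing p c₁ c₂ A V) (I : DCube d)
    (e : EuclideanSpace ℂ (Fin n)) :
    ENNReal.ofReal I.vol * ENNReal.ofReal ‖mApp (V I) e‖ ^ p ≤
      ENNReal.ofReal c₂ ^ p * ∫⁻ x in I.set, ENNReal.ofReal ‖mApp (A x) e‖ ^ p := by
  have h := mul_le_mul_right (hV.le_lintegral hp I e) (ENNReal.ofReal I.vol)
  rw [lintegral_avg] at h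
  refine h.trans (le_of_eq ?_)
  rw [mul_left_comm, ← mul_assoc (ENNReal.ofReal I.vol),
    ENNReal.mul_inv_cancel I.ofReal_vol_ne_zero ENNReal.ofReal_ne_top, one_mul]

lemma IsReducing.vol_mul_inv_le (hp : 1 < p) (hA : MatMeasurable A) (hpd : ∀ᵐ x, (A x).PosDef)
    (hV : IsReducing p c₁ c₂ A V) (I : DCube d) (e : EuclideanSpace ℂ (Fin n)) :
    ENNReal.ofReal c₁ ^ (p / (p - 1)) *
      (ENNReal.ofReal I.vol * ENNReal.ofReal ‖mApp (V I)⁻¹ e‖ ^ (p / (p - 1))) ≤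
      ∫⁻ x in I.set, ENNReal.ofReal ‖mApp (A x)⁻¹ e‖ ^ (p / (p - 1)) := by
  have h := ofReal_norm_inv_mApp_rpow_le hp hA (ae_avg hpd I) (hV I).1 (hV.lintegral_le hp I) e
  rw [avg_univ, ENNReal.one_rpow, mul_one, lintegral_avg] at h
  have h := mul_le_mul_right h (ENNReal.ofReal I.vol)
  rwa [mul_left_comm, ← mul_assoc (ENNReal.ofReal I.vol) (ENNReal.ofReal I.vol)⁻¹,
    ENNReal.mul_inv_cancel I.ofReal_vol_ne_zero ENNReal.ofReal_ne_top, one_mul] at h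

lemma IsReducing.setLIntegral_inv_le (hp : 1 < p) (hA : MatMeasurable A)
    (hpd : ∀ᵐ x, (A x).PosDef) (hap : apNorm p A < ⊤)
    (hV : IsReducing p c₁ c₂ A V) (I : DCube d) (e : EuclideanSpace ℂ (Fin n)) :
    ∫⁻ x in I.set, ENNReal.ofReal ‖mApp (A x)⁻¹ (mApp (V I) e)‖ ^ (p / (p - 1)) ≤
      ENNReal.ofReal I.vol *
        ((ENNReal.ofReal ‖e‖ * ENNReal.ofReal c₂) ^ p * apNorm p A) ^ (1 / (p - 1)) := by
  have h := lintegral_inv_mApp_le hp hA (ae_avg hpd I) hap (lintegral_avg_le_apNorm hp I)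
    (hV I).1.isHermitian (hV.le_lintegral hp I) e
  rw [lintegral_avg] at h
  have h := mul_le_mul_right h (ENNReal.ofReal I.vol)
  rwa [← mul_assoc, ENNReal.mul_inv_cancel I.ofReal_vol_ne_zero ENNReal.ofReal_ne_top,
    one_mul] at h

/-- The weights `‖A e‖ ^ p` are uniformly dyadic `A_∞`. -/
lemma IsReducing.setLIntegral_mul_rpow_le (hp : 1 < p) (hA : MatMeasurable A)
    (hpd : ∀ᵐ x, (A x).PosDef) (hap : apNorm p A < ⊤)
    (hV : IsReducing p c₁ c₂ A V) (I : DCube d) (e : EuclideanSpace ℂ (Fin n))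
    {E : Set (Fin d → ℝ)} (hE : E ⊆ I.set) (hEm : MeasurableSet E) :
    ENNReal.ofReal c₁ ^ p * (∫⁻ x in I.set, ENNReal.ofReal ‖mApp (A x) e‖ ^ p) *
      ((ENNReal.ofReal I.vol)⁻¹ * volume E) ^ p ≤
      ENNReal.ofReal c₂ ^ p * apNorm p A * ∫⁻ x in E, ENNReal.ofReal ‖mApp (A x) e‖ ^ p := by
  have h := ofReal_norm_mApp_rpow_mul_le hp hA (ae_avg hpd I) hap (lintegral_avg_le_apNorm hp I)
    (hV I).1.isHermitian (hV.le_lintegral hp I) e E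
  have e1 : I.avg E = (ENNReal.ofReal I.vol)⁻¹ * volume E := by
    rw [DCube.avg, Measure.smul_apply, Measure.restrict_apply hEm, smul_eq_mul,
      Set.inter_eq_left.2 hE]
  have e2 : ∫⁻ x in E, ENNReal.ofReal ‖mApp (A x) e‖ ^ p ∂I.avg =
      (ENNReal.ofReal I.vol)⁻¹ * ∫⁻ x in E, ENNReal.ofReal ‖mApp (A x) e‖ ^ p := by
    rw [DCube.avg, Measure.restrict_smul, lintegral_smul_measure, smul_eq_mul,
      Measure.restrict_restrict hEm, Set.inter_eq_left.2 hE]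
  rw [e1, e2] at h
  have h := mul_le_mul_right h (ENNReal.ofReal I.vol)
  rw [← mul_assoc, mul_left_comm (ENNReal.ofReal I.vol) (_ * _),
    ← mul_assoc (ENNReal.ofReal I.vol) (ENNReal.ofReal I.vol)⁻¹,
    ENNReal.mul_inv_cancel I.ofReal_vol_ne_zero ENNReal.ofReal_ne_top, one_mul] at h
  exact (mul_le_mul_left (hV.setLIntegral_le hp I e) _).trans h

lemma IsReducing.rpow_le_apNorm (hn : 0 < n) (hp : 1 < p) (hc₁ : 0 < c₁) (hA : MatMeasurable A)
    (hpd : ∀ᵐ x, (A x).PosDef) (hap : apNorm p A < ⊤)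
    (hV : IsReducing p c₁ c₂ A V) (I : DCube d) :
    ENNReal.ofReal c₁ ^ p ≤ ENNReal.ofReal c₂ ^ p * apNorm p A := by
  obtain ⟨e, he⟩ : ∃ e : EuclideanSpace ℂ (Fin n), e ≠ 0 :=
    ⟨EuclideanSpace.single ⟨0, hn⟩ 1, by simp⟩
  have hVe : ENNReal.ofReal ‖mApp (V I) e‖ ^ p ≠ 0 := by
    refine (ENNReal.rpow_pos ?_ ENNReal.ofReal_ne_top).ne'
    simp only [ENNReal.ofReal_pos, norm_pos_iff]
    intro h
    apply he
    rw [← mApp_inv_mApp (hV I).1 e, h, mApp_zero]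
  have h1 := hV.setLIntegral_mul_rpow_le hp hA hpd hap I e le_rfl I.measurableSet_set
  rw [DCube.volume_set, ENNReal.inv_mul_cancel I.ofReal_vol_ne_zero ENNReal.ofReal_ne_top,
    ENNReal.one_rpow, mul_one] at h1
  have h2 := hV.vol_mul_le hp I e
  have h3 := hV.setLIntegral_le hp I e
  set w := ∫⁻ x in I.set, ENNReal.ofReal ‖mApp (A x) e‖ ^ p
  have hw0 : w ≠ 0 := by
    intro h0
    rw [h0, mul_zero, nonpos_iff_eq_zero, mul_eq_zero] at h2
    exact h2.elim I.ofReal_vol_ne_zero hVe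
  have hw1 : w ≠ ⊤ := by
    intro h0
    have hc : ENNReal.ofReal c₁ ^ p ≠ 0 :=
      (ENNReal.rpow_pos (by simpa using hc₁) ENNReal.ofReal_ne_top).ne'
    rw [h0, ENNReal.mul_top hc, top_le_iff] at h3
    exact ENNReal.mul_ne_top ENNReal.ofReal_ne_top
      (ENNReal.rpow_ne_top_of_nonneg (by linarith) ENNReal.ofReal_ne_top) h3
  exact (ENNReal.mul_le_mul_iff_left hw0 hw1).1 h1

end Avg

/-! ## Stopping times -/

section Stopping

variable {d n : ℕ} {p c₁ c₂ l₁ l₂ : ℝ} {A : (Fin d → ℝ) → Matrix (Fin n) (Fin n) ℂ}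
  {V : DCube d → Matrix (Fin n) (Fin n) ℂ} {𝒥 : DCube d → Set (DCube d)}

/-- The union of the cubes of the `m`-th iterated stopping collection. -/
def iterUnion (𝒥 : DCube d → Set (DCube d)) (m : ℕ) (I₀ : DCube d) : Set (Fin d → ℝ) :=
  ⋃ J ∈ JIter 𝒥 m I₀, J.set

lemma measurableSet_biUnion_cubes (𝒢 : Set (DCube d)) : MeasurableSet (⋃ J ∈ 𝒢, J.set) :=
  MeasurableSet.biUnion 𝒢.to_countable fun J _ => J.measurableSet_set

lemma iterUnion_succ (𝒥 : DCube d → Set (DCube d)) (m : ℕ) (I₀ : DCube d) :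
    iterUnion 𝒥 (m + 1) I₀ = ⋃ L ∈ JIter 𝒥 m I₀, ⋃ J ∈ 𝒥 L, J.set := by
  ext x
  simp only [iterUnion, JIter, Set.mem_iUnion, exists_prop]
  constructor
  · rintro ⟨J, ⟨L, hL, hJ⟩, hx⟩; exact ⟨L, hL, J, hJ, hx⟩
  · rintro ⟨L, hL, J, hJ, hx⟩; exact ⟨J, ⟨L, hL, hJ⟩, hx⟩

lemma IsStopping.jIter_pairwiseDisjoint (h : IsStopping 𝒥) (m : ℕ) (I₀ : DCube d) :
    (JIter 𝒥 m I₀).PairwiseDisjoint DCube.set := by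
  induction m with
  | zero => exact Set.pairwiseDisjoint_singleton _ _
  | succ m ih =>
    intro J hJ J' hJ' hne
    simp only [JIter, Set.mem_iUnion, exists_prop] at hJ hJ'
    obtain ⟨L, hL, hJ⟩ := hJ
    obtain ⟨L', hL', hJ'⟩ := hJ'
    by_cases hLL : L = L'
    · subst hLL
      exact (h L).2 hJ hJ' hne
    · exact (ih hL hL' hLL).mono ((h L).1 J hJ) ((h L').1 J' hJ')

lemma IsStopping.exists_jIter_of_le (h : IsStopping 𝒥) {I₀ J : DCube d} {j m : ℕ} (hjm : j ≤ m)
    (hJ : J ∈ JIter 𝒥 m I₀) : ∃ J' ∈ JIter 𝒥 j I₀, J.set ⊆ J'.set := by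
  induction m, hjm using Nat.le_induction generalizing J with
  | base => exact ⟨J, hJ, le_rfl⟩
  | succ m _ ih =>
    simp only [JIter, Set.mem_iUnion, exists_prop] at hJ
    obtain ⟨L, hL, hJ⟩ := hJ
    obtain ⟨J', hJ', hs⟩ := ih hL
    exact ⟨J', hJ', ((h L).1 J hJ).trans hs⟩

lemma IsStopping.subset_of_mem_jIter (h : IsStopping 𝒥) {I₀ J : DCube d} {m : ℕ}
    (hJ : J ∈ JIter 𝒥 m I₀) : J.set ⊆ I₀.set := by
  obtain ⟨J', hJ', hs⟩ := h.exists_jIter_of_le (Nat.zero_le m) hJ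
  rwa [Set.mem_singleton_iff.1 hJ'] at hs

lemma IsStopping.mem_fcol_of_mem_fj (h : IsStopping 𝒥) {I₀ I L : DCube d} {j : ℕ}
    (hI : I ∈ Fj 𝒥 I₀ j) (hL : L ∈ JIter 𝒥 (j - 1) I₀) {x : Fin d → ℝ} (hxI : x ∈ I.set)
    (hxL : x ∈ L.set) : I ∈ Fcol 𝒥 L := by
  simp only [Fj, Set.mem_iUnion, exists_prop] at hI
  obtain ⟨L', hL', hI⟩ := hI
  have : L' = L := by
    by_contra hne
    exact Set.disjoint_left.1 (h.jIter_pairwiseDisjoint _ _ hL' hL hne) (hI.1 hxI) hxL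
  rwa [← this]

lemma subset_iterUnion_of_mem_fj {I₀ I : DCube d} {j : ℕ}
    (hI : I ∈ Fj 𝒥 I₀ j) : I.set ⊆ iterUnion 𝒥 (j - 1) I₀ := by
  simp only [Fj, Set.mem_iUnion, exists_prop] at hI
  obtain ⟨L', hL', hI⟩ := hI
  exact fun x hx => Set.mem_biUnion hL' (hI.1 hx)

/-- A cube of `ℱ^j` that meets a cube of a later stopping generation is strictly larger. -/
lemma IsStopping.lt_or_disjoint_of_mem_fj (h : IsStopping 𝒥) {I₀ I J : DCube d} {j m : ℕ}
    (hj : 1 ≤ j) (hjm : j ≤ m) (hI : I ∈ Fj 𝒥 I₀ j) (hJ : J ∈ JIter 𝒥 m I₀) :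
    J.k < I.k ∨ Disjoint I.set J.set := by
  by_contra! hcon
  obtain ⟨x, hxI, hxJ⟩ := Set.not_disjoint_iff.1 hcon.2
  have hIJ := DCube.subset_of_k_le hcon.1 hxI hxJ
  obtain ⟨J', hJ', hs⟩ := h.exists_jIter_of_le hjm hJ
  obtain ⟨i, rfl⟩ : ∃ i, j = i + 1 := ⟨j - 1, by omega⟩
  simp only [JIter, Set.mem_iUnion, exists_prop] at hJ'
  obtain ⟨L, hL, hJL⟩ := hJ'
  have := h.mem_fcol_of_mem_fj hI hL hxI ((h L).1 _ hJL (hs hxJ))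
  exact this.2 J' hJL (hIJ.trans hs)

lemma isStopping_stopST (p l₁ l₂ : ℝ) (V : DCube d → Matrix (Fin n) (Fin n) ℂ) :
    IsStopping (stopST p l₁ l₂ V) := by
  intro I
  refine ⟨fun J hJ => hJ.1, fun J hJ K hK hne => Set.disjoint_left.2 fun x hxJ hxK => hne ?_⟩
  rcases le_total J.k K.k with h | h
  · exact (hJ.2.2 K hK.1 hK.2.1 (DCube.subset_of_k_le h hxJ hxK)).symm
  · exact hK.2.2 J hJ.1 hJ.2.1 (DCube.subset_of_k_le h hxK hxJ)

lemma not_stopBad_of_mem_fcol (hd : 0 < d) {I Q : DCube d}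
    (hQ : Q ∈ Fcol (stopST p l₁ l₂ V) I) : ¬ stopBad p l₁ l₂ V Q I := by
  intro hbad
  obtain ⟨k, ⟨K, hK, hKk⟩, hmax⟩ := Int.exists_greatest_of_bdd
    (P := fun k => ∃ K : DCube d, (Q.set ⊆ K.set ∧ K.set ⊆ I.set ∧ stopBad p l₁ l₂ V K I) ∧ K.k = k)
    ⟨I.k, by
      rintro _ ⟨K, hK, rfl⟩
      exact DCube.k_le_of_subset hd hK.2.1⟩
    ⟨Q.k, Q, ⟨le_rfl, hQ.1, hbad⟩, rfl⟩
  refine hQ.2 K ⟨hK.2.1, hK.2.2, fun K' h1 h2 h3 => ?_⟩ hK.1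
  have h4 := hmax K'.k ⟨K', ⟨hK.1.trans h3, h1, h2⟩, rfl⟩
  exact DCube.eq_of_k_eq (le_antisymm (h4.trans hKk.ge) (DCube.k_le_of_subset hd h3))
    (h3 K.corner_mem) K.corner_mem

lemma parent_of_mem_stopST (hd : 0 < d) {I J : DCube d} (hJ : J ∈ stopST p l₁ l₂ V I)
    (hne : J ≠ I) : J.parent.set ⊆ I.set ∧ ¬ stopBad p l₁ l₂ V J.parent I := by
  have hlt : J.k < I.k := lt_of_le_of_ne (DCube.k_le_of_subset hd hJ.1) fun h =>
    hne (DCube.eq_of_k_eq h J.corner_mem (hJ.1 J.corner_mem))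
  have hs := DCube.parent_subset hJ.1 hlt
  refine ⟨hs, fun hbad => ?_⟩
  have h1 : J.parent.k = J.k := congrArg DCube.k (hJ.2.2 J.parent hs hbad J.subset_parent)
  simp [DCube.parent, DCube.around] at h1

lemma mul_volume_biUnion_le {𝒢 : Set (DCube d)} (hdis : 𝒢.PairwiseDisjoint DCube.set) {I : DCube d}
    (hsub : ∀ J ∈ 𝒢, J.set ⊆ I.set) {c : ℝ≥0∞} {g : (Fin d → ℝ) → ℝ≥0∞}
    (h : ∀ J ∈ 𝒢, c * ENNReal.ofReal J.vol ≤ ∫⁻ x in J.set, g x) :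
    c * volume (⋃ J ∈ 𝒢, J.set) ≤ ∫⁻ x in I.set, g x := by
  calc c * volume (⋃ J ∈ 𝒢, J.set)
      = ∑' J : 𝒢, c * ENNReal.ofReal (J : DCube d).vol := by
        rw [measure_biUnion 𝒢.to_countable hdis fun J _ => J.measurableSet_set,
          ENNReal.tsum_mul_left]
        simp only [DCube.volume_set]
    _ ≤ ∑' J : 𝒢, ∫⁻ x in (J : DCube d).set, g x := ENNReal.tsum_le_tsum fun J => h J J.2
    _ = ∫⁻ x in ⋃ J ∈ 𝒢, J.set, g x :=
        (lintegral_biUnion 𝒢.to_countable (fun J _ => J.measurableSet_set) hdis g).symm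
    _ ≤ _ := lintegral_mono_set (Set.iUnion₂_subset hsub)

lemma ofReal_matNorm_rpow_le_sum (M : Matrix (Fin n) (Fin n) ℂ) {q : ℝ} (hq : 0 < q) :
    ENNReal.ofReal (matNorm M ^ q) ≤
      (n : ℝ≥0∞) ^ q * ∑ i, ENNReal.ofReal ‖mApp M (EuclideanSpace.single i 1)‖ ^ q := by
  refine (ENNReal.ofReal_le_ofReal (matNorm_rpow_le_sum M hq)).trans_eq ?_
  rw [ENNReal.ofReal_mul (by positivity), ENNReal.ofReal_sum_of_nonneg fun _ _ => by positivity,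
    ← ENNReal.ofReal_rpow_of_nonneg (by positivity) hq.le, ENNReal.ofReal_natCast]
  congr 1
  exact Finset.sum_congr rfl fun i _ =>
    (ENNReal.ofReal_rpow_of_nonneg (norm_nonneg _) hq.le).symm

lemma four_mul_volume_direct_le (hn : 0 < n) (hp : 1 < p) (hc₂ : 0 < c₂)
    (hA : MatMeasurable A) (hV : IsReducing p c₁ c₂ A V) (I : DCube d)
    (hl₁ : 4 * ((n : ℝ≥0∞) ^ p * ENNReal.ofReal c₂ ^ p * n) ≤
      ENNReal.ofReal c₁ ^ p * ENNReal.ofReal l₁)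
    {𝒢 : Set (DCube d)} (hdis : 𝒢.PairwiseDisjoint DCube.set) (hsub : ∀ J ∈ 𝒢, J.set ⊆ I.set)
    (hbad : ∀ J ∈ 𝒢, l₁ < matNorm (V J * (V I)⁻¹) ^ p) :
    4 * volume (⋃ J ∈ 𝒢, J.set) ≤ ENNReal.ofReal I.vol := by
  set u : Fin n → EuclideanSpace ℂ (Fin n) := fun i => mApp (V I)⁻¹ (EuclideanSpace.single i 1)
  have hm : ∀ i, Measurable fun x => ENNReal.ofReal ‖mApp (A x) (u i)‖ ^ p := fun i =>
    (measurable_ofReal_norm_mApp hA (u i)).pow_const _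
  have hint : ∀ Q : DCube d, ∫⁻ x in Q.set, ((n : ℝ≥0∞) ^ p * ENNReal.ofReal c₂ ^ p) *
      ∑ i, ENNReal.ofReal ‖mApp (A x) (u i)‖ ^ p = ((n : ℝ≥0∞) ^ p * ENNReal.ofReal c₂ ^ p) *
      ∑ i, ∫⁻ x in Q.set, ENNReal.ofReal ‖mApp (A x) (u i)‖ ^ p := fun Q => by
    rw [lintegral_const_mul _ (Finset.measurable_fun_sum _ fun i _ => hm i),
      lintegral_finsetSum _ fun i _ => hm i]
  have h1 : ENNReal.ofReal l₁ * volume (⋃ J ∈ 𝒢, J.set) ≤ _ :=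
    mul_volume_biUnion_le hdis hsub (g := fun x => ((n : ℝ≥0∞) ^ p * ENNReal.ofReal c₂ ^ p) *
      ∑ i, ENNReal.ofReal ‖mApp (A x) (u i)‖ ^ p) fun J hJ => by
      rw [hint]
      refine (mul_le_mul_left ((ENNReal.ofReal_le_ofReal (hbad J hJ).le).trans
        (ofReal_matNorm_rpow_le_sum _ (by linarith))) _).trans ?_
      rw [mul_assoc, mul_assoc, Finset.sum_mul,
        Finset.mul_sum (Finset.univ) _ (ENNReal.ofReal c₂ ^ p)]
      refine mul_le_mul_right (Finset.sum_le_sum fun i _ => ?_) _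
      rw [mul_comm, mApp_mul]
      exact hV.vol_mul_le hp J (u i)
  rw [hint] at h1
  have h2 : ENNReal.ofReal c₁ ^ p * ∑ i, ∫⁻ x in I.set, ENNReal.ofReal ‖mApp (A x) (u i)‖ ^ p ≤
      n * ENNReal.ofReal I.vol := by
    rw [Finset.mul_sum]
    refine (Finset.sum_le_sum fun i _ => hV.setLIntegral_le hp I (u i)).trans_eq ?_
    have : ∀ i, mApp (V I) (u i) = EuclideanSpace.single i 1 := fun i =>
      mApp_mApp_inv (hV I).1 _
    simp [this]
  set w := ∑ i, ∫⁻ x in I.set, ENNReal.ofReal ‖mApp (A x) (u i)‖ ^ p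
  set N := (n : ℝ≥0∞) ^ p * ENNReal.ofReal c₂ ^ p * n
  have hN0 : N ≠ 0 := by
    refine mul_ne_zero (mul_ne_zero (ENNReal.rpow_pos ?_ (by simp)).ne'
      (ENNReal.rpow_pos (by simpa) (by simp)).ne') ?_
    · exact_mod_cast hn
    · exact_mod_cast hn.ne'
  have hN1 : N ≠ ⊤ := ENNReal.mul_ne_top (ENNReal.mul_ne_top
    (ENNReal.rpow_ne_top_of_nonneg (by linarith) (by simp))
    (ENNReal.rpow_ne_top_of_nonneg (by linarith) (by simp))) (by simp)
  refine (ENNReal.mul_le_mul_iff_right hN0 hN1).1 ?_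
  calc N * (4 * volume (⋃ J ∈ 𝒢, J.set)) = 4 * N * volume (⋃ J ∈ 𝒢, J.set) := by ring
    _ ≤ ENNReal.ofReal c₁ ^ p * ENNReal.ofReal l₁ * volume (⋃ J ∈ 𝒢, J.set) :=
        mul_le_mul_left hl₁ _
    _ ≤ ENNReal.ofReal c₁ ^ p * ((n : ℝ≥0∞) ^ p * ENNReal.ofReal c₂ ^ p * w) := by
        rw [mul_assoc]
        exact mul_le_mul_right h1 _
    _ = (n : ℝ≥0∞) ^ p * ENNReal.ofReal c₂ ^ p * (ENNReal.ofReal c₁ ^ p * w) := mul_left_comm _ _ _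
    _ ≤ (n : ℝ≥0∞) ^ p * ENNReal.ofReal c₂ ^ p * (n * ENNReal.ofReal I.vol) := mul_le_mul_right h2 _
    _ = _ := by rw [← mul_assoc]

lemma four_mul_volume_dual_le (hn : 0 < n) (hp : 1 < p) (hc₁ : 0 < c₁)
    (hA : MatMeasurable A) (hpd : ∀ᵐ x, (A x).PosDef) (hap : apNorm p A < ⊤)
    (hV : IsReducing p c₁ c₂ A V) (I : DCube d)
    (hl₂ : 4 * ((n : ℝ≥0∞) ^ (p / (p - 1)) * n *
        (ENNReal.ofReal c₂ ^ p * apNorm p A) ^ (1 / (p - 1))) ≤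
      ENNReal.ofReal c₁ ^ (p / (p - 1)) * ENNReal.ofReal l₂)
    {𝒢 : Set (DCube d)} (hdis : 𝒢.PairwiseDisjoint DCube.set) (hsub : ∀ J ∈ 𝒢, J.set ⊆ I.set)
    (hbad : ∀ J ∈ 𝒢, l₂ < matNorm ((V J)⁻¹ * V I) ^ (p / (p - 1))) :
    4 * volume (⋃ J ∈ 𝒢, J.set) ≤ ENNReal.ofReal I.vol := by
  have hq := one_lt_conj hp
  set q := p / (p - 1)
  set u : Fin n → EuclideanSpace ℂ (Fin n) := fun i => mApp (V I) (EuclideanSpace.single i 1)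
  have hm : ∀ i, Measurable fun x => ENNReal.ofReal ‖mApp (A x)⁻¹ (u i)‖ ^ q := fun i =>
    (measurable_ofReal_norm_mApp hA.inv (u i)).pow_const _
  have hint : ∀ Q : DCube d, ∫⁻ x in Q.set, (n : ℝ≥0∞) ^ q *
      ∑ i, ENNReal.ofReal ‖mApp (A x)⁻¹ (u i)‖ ^ q = (n : ℝ≥0∞) ^ q *
      ∑ i, ∫⁻ x in Q.set, ENNReal.ofReal ‖mApp (A x)⁻¹ (u i)‖ ^ q := fun Q => by
    rw [lintegral_const_mul _ (Finset.measurable_fun_sum _ fun i _ => hm i),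
      lintegral_finsetSum _ fun i _ => hm i]
  have h1 : ENNReal.ofReal c₁ ^ q * ENNReal.ofReal l₂ * volume (⋃ J ∈ 𝒢, J.set) ≤ _ :=
    mul_volume_biUnion_le hdis hsub (g := fun x => (n : ℝ≥0∞) ^ q *
      ∑ i, ENNReal.ofReal ‖mApp (A x)⁻¹ (u i)‖ ^ q) fun J hJ => by
      rw [hint, mul_assoc]
      refine (mul_le_mul_right (mul_le_mul_left ((ENNReal.ofReal_le_ofReal (hbad J hJ).le).trans
        (ofReal_matNorm_rpow_le_sum _ (by linarith))) _) _).trans ?_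
      rw [mul_assoc, mul_left_comm, Finset.sum_mul, Finset.mul_sum]
      refine mul_le_mul_right (Finset.sum_le_sum fun i _ => ?_) _
      rw [mul_comm (_ ^ q) (ENNReal.ofReal J.vol), mApp_mul]
      exact hV.vol_mul_inv_le hp hA hpd J (u i)
  rw [hint] at h1
  have h2 : ∑ i, ∫⁻ x in I.set, ENNReal.ofReal ‖mApp (A x)⁻¹ (u i)‖ ^ q ≤
      n * (ENNReal.ofReal I.vol * (ENNReal.ofReal c₂ ^ p * apNorm p A) ^ (1 / (p - 1))) := by
    refine (Finset.sum_le_sum fun i _ => hV.setLIntegral_inv_le hp hA hpd hap I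
      (EuclideanSpace.single i 1)).trans_eq ?_
    simp
  set N := (n : ℝ≥0∞) ^ q * n * (ENNReal.ofReal c₂ ^ p * apNorm p A) ^ (1 / (p - 1))
  have hK0 : ENNReal.ofReal c₂ ^ p * apNorm p A ≠ 0 := by
    have h := hV.rpow_le_apNorm hn hp hc₁ hA hpd hap I
    exact (lt_of_lt_of_le (ENNReal.rpow_pos (by simpa) (by simp)) h).ne'
  have hK1 : ENNReal.ofReal c₂ ^ p * apNorm p A ≠ ⊤ :=
    ENNReal.mul_ne_top (ENNReal.rpow_ne_top_of_nonneg (by linarith) (by simp)) hap.ne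
  have hN0 : N ≠ 0 := by
    refine mul_ne_zero (mul_ne_zero (ENNReal.rpow_pos ?_ (by simp)).ne' ?_)
      (ENNReal.rpow_pos (pos_iff_ne_zero.2 hK0) hK1).ne'
    · exact_mod_cast hn
    · exact_mod_cast hn.ne'
  have hN1 : N ≠ ⊤ := ENNReal.mul_ne_top (ENNReal.mul_ne_top
    (ENNReal.rpow_ne_top_of_nonneg (by linarith) (by simp)) (by simp))
    (ENNReal.rpow_ne_top_of_nonneg (one_div_nonneg.2 (by linarith)) hK1)
  refine (ENNReal.mul_le_mul_iff_right hN0 hN1).1 ?_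
  calc N * (4 * volume (⋃ J ∈ 𝒢, J.set)) = 4 * N * volume (⋃ J ∈ 𝒢, J.set) := by ring
    _ ≤ ENNReal.ofReal c₁ ^ q * ENNReal.ofReal l₂ * volume (⋃ J ∈ 𝒢, J.set) :=
        mul_le_mul_left hl₂ _
    _ ≤ _ := h1
    _ ≤ _ := mul_le_mul_right h2 _
    _ = _ := by ring

/-- The decay lemma: the stopping cubes cover at most half of each cube. -/
lemma two_mul_volume_stopST_le (hn : 0 < n) (hp : 1 < p) (hc₁ : 0 < c₁) (hc₂ : 0 < c₂)
    (hA : MatMeasurable A) (hpd : ∀ᵐ x, (A x).PosDef) (hap : apNorm p A < ⊤)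
    (hV : IsReducing p c₁ c₂ A V)
    (hl₁ : 4 * ((n : ℝ≥0∞) ^ p * ENNReal.ofReal c₂ ^ p * n) ≤
      ENNReal.ofReal c₁ ^ p * ENNReal.ofReal l₁)
    (hl₂ : 4 * ((n : ℝ≥0∞) ^ (p / (p - 1)) * n *
        (ENNReal.ofReal c₂ ^ p * apNorm p A) ^ (1 / (p - 1))) ≤
      ENNReal.ofReal c₁ ^ (p / (p - 1)) * ENNReal.ofReal l₂) (I : DCube d) :
    2 * volume (⋃ J ∈ stopST p l₁ l₂ V I, J.set) ≤ ENNReal.ofReal I.vol := by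
  set 𝒢 := stopST p l₁ l₂ V I
  have hst := isStopping_stopST p l₁ l₂ V I
  have hdis : 𝒢.PairwiseDisjoint DCube.set := hst.2
  set 𝒢₁ := {J ∈ 𝒢 | l₁ < matNorm (V J * (V I)⁻¹) ^ p}
  set 𝒢₂ := {J ∈ 𝒢 | l₂ < matNorm ((V J)⁻¹ * V I) ^ (p / (p - 1))}
  have h1 := four_mul_volume_direct_le hn hp hc₂ hA hV I hl₁
    (hdis.subset (Set.sep_subset _ _)) (fun J (hJ : J ∈ 𝒢₁) => hst.1 J hJ.1) fun J hJ => hJ.2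
  have h2 := four_mul_volume_dual_le hn hp hc₁ hA hpd hap hV I hl₂
    (hdis.subset (Set.sep_subset _ _)) (fun J (hJ : J ∈ 𝒢₂) => hst.1 J hJ.1) fun J hJ => hJ.2
  have h3 : (⋃ J ∈ 𝒢, J.set) ⊆ (⋃ J ∈ 𝒢₁, J.set) ∪ ⋃ J ∈ 𝒢₂, J.set := by
    refine Set.iUnion₂_subset fun J hJ => ?_
    rcases hJ.2.1 with h | h
    · exact (Set.subset_biUnion_of_mem (u := DCube.set) (show J ∈ 𝒢₁ from ⟨hJ, h⟩)).trans
        Set.subset_union_left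
    · exact (Set.subset_biUnion_of_mem (u := DCube.set) (show J ∈ 𝒢₂ from ⟨hJ, h⟩)).trans
        Set.subset_union_right
  have h4 := (measure_mono h3).trans (measure_union_le (μ := volume) _ _)
  have h5 : 2 * (2 * volume (⋃ J ∈ 𝒢, J.set)) ≤ 2 * ENNReal.ofReal I.vol := by
    calc _ = 4 * volume (⋃ J ∈ 𝒢, J.set) := by rw [← mul_assoc]; norm_num
      _ ≤ 4 * _ := mul_le_mul_right h4 _
      _ = _ := mul_add _ _ _
      _ ≤ _ := add_le_add h1 h2
      _ = _ := (two_mul _).symm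
  exact (ENNReal.mul_le_mul_iff_right (by simp) (by simp)).1 h5

end Stopping

/-! ## Decay of the weighted mass along stopping generations -/

section Decay

variable {d n : ℕ} {p c₁ c₂ l₁ l₂ : ℝ} {A : (Fin d → ℝ) → Matrix (Fin n) (Fin n) ℂ}
  {V : DCube d → Matrix (Fin n) (Fin n) ℂ} {𝒥 : DCube d → Set (DCube d)}

lemma IsReducing.setLIntegral_ne_top (hp : 1 < p) (hc₁ : 0 < c₁) (hV : IsReducing p c₁ c₂ A V)
    (I : DCube d) (e : EuclideanSpace ℂ (Fin n)) :
    ∫⁻ x in I.set, ENNReal.ofReal ‖mApp (A x) e‖ ^ p ≠ ⊤ := by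
  intro h
  have h1 := hV.setLIntegral_le hp I e
  rw [h, ENNReal.mul_top (ENNReal.rpow_pos (by simpa) (by simp)).ne', top_le_iff] at h1
  exact ENNReal.mul_ne_top ENNReal.ofReal_ne_top
    (ENNReal.rpow_ne_top_of_nonneg (by linarith) ENNReal.ofReal_ne_top) h1

lemma IsReducing.apNorm_toReal_bounds (hn : 0 < n) (hp : 1 < p) (hc₁ : 0 < c₁) (hc₂ : 0 < c₂)
    (hA : MatMeasurable A) (hpd : ∀ᵐ x, (A x).PosDef) (hap : apNorm p A < ⊤)
    (hV : IsReducing p c₁ c₂ A V) (I : DCube d) :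
    0 < (apNorm p A).toReal ∧ (c₁ / (2 * c₂)) ^ p / (apNorm p A).toReal ≤ 1 := by
  have hlow := ENNReal.toReal_mono (ENNReal.mul_ne_top
    (ENNReal.rpow_ne_top_of_nonneg (by linarith) ENNReal.ofReal_ne_top) hap.ne)
    (hV.rpow_le_apNorm hn hp hc₁ hA hpd hap I)
  rw [ENNReal.toReal_mul, ← ENNReal.toReal_rpow, ← ENNReal.toReal_rpow,
    ENNReal.toReal_ofReal hc₁.le, ENNReal.toReal_ofReal hc₂.le] at hlow
  set K := (apNorm p A).toReal
  have hK0 : 0 < K := pos_of_mul_pos_right ((by positivity : 0 < c₁ ^ p).trans_le hlow)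
    (by positivity)
  refine ⟨hK0, ?_⟩
  rw [div_le_one hK0, Real.div_rpow hc₁.le (by positivity), Real.mul_rpow (by norm_num) hc₂.le,
    div_le_iff₀ (by positivity)]
  have : (1 : ℝ) ≤ 2 ^ p := Real.one_le_rpow (by norm_num) (by linarith)
  calc c₁ ^ p ≤ K * (1 * c₂ ^ p) := by rwa [one_mul, mul_comm]
    _ ≤ K * (2 ^ p * c₂ ^ p) := by gcongr

/-- A subset of at most half the volume of a cube misses a fixed proportion of the weight. -/
lemma IsReducing.setLIntegral_le_of_two_mul_volume_le (hn : 0 < n) (hp : 1 < p) (hc₁ : 0 < c₁)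
    (hc₂ : 0 < c₂) (hA : MatMeasurable A) (hpd : ∀ᵐ x, (A x).PosDef) (hap : apNorm p A < ⊤)
    (hV : IsReducing p c₁ c₂ A V) (I : DCube d) (e : EuclideanSpace ℂ (Fin n))
    {U : Set (Fin d → ℝ)} (hU : U ⊆ I.set) (hUm : MeasurableSet U)
    (hvol : 2 * volume U ≤ ENNReal.ofReal I.vol) :
    ∫⁻ x in U, ENNReal.ofReal ‖mApp (A x) e‖ ^ p ≤
      ENNReal.ofReal (1 - (c₁ / (2 * c₂)) ^ p / (apNorm p A).toReal) *
        ∫⁻ x in I.set, ENNReal.ofReal ‖mApp (A x) e‖ ^ p := by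
  obtain ⟨hK0, hκ1⟩ := hV.apNorm_toReal_bounds hn hp hc₁ hc₂ hA hpd hap I
  have hKap : apNorm p A = ENNReal.ofReal (apNorm p A).toReal :=
    (ENNReal.ofReal_toReal hap.ne).symm
  set K := (apNorm p A).toReal
  have hcp : 0 < c₂ ^ p := by positivity
  have hκ0 : 0 ≤ (c₁ / (2 * c₂)) ^ p / K := by positivity
  have hκc : c₂ ^ p * K * ((c₁ / (2 * c₂)) ^ p / K) = c₁ ^ p * (2⁻¹ : ℝ) ^ p := by
    rw [Real.div_rpow hc₁.le (by positivity), Real.mul_rpow (by norm_num) hc₂.le,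
      Real.inv_rpow (by norm_num)]
    field_simp
  set κ := (c₁ / (2 * c₂)) ^ p / K
  set w := ∫⁻ x in I.set, ENNReal.ofReal ‖mApp (A x) e‖ ^ p
  have hw : w ≠ ⊤ := hV.setLIntegral_ne_top hp hc₁ I e
  have hhalf : (2⁻¹ : ℝ≥0∞) ≤ (ENNReal.ofReal I.vol)⁻¹ * volume (I.set \ U) := by
    have h1 : volume U + volume (I.set \ U) = ENNReal.ofReal I.vol := by
      rw [measure_add_sdiff hUm.nullMeasurableSet, Set.union_eq_self_of_subset_left hU,
        I.volume_set]
    have h2 : 2 * ENNReal.ofReal I.vol ≤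
        ENNReal.ofReal I.vol + 2 * volume (I.set \ U) := by
      conv_lhs => rw [← h1, mul_add]
      gcongr
    rw [two_mul] at h2
    have h3 := (ENNReal.add_le_add_iff_left ENNReal.ofReal_ne_top).1 h2
    rw [mul_comm, ← div_eq_mul_inv,
      ENNReal.le_div_iff_mul_le (Or.inl I.ofReal_vol_ne_zero) (Or.inl ENNReal.ofReal_ne_top)]
    calc (2⁻¹ : ℝ≥0∞) * ENNReal.ofReal I.vol ≤ 2⁻¹ * (2 * volume (I.set \ U)) := by gcongr
      _ = _ := by rw [← mul_assoc, ENNReal.inv_mul_cancel (by simp) (by simp), one_mul]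
  have hE := hV.setLIntegral_mul_rpow_le hp hA hpd hap I e (E := I.set \ U) Set.sdiff_subset
    (I.measurableSet_set.diff hUm)
  have hκw : ENNReal.ofReal κ * w ≤
      ∫⁻ x in I.set \ U, ENNReal.ofReal ‖mApp (A x) e‖ ^ p := by
    have hM : ENNReal.ofReal c₂ ^ p * apNorm p A = ENNReal.ofReal (c₂ ^ p * K) := by
      rw [hKap, ENNReal.ofReal_rpow_of_pos hc₂, ENNReal.ofReal_mul hcp.le]
    refine (ENNReal.mul_le_mul_iff_right (a := ENNReal.ofReal (c₂ ^ p * K))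
      (by simp only [ne_eq, ENNReal.ofReal_eq_zero, not_le]; positivity)
      ENNReal.ofReal_ne_top).1 ?_
    rw [← hM]
    refine le_trans ?_ hE
    rw [hM, ← mul_assoc, ← ENNReal.ofReal_mul (by positivity), hκc,
      ENNReal.ofReal_mul (by positivity), ENNReal.ofReal_rpow_of_pos hc₁, mul_right_comm,
      ← ENNReal.ofReal_rpow_of_pos (by norm_num : (0 : ℝ) < 2⁻¹),
      ENNReal.ofReal_inv_of_pos (by norm_num), ENNReal.ofReal_ofNat]
    gcongr
  have hsplit : (∫⁻ x in U, ENNReal.ofReal ‖mApp (A x) e‖ ^ p) +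
      ∫⁻ x in I.set \ U, ENNReal.ofReal ‖mApp (A x) e‖ ^ p = w := by
    have h := lintegral_inter_add_sdiff (μ := volume)
      (fun x => ENNReal.ofReal ‖mApp (A x) e‖ ^ p) I.set hUm
    rwa [Set.inter_eq_self_of_subset_right hU] at h
  refine (ENNReal.add_le_add_iff_right (a := ENNReal.ofReal κ * w)
    (ENNReal.mul_ne_top ENNReal.ofReal_ne_top hw)).1 ?_
  rw [← add_mul, ← ENNReal.ofReal_add (by linarith) hκ0, sub_add_cancel, ENNReal.ofReal_one,
    one_mul, ← hsplit]
  gcongr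
  rwa [hsplit]

lemma lintegral_iterUnion_succ_le (h : IsStopping 𝒥) {θ : ℝ≥0∞}
    (hθ : ∀ I e, ∫⁻ x in ⋃ J ∈ 𝒥 I, J.set, ENNReal.ofReal ‖mApp (A x) e‖ ^ p ≤
      θ * ∫⁻ x in I.set, ENNReal.ofReal ‖mApp (A x) e‖ ^ p) (m : ℕ) (I₀ : DCube d)
    {g : (Fin d → ℝ) → EuclideanSpace ℂ (Fin n)}
    (hg : ∀ L ∈ JIter 𝒥 m I₀, ∃ v, ∀ x ∈ L.set, g x = v) :
    ∫⁻ x in iterUnion 𝒥 (m + 1) I₀, ENNReal.ofReal ‖mApp (A x) (g x)‖ ^ p ≤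
      θ * ∫⁻ x in iterUnion 𝒥 m I₀, ENNReal.ofReal ‖mApp (A x) (g x)‖ ^ p := by
  have hdis := h.jIter_pairwiseDisjoint m I₀
  have hsub : ∀ L : DCube d, (⋃ J ∈ 𝒥 L, J.set) ⊆ L.set := fun L =>
    Set.iUnion₂_subset fun J hJ => (h L).1 J hJ
  rw [iterUnion_succ, iterUnion,
    lintegral_biUnion (JIter 𝒥 m I₀).to_countable (fun L _ => measurableSet_biUnion_cubes _)
      (fun L hL L' hL' hne => (hdis hL hL' hne).mono (hsub L) (hsub L')),
    lintegral_biUnion (JIter 𝒥 m I₀).to_countable (fun L _ => L.measurableSet_set) hdis,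
    ← ENNReal.tsum_mul_left]
  refine ENNReal.tsum_le_tsum fun L => ?_
  obtain ⟨v, hv⟩ := hg L L.2
  rw [setLIntegral_congr_fun (g := fun x => ENNReal.ofReal ‖mApp (A x) v‖ ^ p)
      (measurableSet_biUnion_cubes _) fun x hx => by simp only [hv x (hsub _ hx)],
    setLIntegral_congr_fun (g := fun x => ENNReal.ofReal ‖mApp (A x) v‖ ^ p)
      (DCube.measurableSet_set _) fun x hx => by simp only [hv x hx]]
  exact hθ L v

lemma lintegral_iterUnion_add_le (h : IsStopping 𝒥) {θ : ℝ≥0∞}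
    (hθ : ∀ I e, ∫⁻ x in ⋃ J ∈ 𝒥 I, J.set, ENNReal.ofReal ‖mApp (A x) e‖ ^ p ≤
      θ * ∫⁻ x in I.set, ENNReal.ofReal ‖mApp (A x) e‖ ^ p) {j : ℕ} (hj : 1 ≤ j) (I₀ : DCube d)
    {S : Finset (DCube d)} (hS : ∀ I ∈ S, I ∈ Fj 𝒥 I₀ j)
    (a : DCube d → (Fin d → Bool) → EuclideanSpace ℂ (Fin n)) (m : ℕ) :
    ∫⁻ x in iterUnion 𝒥 (j + m) I₀, ENNReal.ofReal ‖mApp (A x) (haarSum S a x)‖ ^ p ≤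
      θ ^ m * ∫⁻ x, ENNReal.ofReal ‖mApp (A x) (haarSum S a x)‖ ^ p := by
  induction m with
  | zero => simpa using setLIntegral_le_lintegral _ _
  | succ m ih =>
    refine (lintegral_iterUnion_succ_le h hθ (j + m) I₀ fun L hL =>
      ⟨haarSum S a L.corner, fun x hx => ?_⟩).trans ?_
    · exact haarSum_congr a (fun I hI => h.lt_or_disjoint_of_mem_fj hj (by omega) (hS I hI) hL)
        hx L.corner_mem
    · rw [pow_succ', mul_assoc]
      gcongr

end Decay
/-! ## The weighted `L^p` bound for one stopping generation -/

section Generation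

variable {d n : ℕ} {p c₁ c₂ l₁ l₂ : ℝ} {A : (Fin d → ℝ) → Matrix (Fin n) (Fin n) ℂ}
  {V : DCube d → Matrix (Fin n) (Fin n) ℂ}

lemma IsReducing.setLIntegral_le_of_not_stopBad (hp : 1 < p) (hV : IsReducing p c₁ c₂ A V)
    {Q L : DCube d} (hQ : ¬ stopBad p l₁ l₂ V Q L) (v : EuclideanSpace ℂ (Fin n)) :
    ENNReal.ofReal c₁ ^ p * ∫⁻ x in Q.set, ENNReal.ofReal ‖mApp (A x) v‖ ^ p ≤
      ENNReal.ofReal Q.vol * (ENNReal.ofReal l₁ * ENNReal.ofReal ‖mApp (V L) v‖ ^ p) := by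
  have hM : matNorm (V Q * (V L)⁻¹) ^ p ≤ l₁ := not_lt.1 fun h => hQ (Or.inl h)
  refine (hV.setLIntegral_le hp Q v).trans ?_
  gcongr
  have h1 : ‖mApp (V Q) v‖ ≤ matNorm (V Q * (V L)⁻¹) * ‖mApp (V L) v‖ := by
    simpa [mApp_mul, mApp_inv_mApp (hV L).1] using
      norm_mApp_le (V Q * (V L)⁻¹) (mApp (V L) v)
  have hp0 : 0 ≤ p := by linarith
  rw [ENNReal.ofReal_rpow_of_nonneg (norm_nonneg _) hp0,
    ENNReal.ofReal_rpow_of_nonneg (norm_nonneg _) hp0,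
    ← ENNReal.ofReal_mul ((Real.rpow_nonneg (matNorm_nonneg _) _).trans hM)]
  refine ENNReal.ofReal_le_ofReal ((Real.rpow_le_rpow (norm_nonneg _) h1 hp0).trans ?_)
  rw [Real.mul_rpow (matNorm_nonneg _) (norm_nonneg _)]
  gcongr

lemma IsReducing.setLIntegral_le_of_mem_stopST (hd : 0 < d) (hp : 1 < p)
    (hV : IsReducing p c₁ c₂ A V) {J L : DCube d} (hJ : J ∈ stopST p l₁ l₂ V L) (hne : J ≠ L)
    (v : EuclideanSpace ℂ (Fin n)) :
    ENNReal.ofReal c₁ ^ p * ∫⁻ x in J.set, ENNReal.ofReal ‖mApp (A x) v‖ ^ p ≤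
      2 ^ d * (ENNReal.ofReal J.vol * (ENNReal.ofReal l₁ * ENNReal.ofReal ‖mApp (V L) v‖ ^ p)) := by
  have h := hV.setLIntegral_le_of_not_stopBad hp (parent_of_mem_stopST hd hJ hne).2 v
  rw [DCube.vol_parent, ENNReal.ofReal_mul (by positivity), ENNReal.ofReal_pow (by norm_num),
    ENNReal.ofReal_ofNat, mul_assoc] at h
  refine le_trans ?_ h
  gcongr
  exact J.subset_parent

/-- Each cube is partitioned, up to a scale finer than `N`, into its stopping cubes and small
cubes of `ℱ(L)`. -/
lemma exists_partition (hd : 0 < d) (L : DCube d) {N : ℤ} (hN : N ≤ L.k) :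
    ∃ 𝒢 : Set (DCube d), 𝒢.PairwiseDisjoint DCube.set ∧ (⋃ G ∈ 𝒢, G.set) = L.set ∧
      ∀ G ∈ 𝒢, G ∈ stopST p l₁ l₂ V L ∨ (G ∈ Fcol (stopST p l₁ l₂ V) L ∧ G.k = N) := by
  have hst := isStopping_stopST p l₁ l₂ V L
  set 𝒥 := stopST p l₁ l₂ V
  have hsep : ∀ J Q : DCube d, J ∈ 𝒥 L → N ≤ J.k → Q ∈ Fcol 𝒥 L → Q.k = N →
      Disjoint J.set Q.set := fun J Q hJ hJk hQ hQk => Set.disjoint_left.2 fun x hxJ hxQ =>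
    hQ.2 J hJ (DCube.subset_of_k_le (hQk.trans_le hJk) hxQ hxJ)
  refine ⟨{G | G ∈ 𝒥 L ∧ N ≤ G.k ∨ G ∈ Fcol 𝒥 L ∧ G.k = N}, ?_, ?_, ?_⟩
  · rintro G (⟨hG, hGk⟩ | ⟨hG, hGk⟩) G' (⟨hG', hGk'⟩ | ⟨hG', hGk'⟩) hne
    · exact hst.2 hG hG' hne
    · exact hsep _ _ hG hGk hG' hGk'
    · exact (hsep _ _ hG' hGk' hG hGk).symm
    · exact Set.disjoint_left.2 fun x hx hx' =>
        hne (DCube.eq_of_k_eq (hGk.trans hGk'.symm) hx hx')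
  · refine subset_antisymm (Set.iUnion₂_subset ?_) fun x hx => ?_
    · rintro G (⟨hG, -⟩ | ⟨hG, -⟩)
      · exact hst.1 G hG
      · exact hG.1
    · have hxQ := DCube.mem_around N x
      by_cases hQ : DCube.around N x ∈ Fcol 𝒥 L
      · exact Set.mem_biUnion (show _ ∈ {G | _} from Or.inr ⟨hQ, rfl⟩) hxQ
      · have hQL : (DCube.around N x).set ⊆ L.set := DCube.subset_of_k_le hN hxQ hx
        simp only [Fcol, Set.mem_ofPred_eq, not_and, not_forall, not_not] at hQ
        obtain ⟨J, hJ, hQJ⟩ := hQ hQL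
        exact Set.mem_biUnion
          (show _ ∈ {G | _} from Or.inl ⟨hJ, DCube.k_le_of_subset hd hQJ⟩) (hQJ hxQ)
  · rintro G (⟨hG, -⟩ | hG)
    · exact Or.inl hG
    · exact Or.inr hG

lemma IsReducing.setLIntegral_haarSum_le (hd : 0 < d) (hp : 1 < p)
    (hV : IsReducing p c₁ c₂ A V) {L : DCube d} (hL : L ∉ stopST p l₁ l₂ V L)
    {S : Finset (DCube d)} (hS : ∀ I ∈ S, I ∈ Fcol (stopST p l₁ l₂ V) L)
    (a : DCube d → (Fin d → Bool) → EuclideanSpace ℂ (Fin n)) :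
    ENNReal.ofReal c₁ ^ p * ∫⁻ x in L.set, ENNReal.ofReal ‖mApp (A x) (haarSum S a x)‖ ^ p ≤
      2 ^ d * ENNReal.ofReal l₁ *
        ∫⁻ x in L.set, ENNReal.ofReal ‖mApp (V L) (haarSum S a x)‖ ^ p := by
  obtain ⟨N, hNL, hN⟩ : ∃ N : ℤ, N ≤ L.k ∧ ∀ I ∈ S, N < I.k := by
    obtain ⟨N, hN⟩ := (S.image fun I => I.k).bddBelow
    refine ⟨min L.k (N - 1), min_le_left _ _, fun I hI => (min_le_right _ _).trans_lt ?_⟩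
    have := hN (Finset.mem_coe.2 (Finset.mem_image_of_mem _ hI))
    linarith
  obtain ⟨𝒢, hdis, hU, h𝒢⟩ := exists_partition (p := p) (l₁ := l₁) (l₂ := l₂) (V := V) hd L hNL
  rw [← hU, lintegral_biUnion 𝒢.to_countable (fun G _ => G.measurableSet_set) hdis,
    lintegral_biUnion 𝒢.to_countable (fun G _ => G.measurableSet_set) hdis,
    ← ENNReal.tsum_mul_left, ← ENNReal.tsum_mul_left]
  refine ENNReal.tsum_le_tsum fun ⟨G, hG⟩ => ?_
  have hconst : ∀ x ∈ G.set, haarSum S a x = haarSum S a G.corner := fun x hx => by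
    refine haarSum_congr a (fun I hI => ?_) hx G.corner_mem
    rcases h𝒢 G hG with h | ⟨-, h⟩
    · by_contra! hcon
      obtain ⟨y, hyI, hyG⟩ := Set.not_disjoint_iff.1 hcon.2
      exact (hS I hI).2 G h (DCube.subset_of_k_le hcon.1 hyI hyG)
    · exact Or.inl (h.trans_lt (hN I hI))
  set v := haarSum S a G.corner
  have e : ∀ M : (Fin d → ℝ) → Matrix (Fin n) (Fin n) ℂ,
      ∫⁻ x in G.set, ENNReal.ofReal ‖mApp (M x) (haarSum S a x)‖ ^ p =
        ∫⁻ x in G.set, ENNReal.ofReal ‖mApp (M x) v‖ ^ p := fun M =>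
    setLIntegral_congr_fun G.measurableSet_set fun x hx => by simp only [hconst x hx]
  rw [e A, e fun _ => V L, setLIntegral_const, G.volume_set]
  refine le_trans ?_ (le_of_eq (show 2 ^ d * (ENNReal.ofReal G.vol *
    (ENNReal.ofReal l₁ * ENNReal.ofReal ‖mApp (V L) v‖ ^ p)) = _ by ring))
  rcases h𝒢 G hG with h | ⟨h, -⟩
  · exact hV.setLIntegral_le_of_mem_stopST hd hp h (fun hGL => hL (hGL ▸ h)) v
  · refine (hV.setLIntegral_le_of_not_stopBad hp (not_stopBad_of_mem_fcol hd h) v).trans ?_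
    exact le_mul_of_one_le_left' (one_le_pow₀ (by norm_num))

lemma matNorm_mul_inv_comm {M N : Matrix (Fin n) (Fin n) ℂ} (hM : M.PosDef) (hN : N.PosDef) :
    matNorm (M * N⁻¹) = matNorm (N⁻¹ * M) := by
  rw [← matNorm_conjTranspose, Matrix.conjTranspose_mul, hM.isHermitian.eq,
    hN.isHermitian.inv.eq]

lemma haarSum_singleton (I : DCube d) (a : DCube d → (Fin d → Bool) → EuclideanSpace ℂ (Fin n))
    (x : Fin d → ℝ) : haarSum {I} a x = ∑ ε ∈ Sfin d, haarFn I ε x • a I ε := by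
  simp [haarSum]

lemma mApp_haarSum (M : Matrix (Fin n) (Fin n) ℂ) (S : Finset (DCube d))
    (a : DCube d → (Fin d → Bool) → EuclideanSpace ℂ (Fin n)) (x : Fin d → ℝ) :
    mApp M (haarSum S a x) = haarSum S (fun I ε => mApp M (a I ε)) x := by
  simp only [haarSum, mApp_sum, mApp_smul_real]

lemma haarSum_smul (c : ℝ) (S : Finset (DCube d))
    (a : DCube d → (Fin d → Bool) → EuclideanSpace ℂ (Fin n)) (x : Fin d → ℝ) :
    haarSum S (fun I ε => c • a I ε) x = c • haarSum S a x := by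
  simp only [haarSum, Finset.smul_sum, smul_comm c]

/-- The contribution of `ℱ(L)` to the weighted bound. -/
lemma IsReducing.setLIntegral_fcol_le (hd : 0 < d) (hp : 1 < p) {Cb : ℝ}
    (hCb : ∀ (S : Finset (DCube d)) (a b : DCube d → (Fin d → Bool) → EuclideanSpace ℂ (Fin n)),
      (∀ I ∈ S, ∀ x, ‖haarSum {I} b x‖ ≤ ‖haarSum {I} a x‖) →
      ∫⁻ x, ENNReal.ofReal ‖haarSum S b x‖ ^ p ≤
        ENNReal.ofReal Cb * ∫⁻ x, ENNReal.ofReal ‖haarSum S a x‖ ^ p)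
    (hV : IsReducing p c₁ c₂ A V) (hl₂ : 0 ≤ l₂) {L : DCube d} (hL : L ∉ stopST p l₁ l₂ V L)
    {S : Finset (DCube d)} (hS : ∀ I ∈ S, I ∈ Fcol (stopST p l₁ l₂ V) L)
    (a : DCube d → (Fin d → Bool) → EuclideanSpace ℂ (Fin n)) :
    ENNReal.ofReal c₁ ^ p * ∫⁻ x in L.set,
        ENNReal.ofReal ‖mApp (A x) (haarSum S (fun I ε => mApp (V I)⁻¹ (a I ε)) x)‖ ^ p ≤
      2 ^ d * ENNReal.ofReal l₁ * (ENNReal.ofReal Cb * ENNReal.ofReal (l₂ ^ (p - 1))) *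
        ∫⁻ x in L.set, ENNReal.ofReal ‖haarSum S a x‖ ^ p := by
  have hp0 : 0 < p := by linarith
  have hp1 : 0 < p - 1 := by linarith
  refine (hV.setLIntegral_haarSum_le hd hp hL hS _).trans ?_
  rw [mul_assoc (2 ^ d * ENNReal.ofReal l₁)]
  gcongr
  have hzero : ∀ (b : DCube d → (Fin d → Bool) → EuclideanSpace ℂ (Fin n)) x, x ∉ L.set →
      haarSum S b x = 0 := fun b x hx => haarSum_eq_zero b fun I hI hxI => hx ((hS I hI).1 hxI)
  set Λ : ℝ := l₂ ^ ((p - 1) / p)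
  have hΛ0 : 0 ≤ Λ := by positivity
  have hΛp : Λ ^ p = l₂ ^ (p - 1) := by
    rw [← Real.rpow_mul hl₂, div_mul_cancel₀ _ hp0.ne']
  have hsub : ∀ I ∈ S, ∀ x, ‖haarSum {I} (fun I ε => mApp (V L) (mApp (V I)⁻¹ (a I ε))) x‖ ≤
      ‖haarSum {I} (fun I ε => Λ • a I ε) x‖ := fun I hI x => by
    have hIL : matNorm ((V I)⁻¹ * V L) ^ (p / (p - 1)) ≤ l₂ := not_lt.1 fun h =>
      not_stopBad_of_mem_fcol hd (hS I hI) (Or.inr h)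
    have hIΛ : matNorm (V L * (V I)⁻¹) ≤ Λ := by
      rw [matNorm_mul_inv_comm (hV L).1 (hV I).1]
      calc matNorm ((V I)⁻¹ * V L)
          = (matNorm ((V I)⁻¹ * V L) ^ (p / (p - 1))) ^ ((p - 1) / p) := by
            rw [← Real.rpow_mul (matNorm_nonneg _), div_mul_div_cancel₀ hp1.ne',
              div_self hp0.ne', Real.rpow_one]
        _ ≤ Λ := Real.rpow_le_rpow (Real.rpow_nonneg (matNorm_nonneg _) _) hIL (by positivity)
    have e : haarSum {I} (fun I ε => mApp (V L) (mApp (V I)⁻¹ (a I ε))) x =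
        mApp (V L * (V I)⁻¹) (haarSum {I} a x) := by
      rw [mApp_haarSum, haarSum_singleton, haarSum_singleton]
      simp only [mApp_mul]
    rw [e, haarSum_smul, norm_smul, Real.norm_of_nonneg hΛ0]
    exact (norm_mApp_le _ _).trans (by gcongr)
  calc ∫⁻ x in L.set,
        ENNReal.ofReal ‖mApp (V L) (haarSum S (fun I ε => mApp (V I)⁻¹ (a I ε)) x)‖ ^ p
      ≤ ∫⁻ x, ENNReal.ofReal ‖haarSum S (fun I ε => mApp (V L) (mApp (V I)⁻¹ (a I ε))) x‖ ^ p := by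
        simp only [mApp_haarSum]
        exact setLIntegral_le_lintegral _ _
    _ ≤ ENNReal.ofReal Cb * ∫⁻ x, ENNReal.ofReal ‖haarSum S (fun I ε => Λ • a I ε) x‖ ^ p :=
        hCb S _ _ hsub
    _ = ENNReal.ofReal Cb * (ENNReal.ofReal (l₂ ^ (p - 1)) *
          ∫⁻ x, ENNReal.ofReal ‖haarSum S a x‖ ^ p) := by
        congr 1
        rw [← hΛp, ← ENNReal.ofReal_rpow_of_nonneg hΛ0 hp0.le,
          ← lintegral_const_mul' _ _ (ENNReal.rpow_ne_top_of_nonneg hp0.le ENNReal.ofReal_ne_top)]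
        simp only [haarSum_smul, norm_smul, Real.norm_of_nonneg hΛ0, ENNReal.ofReal_mul hΛ0,
          ENNReal.mul_rpow_of_nonneg _ _ hp0.le]
    _ = _ := by
        rw [← mul_assoc]
        congr 1
        refine (setLIntegral_eq_of_support_subset fun x hx => ?_).symm
        by_contra hxL
        exact hx (by simp [hzero a x hxL, hp0])

end Generation
/-! ## Assembling the estimate -/

section Final

variable {d n : ℕ} {p c₁ c₂ l₁ l₂ : ℝ} {A : (Fin d → ℝ) → Matrix (Fin n) (Fin n) ℂ}
  {V : DCube d → Matrix (Fin n) (Fin n) ℂ}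

/-- The Haar series of a function with finite Haar expansion over `ℱ^j` is a finite sum. -/
lemma FiniteHaar.exists_finset (hd : 0 < d) {f : (Fin d → ℝ) → EuclideanSpace ℂ (Fin n)}
    (hf : FiniteHaar f) {𝒥 : DCube d → Set (DCube d)} (h : IsStopping 𝒥) (I₀ : DCube d) (j : ℕ) :
    ∃ S : Finset (DCube d), (∀ I ∈ S, I ∈ Fj 𝒥 I₀ j) ∧
      (∀ x, deltaHaar 𝒥 I₀ j f x = haarSum S (haarCoef f) x) ∧
      ∀ x, projInv V (Fj 𝒥 I₀ j) f x =
        haarSum S (fun I ε => mApp (V I)⁻¹ (haarCoef f I ε)) x := by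
  classical
  obtain ⟨S, hS⟩ : ∃ S : Finset (DCube d), ∀ I, I ∈ S ↔
      (I.set ⊆ I₀.set ∧ ∃ ε ∈ Sfin d, haarCoef f I ε ≠ 0) ∧ I ∈ Fj 𝒥 I₀ j :=
    ⟨(hf.finite_support hd I₀).toFinset.filter (· ∈ Fj 𝒥 I₀ j), fun I => by
      rw [Finset.mem_filter, Set.Finite.mem_toFinset, Set.mem_ofPred_eq]⟩
  have key : ∀ b : DCube d → (Fin d → Bool) → EuclideanSpace ℂ (Fin n),
      (∀ I ε, haarCoef f I ε = 0 → b I ε = 0) → ∀ x,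
      ∑' I : Fj 𝒥 I₀ j, ∑ ε ∈ Sfin d, haarFn (I : DCube d) ε x • b I ε = haarSum S b x := by
    intro b hb x
    rw [tsum_subtype (Fj 𝒥 I₀ j) fun I => ∑ ε ∈ Sfin d, haarFn I ε x • b I ε,
      tsum_eq_sum (s := S) fun I hI => ?_]
    · exact Finset.sum_congr rfl fun I hI => Set.indicator_of_mem ((hS I).1 hI).2 _
    · refine Set.indicator_apply_eq_zero.2 fun hIF => Finset.sum_eq_zero fun ε hε => ?_
      rw [hb, smul_zero]
      by_contra hne
      have hI₀ : I.set ⊆ I₀.set := by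
        simp only [Fj, Set.mem_iUnion, exists_prop] at hIF
        obtain ⟨L, hL, hIL⟩ := hIF
        exact hIL.1.trans (h.subset_of_mem_jIter hL)
      exact hI ((hS I).2 ⟨⟨hI₀, ε, hε, hne⟩, hIF⟩)
  refine ⟨S, fun I hI => ((hS I).1 hI).2, key (haarCoef f) fun _ _ h => h,
    key (fun I ε => mApp (V I)⁻¹ (haarCoef f I ε)) fun I ε h => ?_⟩
  simp only [h, mApp_zero]

/-- The weighted `L^p` bound for the operator of one stopping generation. -/
lemma IsReducing.lintegral_haarSum_le (hd : 0 < d) (hp : 1 < p) {Cb : ℝ}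
    (hCb : ∀ (S : Finset (DCube d)) (a b : DCube d → (Fin d → Bool) → EuclideanSpace ℂ (Fin n)),
      (∀ I ∈ S, ∀ x, ‖haarSum {I} b x‖ ≤ ‖haarSum {I} a x‖) →
      ∫⁻ x, ENNReal.ofReal ‖haarSum S b x‖ ^ p ≤
        ENNReal.ofReal Cb * ∫⁻ x, ENNReal.ofReal ‖haarSum S a x‖ ^ p)
    (hV : IsReducing p c₁ c₂ A V) (hl₂ : 0 ≤ l₂) (hL : ∀ L, L ∉ stopST p l₁ l₂ V L)
    {I₀ : DCube d} {j : ℕ} {S : Finset (DCube d)} (hS : ∀ I ∈ S, I ∈ Fj (stopST p l₁ l₂ V) I₀ j)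
    (a : DCube d → (Fin d → Bool) → EuclideanSpace ℂ (Fin n)) :
    ENNReal.ofReal c₁ ^ p * ∫⁻ x,
        ENNReal.ofReal ‖mApp (A x) (haarSum S (fun I ε => mApp (V I)⁻¹ (a I ε)) x)‖ ^ p ≤
      2 ^ d * ENNReal.ofReal l₁ * (ENNReal.ofReal Cb * ENNReal.ofReal (l₂ ^ (p - 1))) *
        ∫⁻ x, ENNReal.ofReal ‖haarSum S a x‖ ^ p := by
  classical
  have hst := isStopping_stopST p l₁ l₂ V
  set 𝒥 := stopST p l₁ l₂ V
  have hdis := hst.jIter_pairwiseDisjoint (j - 1) I₀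
  have hloc : ∀ L ∈ JIter 𝒥 (j - 1) I₀, ∀ x ∈ L.set,
      ∀ b : DCube d → (Fin d → Bool) → EuclideanSpace ℂ (Fin n),
      haarSum S b x = haarSum (S.filter (· ∈ Fcol 𝒥 L)) b x := fun L hL x hx b => by
    refine (Finset.sum_filter_of_ne fun I hI hne => ?_).symm
    by_contra hIL
    refine hne (Finset.sum_eq_zero fun ε _ => ?_)
    rw [haarFn_eq_zero ε fun hxI => hIL (hst.mem_fcol_of_mem_fj (hS I hI) hL hxI hx), zero_smul]
  have hsupp : ∀ (b : DCube d → (Fin d → Bool) → EuclideanSpace ℂ (Fin n)) x,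
      x ∉ iterUnion 𝒥 (j - 1) I₀ → haarSum S b x = 0 := fun b x hx =>
    haarSum_eq_zero b fun I hI hxI => hx (subset_iterUnion_of_mem_fj (hS I hI) hxI)
  calc _ = ENNReal.ofReal c₁ ^ p * ∫⁻ x in iterUnion 𝒥 (j - 1) I₀,
        ENNReal.ofReal ‖mApp (A x) (haarSum S (fun I ε => mApp (V I)⁻¹ (a I ε)) x)‖ ^ p := by
        congr 1
        refine (setLIntegral_eq_of_support_subset fun x hx => ?_).symm
        by_contra hxL
        exact hx (by simp [hsupp _ x hxL, mApp_zero, zero_lt_one.trans hp])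
    _ ≤ 2 ^ d * ENNReal.ofReal l₁ * (ENNReal.ofReal Cb * ENNReal.ofReal (l₂ ^ (p - 1))) *
        ∫⁻ x in iterUnion 𝒥 (j - 1) I₀, ENNReal.ofReal ‖haarSum S a x‖ ^ p := by
        rw [iterUnion,
          lintegral_biUnion (JIter 𝒥 (j - 1) I₀).to_countable (fun L _ => L.measurableSet_set) hdis,
          lintegral_biUnion (JIter 𝒥 (j - 1) I₀).to_countable (fun L _ => L.measurableSet_set) hdis,
          ← ENNReal.tsum_mul_left, ← ENNReal.tsum_mul_left]
        refine ENNReal.tsum_le_tsum fun ⟨L, hLJ⟩ => ?_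
        refine Eq.trans_le ?_ ((hV.setLIntegral_fcol_le hd hp hCb hl₂ (hL L)
          (S := S.filter (· ∈ Fcol 𝒥 L)) (fun I hI => (Finset.mem_filter.1 hI).2) a).trans_eq ?_)
        · congr 1
          exact setLIntegral_congr_fun L.measurableSet_set fun x hx => by
            simp only [hloc L hLJ x hx]
        · congr 1
          exact setLIntegral_congr_fun L.measurableSet_set fun x hx => by
            simp only [hloc L hLJ x hx]
    _ ≤ _ := by
        gcongr
        exact Measure.restrict_le_self

lemma lintegral_rpow_half_mul_le {α : Type*} [MeasurableSpace α] {μ : Measure α}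
    {u v : α → ℝ≥0∞} (hu : AEMeasurable u μ) (hv : AEMeasurable v μ) (p : ℝ) :
    ∫⁻ x, u x ^ (p / 2) * v x ^ (p / 2) ∂μ ≤
      (∫⁻ x, u x ^ p ∂μ) ^ (1 / 2 : ℝ) * (∫⁻ x, v x ^ p ∂μ) ^ (1 / 2 : ℝ) := by
  have h := ENNReal.lintegral_mul_le_Lp_mul_Lq μ Real.HolderConjugate.two_two
    (hu.pow_const (p / 2)) (hv.pow_const (p / 2))
  simpa only [Pi.mul_apply, ← ENNReal.rpow_mul, div_mul_cancel₀ p (two_ne_zero' ℝ)] using h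

lemma one_sub_div_pow_le {c₀ K p C' : ℝ} (hc₀ : 0 < c₀) (hK : 0 < K) (hp : 0 < p)
    (hκ : c₀ / K ≤ 1) (hC' : 1 ≤ c₀ * (p * C')) (hC'0 : 0 < C') (m : ℕ) :
    ((1 - c₀ / K) ^ m) ^ (1 / 2 : ℝ) ≤ (2 : ℝ) ^ (-((m : ℝ) / (2 * (p * C' * K + 1)))) := by
  have h1 : 1 - c₀ / K ≤ (2 : ℝ) ^ (-(1 / (p * C' * K + 1))) := by
    rw [Real.rpow_def_of_pos (by norm_num)]
    refine (Real.one_sub_le_exp_neg _).trans (Real.exp_le_exp.2 ?_)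
    rw [mul_neg, neg_le_neg_iff, mul_one_div, div_le_div_iff₀ (by positivity) hK]
    have h2 := Real.log_two_lt_d9
    nlinarith [mul_le_mul_of_nonneg_right hC' hK.le]
  have h0 : 0 ≤ 1 - c₀ / K := by linarith
  calc ((1 - c₀ / K) ^ m) ^ (1 / 2 : ℝ)
      ≤ (((2 : ℝ) ^ (-(1 / (p * C' * K + 1)))) ^ m) ^ (1 / 2 : ℝ) :=
        Real.rpow_le_rpow (by positivity) (pow_le_pow_left₀ h0 h1 m) (by norm_num)
    _ = _ := by
        rw [← Real.rpow_natCast, ← Real.rpow_mul (by positivity), ← Real.rpow_mul (by positivity)]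
        congr 1
        field_simp

end Final

section Constants

variable {d n : ℕ} {p c₁ c₂ l₁ l₂ : ℝ} {V : DCube d → Matrix (Fin n) (Fin n) ℂ}

lemma notMem_stopST_self {I : DCube d}
    (h : 2 * volume (⋃ J ∈ stopST p l₁ l₂ V I, J.set) ≤ ENNReal.ofReal I.vol) :
    I ∉ stopST p l₁ l₂ V I := by
  intro hI
  have h1 := (mul_le_mul_right (measure_mono (μ := volume)
    (Set.subset_biUnion_of_mem (u := DCube.set) hI)) 2).trans h
  rw [I.volume_set, two_mul] at h1
  have h2 := (ENNReal.add_le_add_iff_left (b := ENNReal.ofReal I.vol) (c := 0)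
    ENNReal.ofReal_ne_top).1 (by rwa [add_zero])
  exact I.ofReal_vol_ne_zero (nonpos_iff_eq_zero.1 h2)

lemma direct_constant_le (hp : 0 < p) (hc₁ : 0 < c₁) (hc₂ : 0 < c₂)
    (h : 4 * (n : ℝ) ^ (p + 1) * (c₂ / c₁) ^ p ≤ l₁) :
    4 * ((n : ℝ≥0∞) ^ p * ENNReal.ofReal c₂ ^ p * n) ≤
      ENNReal.ofReal c₁ ^ p * ENNReal.ofReal l₁ := by
  have e : 4 * ((n : ℝ≥0∞) ^ p * ENNReal.ofReal c₂ ^ p * n) =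
      ENNReal.ofReal (4 * ((n : ℝ) ^ p * c₂ ^ p * n)) := by
    rw [ENNReal.ofReal_mul (by norm_num), ENNReal.ofReal_mul (by positivity),
      ENNReal.ofReal_mul (by positivity), ENNReal.ofReal_rpow_of_pos hc₂,
      ← ENNReal.ofReal_rpow_of_nonneg n.cast_nonneg hp.le, ENNReal.ofReal_natCast,
      ENNReal.ofReal_ofNat]
  rw [e, ENNReal.ofReal_rpow_of_pos hc₁, ← ENNReal.ofReal_mul (by positivity)]
  refine ENNReal.ofReal_le_ofReal (le_trans (le_of_eq ?_)
    (mul_le_mul_of_nonneg_left h (by positivity)))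
  rw [Real.rpow_add_one' (by positivity) (by positivity), Real.div_rpow hc₂.le hc₁.le]
  field_simp

lemma dual_constant_le (hp : 1 < p) (hc₁ : 0 < c₁) (hc₂ : 0 < c₂) {K : ℝ} (hK : 0 ≤ K) :
    4 * ((n : ℝ≥0∞) ^ (p / (p - 1)) * n *
        (ENNReal.ofReal c₂ ^ p * ENNReal.ofReal K) ^ (1 / (p - 1))) ≤
      ENNReal.ofReal c₁ ^ (p / (p - 1)) *
        ENNReal.ofReal (4 * (n : ℝ) ^ (p / (p - 1) + 1) * (c₂ / c₁) ^ (p / (p - 1)) *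
          K ^ (1 / (p - 1))) := by
  have hp1 : 0 < p - 1 := by linarith
  have hq : 0 < p / (p - 1) := by positivity
  have e : 4 * ((n : ℝ≥0∞) ^ (p / (p - 1)) * n *
        (ENNReal.ofReal c₂ ^ p * ENNReal.ofReal K) ^ (1 / (p - 1))) =
      ENNReal.ofReal (4 * ((n : ℝ) ^ (p / (p - 1)) * n * (c₂ ^ p * K) ^ (1 / (p - 1)))) := by
    rw [ENNReal.ofReal_mul (by norm_num), ENNReal.ofReal_mul (by positivity),
      ENNReal.ofReal_mul (by positivity), ENNReal.ofReal_rpow_of_pos hc₂,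
      ← ENNReal.ofReal_rpow_of_nonneg (p := 1 / (p - 1)) (by positivity) (by positivity),
      ENNReal.ofReal_mul (p := c₂ ^ p) (by positivity),
      ← ENNReal.ofReal_rpow_of_nonneg n.cast_nonneg hq.le, ENNReal.ofReal_natCast,
      ENNReal.ofReal_ofNat]
  rw [e, ENNReal.ofReal_rpow_of_pos hc₁, ← ENNReal.ofReal_mul (by positivity)]
  refine ENNReal.ofReal_le_ofReal (le_of_eq ?_)
  rw [Real.rpow_add_one' (by positivity) (by positivity), Real.div_rpow hc₂.le hc₁.le,
    Real.mul_rpow (by positivity) hK, ← Real.rpow_mul hc₂.le, mul_one_div]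
  field_simp

end Constants

/-- With the stopping time `𝒥 = stopST p λ₁ λ₂ V` as in the decay lemma
(`λ₁` depending only on `n, d, p`, `λ₂ = C_λ ‖W‖_{A_p}^{p'/p}`), and
`T_j f = ∑_{I ∈ ℱ^j} ∑_{ε ∈ 𝒮} W^{1/p} V_I^{-1} f_I^ε h_I^ε`, there are constants `C > 0`
and `C' > 1` depending only on `p, n, d` (independent of `W` and `I₀`) such that for
every `f` with finite Haar expansion and all `k > j ≥ 1`,
`∫ |T_k f|^{p/2} |T_j f|^{p/2}
   ≤ C ‖W‖_{A_p} 2^{-(k-j-1)/(2(p C' ‖W‖_{A_p} + 1))} ‖Δ_j f‖_{L^p}^{p/2} ‖Δ_k f‖_{L^p}^{p/2}`. -/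
theorem statement19 (d n : ℕ) (hd : 0 < d) (hn : 0 < n) (p c₁ c₂ : ℝ)
    (hp : 1 < p) (hc₁ : 0 < c₁) (hc₂ : 0 < c₂) :
    ∃ l₁ Cl C' : ℝ, ∃ C : ℝ≥0∞, 1 < l₁ ∧ 0 < Cl ∧ 1 < C' ∧ 0 < C ∧ C < ⊤ ∧
      ∀ (W1p : (Fin d → ℝ) → Matrix (Fin n) (Fin n) ℂ)
        (V : DCube d → Matrix (Fin n) (Fin n) ℂ)
        (I₀ : DCube d)
        (f : (Fin d → ℝ) → EuclideanSpace ℂ (Fin n)) (j k : ℕ),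
        MatMeasurable W1p →
        (∀ᵐ x ∂(volume : Measure (Fin d → ℝ)), (W1p x).PosDef) →
        apNorm p W1p < ⊤ →
        IsReducing p c₁ c₂ W1p V →
        FiniteHaar f →
        1 ≤ j → j < k →
        ∫⁻ x,
            ENNReal.ofReal
              ‖mApp (W1p x)
                (projInv V
                  (Fj (stopST p l₁ (Cl * (apNorm p W1p).toReal ^ (1 / (p - 1))) V) I₀ k)
                  f x)‖ ^ (p / 2) *
            ENNReal.ofReal
              ‖mApp (W1p x)
                (projInv V
                  (Fj (stopST p l₁ (Cl * (apNorm p W1p).toReal ^ (1 / (p - 1))) V) I₀ j)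
                  f x)‖ ^ (p / 2) ≤
          C * apNorm p W1p *
            ENNReal.ofReal
              ((2 : ℝ) ^ (-(((k : ℝ) - (j : ℝ) - 1) /
                (2 * (p * C' * (apNorm p W1p).toReal + 1))))) *
            (∫⁻ x, ENNReal.ofReal
                ‖deltaHaar (stopST p l₁ (Cl * (apNorm p W1p).toReal ^ (1 / (p - 1))) V)
                  I₀ j f x‖ ^ p) ^ (1 / 2 : ℝ) *
            (∫⁻ x, ENNReal.ofReal
                ‖deltaHaar (stopST p l₁ (Cl * (apNorm p W1p).toReal ^ (1 / (p - 1))) V)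
                  I₀ k f x‖ ^ p) ^ (1 / 2 : ℝ) := by
  have hp0 : 0 < p := by linarith
  have hp1 : 0 < p - 1 := by linarith
  obtain ⟨Cb, hCb0, hCb⟩ := exists_lintegral_haarSum_le (H := EuclideanSpace ℂ (Fin n)) hp
  obtain ⟨l₁, hl₁⟩ : ∃ l₁ : ℝ, l₁ = 4 * (n : ℝ) ^ (p + 1) * (c₂ / c₁) ^ p + 2 := ⟨_, rfl⟩
  obtain ⟨Cl, hCl⟩ : ∃ Cl : ℝ,
    Cl = 4 * (n : ℝ) ^ (p / (p - 1) + 1) * (c₂ / c₁) ^ (p / (p - 1)) := ⟨_, rfl⟩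
  have hl₁0 : 1 < l₁ := by
    have : 0 ≤ 4 * (n : ℝ) ^ (p + 1) * (c₂ / c₁) ^ p := by positivity
    linarith
  have hn' : (0 : ℝ) < n := by exact_mod_cast hn
  have hCl0 : 0 < Cl := by rw [hCl]; positivity
  obtain ⟨c₀, hc₀⟩ : ∃ c₀ : ℝ, c₀ = (c₁ / (2 * c₂)) ^ p := ⟨_, rfl⟩
  have hc₀0 : 0 < c₀ := by rw [hc₀]; positivity
  obtain ⟨C₀, hC₀⟩ : ∃ C₀ : ℝ, C₀ = 2 ^ d * l₁ * (Cb * Cl ^ (p - 1)) / c₁ ^ p := ⟨_, rfl⟩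
  have hC₀0 : 0 < C₀ := by rw [hC₀]; positivity
  have hC'0 : 0 < 1 / (p * c₀) := by positivity
  refine ⟨l₁, Cl, 1 / (p * c₀) + 2, ENNReal.ofReal C₀, hl₁0, hCl0, by linarith,
    ENNReal.ofReal_pos.2 hC₀0, ENNReal.ofReal_lt_top, ?_⟩
  intro A V I₀ f j k hA hpd hap hV hf hj hjk
  obtain ⟨hK0, hκ1⟩ := hV.apNorm_toReal_bounds hn hp hc₁ hc₂ hA hpd hap I₀
  have hdec := hV.setLIntegral_le_of_two_mul_volume_le hn hp hc₁ hc₂ hA hpd hap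
  have hKap : apNorm p A = ENNReal.ofReal (apNorm p A).toReal :=
    (ENNReal.ofReal_toReal hap.ne).symm
  have hdual := dual_constant_le (n := n) hp hc₁ hc₂ hK0.le
  rw [← hKap, ← hCl] at hdual
  have hdirect := direct_constant_le (n := n) (l₁ := l₁) hp0 hc₁ hc₂ (by rw [hl₁]; linarith)
  have hvol := two_mul_volume_stopST_le hn hp hc₁ hc₂ hA hpd hap hV hdirect hdual
  rw [← hc₀] at hdec hκ1
  generalize (apNorm p A).toReal = K at *
  obtain ⟨l₂, hl₂⟩ : ∃ l₂ : ℝ, l₂ = Cl * K ^ (1 / (p - 1)) := ⟨_, rfl⟩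
  rw [← hl₂] at hvol ⊢
  have hl₂0 : 0 ≤ l₂ := by rw [hl₂]; positivity
  have hl₂p : l₂ ^ (p - 1) = Cl ^ (p - 1) * K := by
    rw [hl₂, Real.mul_rpow hCl0.le (by positivity), ← Real.rpow_mul hK0.le,
      one_div_mul_cancel hp1.ne', Real.rpow_one]
  have hst := isStopping_stopST p l₁ l₂ V
  have hself : ∀ L, L ∉ stopST p l₁ l₂ V L := fun L => notMem_stopST_self (hvol L)
  have hθ : ∀ I e, ∫⁻ x in ⋃ J ∈ stopST p l₁ l₂ V I, J.set, ENNReal.ofReal ‖mApp (A x) e‖ ^ p ≤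
      ENNReal.ofReal (1 - c₀ / K) * ∫⁻ x in I.set, ENNReal.ofReal ‖mApp (A x) e‖ ^ p :=
    fun I e => hdec I e (Set.iUnion₂_subset fun J hJ => (hst I).1 J hJ)
      (measurableSet_biUnion_cubes _) (hvol I)
  have hconst : ENNReal.ofReal c₁ ^ p * ENNReal.ofReal (C₀ * K) =
      2 ^ d * ENNReal.ofReal l₁ * (ENNReal.ofReal Cb * ENNReal.ofReal (l₂ ^ (p - 1))) := by
    rw [hl₂p, ENNReal.ofReal_rpow_of_pos hc₁, ← ENNReal.ofReal_mul (by positivity),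
      ← ENNReal.ofReal_mul hCb0.le, ← ENNReal.ofReal_ofNat, ← ENNReal.ofReal_pow (by norm_num),
      ← ENNReal.ofReal_mul (by positivity), ← ENNReal.ofReal_mul (by positivity), hC₀]
    congr 1
    field_simp
  have hbound : ∀ {i : ℕ} {S : Finset (DCube d)}, (∀ I ∈ S, I ∈ Fj (stopST p l₁ l₂ V) I₀ i) →
      ∫⁻ x, ENNReal.ofReal ‖mApp (A x)
        (haarSum S (fun I ε => mApp (V I)⁻¹ (haarCoef f I ε)) x)‖ ^ p ≤
      ENNReal.ofReal (C₀ * K) * ∫⁻ x, ENNReal.ofReal ‖haarSum S (haarCoef f) x‖ ^ p := by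
    intro i S hS
    refine (ENNReal.mul_le_mul_iff_right (a := ENNReal.ofReal c₁ ^ p)
      (ENNReal.rpow_pos (by simpa) ENNReal.ofReal_ne_top).ne'
      (ENNReal.rpow_ne_top_of_nonneg hp0.le ENNReal.ofReal_ne_top)).1 ?_
    refine (hV.lintegral_haarSum_le hd hp (hCb d) hl₂0 hself hS _).trans_eq ?_
    rw [← mul_assoc (ENNReal.ofReal c₁ ^ p), hconst]
  obtain ⟨Sj, hSj, hΔj, hPj⟩ := hf.exists_finset (V := V) hd hst I₀ j
  obtain ⟨Sk, hSk, hΔk, hPk⟩ := hf.exists_finset (V := V) hd hst I₀ k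
  simp only [hΔj, hPj, hΔk, hPk]
  set b : DCube d → (Fin d → Bool) → EuclideanSpace ℂ (Fin n) :=
    fun I ε => mApp (V I)⁻¹ (haarCoef f I ε)
  obtain ⟨m, rfl⟩ : ∃ m, k = j + m + 1 := ⟨k - 1 - j, by omega⟩
  have hmeas : ∀ S : Finset (DCube d),
      Measurable fun x => ENNReal.ofReal ‖mApp (A x) (haarSum S b x)‖ := fun S =>
    (measurable_mApp hA (stronglyMeasurable_haarSum S b).measurable).norm.ennreal_ofReal
  have hdecay : ENNReal.ofReal (1 - c₀ / K) ^ m = ENNReal.ofReal ((1 - c₀ / K) ^ m) :=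
    (ENNReal.ofReal_pow (by linarith) m).symm
  have hexp := one_sub_div_pow_le (C' := 1 / (p * c₀) + 2) hc₀0 hK0 hp0 hκ1
    (by
      have : c₀ * (p * (1 / (p * c₀) + 2)) = 1 + 2 * c₀ * p := by field_simp
      rw [this]
      linarith [mul_pos hc₀0 hp0]) (by linarith) m
  have hm : ((j + m + 1 : ℕ) : ℝ) - j - 1 = m := by push_cast; ring
  rw [hm, hKap]
  set Dj := ∫⁻ x, ENNReal.ofReal ‖haarSum Sj (haarCoef f) x‖ ^ p
  set Dk := ∫⁻ x, ENNReal.ofReal ‖haarSum Sk (haarCoef f) x‖ ^ p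
  set U := iterUnion (stopST p l₁ l₂ V) (j + m) I₀
  have hsupp : ∀ x, x ∉ U → haarSum Sk b x = 0 := fun x hx => haarSum_eq_zero b fun I hI hxI =>
    hx (by simpa using subset_iterUnion_of_mem_fj (hSk I hI) hxI)
  have h1 : ∫⁻ x in U, ENNReal.ofReal ‖mApp (A x) (haarSum Sk b x)‖ ^ p ≤
      ENNReal.ofReal (C₀ * K) * Dk :=
    (setLIntegral_le_lintegral _ _).trans (hbound hSk)
  have h2 : ∫⁻ x in U, ENNReal.ofReal ‖mApp (A x) (haarSum Sj b x)‖ ^ p ≤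
      ENNReal.ofReal ((1 - c₀ / K) ^ m) * (ENNReal.ofReal (C₀ * K) * Dj) := by
    rw [← hdecay]
    exact (lintegral_iterUnion_add_le hst hθ hj I₀ hSj b m).trans
      (mul_le_mul_right (hbound hSj) _)
  have h0 : 0 ≤ (1 - c₀ / K) ^ m := pow_nonneg (by linarith) m
  calc _ = ∫⁻ x in U, ENNReal.ofReal ‖mApp (A x) (haarSum Sk b x)‖ ^ (p / 2) *
        ENNReal.ofReal ‖mApp (A x) (haarSum Sj b x)‖ ^ (p / 2) := by
        refine (setLIntegral_eq_of_support_subset fun x hx => ?_).symm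
        by_contra hxU
        exact hx (by simp [hsupp x hxU, mApp_zero, hp0])
    _ ≤ _ := lintegral_rpow_half_mul_le (hmeas Sk).aemeasurable (hmeas Sj).aemeasurable p
    _ ≤ (ENNReal.ofReal (C₀ * K) * Dk) ^ (1 / 2 : ℝ) *
        (ENNReal.ofReal ((1 - c₀ / K) ^ m) * (ENNReal.ofReal (C₀ * K) * Dj)) ^ (1 / 2 : ℝ) := by
        gcongr
    _ = (ENNReal.ofReal (C₀ * K) ^ (1 / 2 : ℝ) * ENNReal.ofReal (C₀ * K) ^ (1 / 2 : ℝ)) *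
        ENNReal.ofReal (((1 - c₀ / K) ^ m) ^ (1 / 2 : ℝ)) *
        Dj ^ (1 / 2 : ℝ) * Dk ^ (1 / 2 : ℝ) := by
        simp only [ENNReal.mul_rpow_of_nonneg _ _ (by norm_num : (0 : ℝ) ≤ 1 / 2),
          ENNReal.ofReal_rpow_of_nonneg h0 (by norm_num : (0 : ℝ) ≤ 1 / 2)]
        ring
    _ ≤ _ := by
        rw [← ENNReal.rpow_add_of_nonneg _ _ (by norm_num) (by norm_num), add_halves,
          ENNReal.rpow_one, ENNReal.ofReal_mul hC₀0.le]
        gcongr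

end
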